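/- arXiv:math/0509077 — 2 statements merged into one kernel-verified Lean document; each statement's English description precedes it below -/
import Mathlib

section
/- (Lemma 4.2 of the paper.) There exists a constant α > 0, depending only on τ and not on N or T, such that for every integer N and every real number T with N ≥ T ≥ 1 there exists a smooth 2π-periodic function u_{N,T}: ℝ → ℂ satisfying: (1) |u_{N,T}(0)| ≤ α·T; (2) û_{N,T}(k) ≥ 0 for all k ∈ ℤ; (3) û_{N,T}(k) ≥ 1 for all k ∈ ℤ with |k − N| ≤ T; (4) |u_{N,T}^♯(λ)| ≤ α·T·N^{−1/2}·(1+|λ|)^{−1/2} + α·T·(1+|λ|)^{−5/2} for all purely imaginary λ with |λ| ≤ N/T; (5) |u_{N,T}^♯(λ)| ≤ α·T·(1+|λ|)^{−5/2} for all purely imaginary λ with |λ| ≥ N/T. -/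
open MeasureTheory

/-- `r ^ z := exp(z · log r)` for `r > 0` (junk value `exp 0 = 1` at `r = 0`). -/
noncomputable def rpowC (r : ℝ) (z : ℂ) : ℂ := Complex.exp (z * (Real.log r : ℂ))

/-- The averaged triple-product kernel
`k_λ(c) = (1/2π)·|sin 2c|^{(−1−λ)/2}·∫₀^{2π} |sin(t−c)|^{(−1−2τ+λ)/2}·|sin(t+c)|^{(−1+2τ+λ)/2} dt`. -/
noncomputable def kKer (τ lam : ℂ) (c : ℝ) : ℂ :=
  (1 / (2 * Real.pi)) * rpowC |Real.sin (2 * c)| ((-1 - lam) / 2) *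
    ∫ t in (0 : ℝ)..(2 * Real.pi),
      rpowC |Real.sin (t - c)| ((-1 - 2 * τ + lam) / 2) *
        rpowC |Real.sin (t + c)| ((-1 + 2 * τ + lam) / 2)

/-- The Fourier coefficient `û(n) = (1/2π)∫₀^{2π} u(c)·e^{−inc} dc` of a 2π-periodic function. -/
noncomputable def fourierCoeff' (u : ℝ → ℂ) (n : ℤ) : ℂ :=
  (1 / (2 * Real.pi)) * ∫ c in (0 : ℝ)..(2 * Real.pi),
    u c * Complex.exp (-Complex.I * (n : ℂ) * (c : ℂ))

/-- The transform `u^♯(λ) = (1/(2π)²)·∫₀^{2π} u(c)·k_λ(c) dc`. -/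
noncomputable def sharpTransform (τ : ℂ) (u : ℝ → ℂ) (lam : ℂ) : ℂ :=
  (1 / (2 * Real.pi) ^ 2) * ∫ c in (0 : ℝ)..(2 * Real.pi), u c * kKer τ lam c

/-- The amplitude `(1 + z²)^{-1/2} · e^{2τ arsinh z}`. -/
noncomputable def symBase (τ : ℂ) (z : ℝ) : ℂ :=
  (((√(1 + z ^ 2))⁻¹ : ℝ) : ℂ) * Complex.exp (2 * τ * (Real.arsinh z : ℂ))

/-- The bounded variable `z / √(1 + z²)`. -/
noncomputable def symVar (z : ℝ) : ℝ := z * (√(1 + z ^ 2))⁻¹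

/-- `symBase` times a polynomial in `symVar`. -/
noncomputable def symPoly (τ : ℂ) (P : Polynomial ℂ) (z : ℝ) : ℂ :=
  symBase τ z * P.eval (symVar z : ℂ)

/-- The action of `√(1 + z²) · d/dz` on the polynomial part of `symPoly`. -/
noncomputable def symDeriv (τ : ℂ) (P : Polynomial ℂ) : Polynomial ℂ :=
  (Polynomial.C (2 * τ) - Polynomial.X) * P + (1 - Polynomial.X ^ 2) * Polynomial.derivative P

/-- The action of `z · d/dz` on the polynomial part of `symPoly`. -/
noncomputable def symEuler (τ : ℂ) (P : Polynomial ℂ) : Polynomial ℂ :=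
  Polynomial.X * symDeriv τ P

lemma hasDerivAt_inv_sqrt_one_add_sq (z : ℝ) :
    HasDerivAt (fun z : ℝ => (√(1 + z ^ 2))⁻¹) (-(symVar z) * ((√(1 + z ^ 2))⁻¹) ^ 2) z := by
  have h1 : 0 < 1 + z ^ 2 := by positivity
  have h2 : HasDerivAt (fun z : ℝ => 1 + z ^ 2) (2 * z) z := by
    simpa using (hasDerivAt_pow 2 z).const_add 1
  have h3 := (h2.sqrt h1.ne').inv (Real.sqrt_ne_zero'.2 h1)
  refine h3.congr_deriv ?_
  have : √(1 + z ^ 2) ≠ 0 := Real.sqrt_ne_zero'.2 h1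
  unfold symVar
  field_simp

lemma hasDerivAt_symVar (z : ℝ) :
    HasDerivAt symVar ((√(1 + z ^ 2))⁻¹ * (1 - symVar z ^ 2)) z := by
  have h1 : 0 < 1 + z ^ 2 := by positivity
  have h3 := (hasDerivAt_id z).mul (hasDerivAt_inv_sqrt_one_add_sq z)
  refine h3.congr_deriv ?_
  unfold symVar
  simp only [id]
  ring

lemma hasDerivAt_symBase (τ : ℂ) (z : ℝ) :
    HasDerivAt (symBase τ)
      ((((√(1 + z ^ 2))⁻¹ : ℝ) : ℂ) * (symBase τ z * (2 * τ - (symVar z : ℂ)))) z := by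
  have h1 := (hasDerivAt_inv_sqrt_one_add_sq z).ofReal_comp
  have h2 := (((Real.hasDerivAt_arsinh z).ofReal_comp).const_mul (2 * τ)).cexp
  refine (h1.mul h2).congr_deriv ?_
  unfold symBase
  push_cast
  ring

lemma hasDerivAt_symPoly (τ : ℂ) (P : Polynomial ℂ) (z : ℝ) :
    HasDerivAt (symPoly τ P)
      ((((√(1 + z ^ 2))⁻¹ : ℝ) : ℂ) * symPoly τ (symDeriv τ P) z) z := by
  have h1 := (hasDerivAt_symVar z).ofReal_comp
  have h2 := (P.hasDerivAt (symVar z : ℂ)).comp z h1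
  refine ((hasDerivAt_symBase τ z).mul h2).congr_deriv ?_
  simp only [symPoly, symDeriv, Function.comp, Polynomial.eval_add, Polynomial.eval_mul,
    Polynomial.eval_sub, Polynomial.eval_C, Polynomial.eval_X, Polynomial.eval_one,
    Polynomial.eval_pow]
  push_cast
  ring

lemma symPoly_symEuler (τ : ℂ) (P : Polynomial ℂ) (z : ℝ) :
    symPoly τ (symEuler τ P) z =
      (z : ℂ) * ((((√(1 + z ^ 2))⁻¹ : ℝ) : ℂ) * symPoly τ (symDeriv τ P) z) := by
  simp only [symPoly, symEuler, symVar, Polynomial.eval_mul, Polynomial.eval_X]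
  push_cast
  ring

lemma abs_symVar_le_one (z : ℝ) : |symVar z| ≤ 1 := by
  have h1 : 0 < √(1 + z ^ 2) := Real.sqrt_pos.2 (by positivity)
  unfold symVar
  rw [abs_mul, abs_of_pos (inv_pos.2 h1), ← div_eq_mul_inv, div_le_one h1]
  exact Real.abs_le_sqrt (by linarith)

lemma norm_symBase {τ : ℂ} (hτ : τ.re = 0) (z : ℝ) : ‖symBase τ z‖ = (√(1 + z ^ 2))⁻¹ := by
  have h1 : 0 < √(1 + z ^ 2) := Real.sqrt_pos.2 (by positivity)
  unfold symBase
  rw [norm_mul, Complex.norm_exp, Complex.norm_real, Real.norm_of_nonneg (inv_pos.2 h1).le]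
  simp [hτ]

lemma exists_norm_symPoly_le {τ : ℂ} (hτ : τ.re = 0) (P : Polynomial ℂ) :
    ∃ C : ℝ, 0 ≤ C ∧ ∀ z, ‖symPoly τ P z‖ ≤ C * (√(1 + z ^ 2))⁻¹ := by
  have hc : ContinuousOn (fun v : ℝ => P.eval (v : ℂ)) (Set.Icc (-1) 1) := by fun_prop
  obtain ⟨C, hC⟩ := isCompact_Icc.exists_bound_of_continuousOn hc
  refine ⟨C, (norm_nonneg _).trans (hC 0 (by norm_num)), fun z => ?_⟩
  unfold symPoly
  rw [norm_mul, norm_symBase hτ, mul_comm]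
  have h1 : 0 < √(1 + z ^ 2) := Real.sqrt_pos.2 (by positivity)
  gcongr
  exact hC _ (abs_le.1 (abs_symVar_le_one z))

lemma continuous_symPoly (τ : ℂ) (P : Polynomial ℂ) : Continuous (symPoly τ P) :=
  continuous_iff_continuousAt.2 fun z => (hasDerivAt_symPoly τ P z).continuousAt

/-- The weight `(1 + p²)^{-(1+λ)/2}`. -/
noncomputable def wt (lam : ℂ) (p : ℝ) : ℂ :=
  Complex.exp (-((1 + lam) / 2) * (Real.log (1 + p ^ 2) : ℂ))

lemma continuous_wt (lam : ℂ) : Continuous (wt lam) := by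
  have : Continuous fun p : ℝ => Real.log (1 + p ^ 2) :=
    Continuous.log (by fun_prop) fun p => by positivity
  unfold wt
  fun_prop

lemma norm_wt {lam : ℂ} (hl : lam.re = 0) (p : ℝ) : ‖wt lam p‖ = (√(1 + p ^ 2))⁻¹ := by
  have h1 : 0 < 1 + p ^ 2 := by positivity
  unfold wt
  rw [Complex.norm_exp, Complex.re_mul_ofReal]
  have : (-((1 + lam) / 2)).re = -(1 / 2) := by simp [hl]
  rw [this, Real.sqrt_eq_rpow, ← Real.rpow_neg h1.le, Real.rpow_def_of_pos h1, mul_comm]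

/-- The amplitude function `δ ↦ ∫ (1 + p²)^{-(1+λ)/2} g(pδ) dp` for `g = symPoly τ P`. -/
noncomputable def ampl (τ : ℂ) (P : Polynomial ℂ) (lam : ℂ) (δ : ℝ) : ℂ :=
  ∫ p : ℝ, wt lam p * symPoly τ P (p * δ)

lemma inv_sqrt_mul_inv_sqrt_le {δ : ℝ} (h0 : 0 < δ) (h1 : δ ≤ 1) (p : ℝ) :
    (√(1 + p ^ 2))⁻¹ * (√(1 + (p * δ) ^ 2))⁻¹ ≤ (1 + (p * δ) ^ 2)⁻¹ := by
  have hp : 0 < 1 + (p * δ) ^ 2 := by positivity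
  have : √(1 + (p * δ) ^ 2) ≤ √(1 + p ^ 2) := by
    apply Real.sqrt_le_sqrt
    have : δ ^ 2 ≤ 1 := by nlinarith
    nlinarith [sq_nonneg p]
  calc _ ≤ (√(1 + (p * δ) ^ 2))⁻¹ * (√(1 + (p * δ) ^ 2))⁻¹ := by
        have := Real.sqrt_pos.2 hp
        gcongr
    _ = _ := by rw [← mul_inv, Real.mul_self_sqrt hp.le]

lemma integrable_inv_one_add_mul_sq {δ : ℝ} (h0 : δ ≠ 0) :
    Integrable fun p : ℝ => (1 + (p * δ) ^ 2)⁻¹ :=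
  integrable_inv_one_add_sq.comp_mul_right' h0

lemma integrable_ampl {τ : ℂ} (hτ : τ.re = 0) (P : Polynomial ℂ) {lam : ℂ} (hl : lam.re = 0)
    {δ : ℝ} (h0 : 0 < δ) (h1 : δ ≤ 1) :
    Integrable fun p : ℝ => wt lam p * symPoly τ P (p * δ) := by
  obtain ⟨C, hC0, hC⟩ := exists_norm_symPoly_le hτ P
  refine ((integrable_inv_one_add_mul_sq h0.ne').const_mul C).mono' ?_ (.of_forall fun p => ?_)
  · exact ((continuous_wt lam).mul
      ((continuous_symPoly τ P).comp (by fun_prop))).aestronglyMeasurable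
  · rw [norm_mul, norm_wt hl]
    calc _ ≤ (√(1 + p ^ 2))⁻¹ * (C * (√(1 + (p * δ) ^ 2))⁻¹) := by gcongr; exact hC _
      _ = C * ((√(1 + p ^ 2))⁻¹ * (√(1 + (p * δ) ^ 2))⁻¹) := by ring
      _ ≤ _ := by gcongr; exact inv_sqrt_mul_inv_sqrt_le h0 h1 p

lemma hasDerivAt_ampl {τ : ℂ} (hτ : τ.re = 0) (P : Polynomial ℂ) {lam : ℂ} (hl : lam.re = 0)
    {δ : ℝ} (h0 : 0 < δ) (h1 : δ < 1) :
    HasDerivAt (ampl τ P lam) ((δ : ℂ)⁻¹ * ampl τ (symEuler τ P) lam δ) δ := by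
  obtain ⟨C, hC0, hC⟩ := exists_norm_symPoly_le hτ (symEuler τ P)
  have hs : Set.Ioo (δ / 2) 1 ∈ nhds δ := Ioo_mem_nhds (by linarith) h1
  have key := hasDerivAt_integral_of_dominated_loc_of_deriv_le (μ := volume) (𝕜 := ℝ)
    (F := fun x p => wt lam p * symPoly τ P (p * x))
    (F' := fun x p => (x : ℂ)⁻¹ * (wt lam p * symPoly τ (symEuler τ P) (p * x)))
    (bound := fun p => (2 / δ) * (C * (1 + (p * (δ / 2)) ^ 2)⁻¹)) hs
    (.of_forall fun x => ((continuous_wt lam).mul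
      ((continuous_symPoly τ P).comp (by fun_prop))).aestronglyMeasurable)
    (integrable_ampl hτ P hl h0 h1.le)
    ((integrable_ampl hτ _ hl h0 h1.le).const_mul _).aestronglyMeasurable
    (.of_forall fun p x hx => ?_)
    (((integrable_inv_one_add_mul_sq (by positivity)).const_mul C).const_mul _)
    (.of_forall fun p x hx => ?_)
  · have := key.2
    rw [integral_const_mul] at this
    exact this
  · have hx0 : 0 < x := by have := hx.1; linarith
    rw [norm_mul, norm_mul, norm_wt hl, norm_inv, Complex.norm_real, Real.norm_of_nonneg hx0.le]
    have e1 : x⁻¹ ≤ 2 / δ := by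
      rw [inv_le_comm₀ hx0 (by positivity), inv_div]; exact hx.1.le
    have e2 : (1 + (p * x) ^ 2)⁻¹ ≤ (1 + (p * (δ / 2)) ^ 2)⁻¹ := by
      have := hx.1.le
      rw [mul_pow, mul_pow]
      gcongr
    calc _ ≤ x⁻¹ * ((√(1 + p ^ 2))⁻¹ * (C * (√(1 + (p * x) ^ 2))⁻¹)) := by gcongr; exact hC _
      _ = x⁻¹ * (C * ((√(1 + p ^ 2))⁻¹ * (√(1 + (p * x) ^ 2))⁻¹)) := by ring
      _ ≤ x⁻¹ * (C * (1 + (p * x) ^ 2)⁻¹) := by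
        gcongr; exact inv_sqrt_mul_inv_sqrt_le hx0 hx.2.le p
      _ ≤ _ := by gcongr
  · have hx0 : 0 < x := by have := hx.1; linarith
    have h2 : HasDerivAt (fun x : ℝ => p * x) p x := by simpa using (hasDerivAt_id x).const_mul p
    have h3 := ((hasDerivAt_symPoly τ P (p * x)).scomp x h2).const_mul (wt lam p)
    refine h3.congr_deriv ?_
    rw [symPoly_symEuler]
    have : (x : ℂ) ≠ 0 := by exact_mod_cast hx0.ne'
    simp only [Complex.real_smul]
    push_cast
    field_simp

lemma continuousOn_ampl {τ : ℂ} (hτ : τ.re = 0) (P : Polynomial ℂ) {lam : ℂ} (hl : lam.re = 0) :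
    ContinuousOn (ampl τ P lam) (Set.Ioo 0 1) := fun _ hδ =>
  (hasDerivAt_ampl hτ P hl hδ.1 hδ.2).continuousAt.continuousWithinAt

lemma exists_norm_ampl_le_rpow {τ : ℂ} (hτ : τ.re = 0) (P : Polynomial ℂ) :
    ∃ C : ℝ, 0 ≤ C ∧ ∀ lam : ℂ, lam.re = 0 → ∀ δ : ℝ, 0 < δ → δ ≤ 1 →
      ‖ampl τ P lam δ‖ ≤ C * δ ^ (-(1 / 4) : ℝ) := by
  obtain ⟨C, hC0, hC⟩ := exists_norm_symPoly_le hτ P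
  have h_int : Integrable fun p : ℝ => (1 + ‖p‖ ^ 2) ^ (-(5 / 4 : ℝ) / 2) :=
    integrable_rpow_neg_one_add_norm_sq (by norm_num)
  refine ⟨C * ∫ p : ℝ, (1 + ‖p‖ ^ 2) ^ (-(5 / 4 : ℝ) / 2),
    mul_nonneg hC0 (integral_nonneg fun p => by positivity), fun lam hl δ h0 h1 => ?_⟩
  have : ‖ampl τ P lam δ‖ ≤ ∫ p : ℝ, (C * δ ^ (-(1 / 4) : ℝ)) * (1 + ‖p‖ ^ 2) ^ (-(5 / 4 : ℝ) / 2) := by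
    refine norm_integral_le_of_norm_le (h_int.const_mul _) (.of_forall fun p => ?_)
    rw [norm_mul, norm_wt hl]
    have hp : 0 < 1 + p ^ 2 := by positivity
    have hpd : 0 < 1 + (p * δ) ^ 2 := by positivity
    have e1 : (√(1 + (p * δ) ^ 2))⁻¹ ≤ δ ^ (-(1 / 4) : ℝ) * (1 + p ^ 2) ^ (-(1 / 8) : ℝ) := by
      rw [Real.sqrt_eq_rpow, ← Real.rpow_neg hpd.le]
      have a1 : δ ^ 2 * (1 + p ^ 2) ≤ 1 + (p * δ) ^ 2 := by nlinarith
      have a2 : (1:ℝ) ≤ 1 + (p * δ) ^ 2 := by nlinarith [sq_nonneg (p * δ)]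
      calc (1 + (p * δ) ^ 2) ^ (-(1 / 2) : ℝ) ≤ (1 + (p * δ) ^ 2) ^ (-(1 / 8) : ℝ) :=
            Real.rpow_le_rpow_of_exponent_le a2 (by norm_num)
        _ ≤ (δ ^ 2 * (1 + p ^ 2)) ^ (-(1 / 8) : ℝ) :=
            Real.rpow_le_rpow_of_nonpos (by positivity) a1 (by norm_num)
        _ = _ := by
            rw [Real.mul_rpow (by positivity) hp.le, ← Real.rpow_natCast, ← Real.rpow_mul h0.le]
            norm_num
    have e2 : (√(1 + p ^ 2))⁻¹ = (1 + p ^ 2) ^ (-(1 / 2) : ℝ) := by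
      rw [Real.sqrt_eq_rpow, ← Real.rpow_neg hp.le]
    calc _ ≤ (√(1 + p ^ 2))⁻¹ * (C * (√(1 + (p * δ) ^ 2))⁻¹) := by gcongr; exact hC _
      _ ≤ (√(1 + p ^ 2))⁻¹ * (C * (δ ^ (-(1 / 4) : ℝ) * (1 + p ^ 2) ^ (-(1 / 8) : ℝ))) := by gcongr
      _ = (C * δ ^ (-(1 / 4) : ℝ)) * ((1 + p ^ 2) ^ (-(1 / 2) : ℝ) * (1 + p ^ 2) ^ (-(1 / 8) : ℝ)) := by
          rw [e2]; ring
      _ = _ := by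
          rw [← Real.rpow_add hp, Real.norm_eq_abs, sq_abs]; norm_num
  rw [integral_const_mul] at this
  linarith

lemma hasDerivAt_log_one_add_sq_cexp (lam : ℂ) (p : ℝ) :
    HasDerivAt (fun p : ℝ => Complex.exp (-(lam / 2) * (Real.log (1 + p ^ 2) : ℂ)))
      (Complex.exp (-(lam / 2) * (Real.log (1 + p ^ 2) : ℂ)) * (-lam * (p / (1 + p ^ 2) : ℝ))) p := by
  have h1 : 0 < 1 + p ^ 2 := by positivity
  have h2 : HasDerivAt (fun z : ℝ => 1 + z ^ 2) (2 * p) p := by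
    simpa using (hasDerivAt_pow 2 p).const_add 1
  refine ((h2.log h1.ne').ofReal_comp.const_mul (-(lam / 2))).cexp.congr_deriv ?_
  push_cast
  ring

lemma wt_eq (lam : ℂ) (p : ℝ) :
    wt lam p = Complex.exp (-(lam / 2) * (Real.log (1 + p ^ 2) : ℂ)) *
      (((√(1 + p ^ 2))⁻¹ : ℝ) : ℂ) := by
  have h1 : 0 < 1 + p ^ 2 := by positivity
  rw [Real.sqrt_eq_rpow, ← Real.rpow_neg h1.le, Real.rpow_def_of_pos h1, Complex.ofReal_exp,
    ← Complex.exp_add, wt]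
  congr 1
  push_cast
  ring

/-- The multiplier used to integrate by parts against the phase `log (1 + p²)`. -/
noncomputable def mult (ε p : ℝ) : ℝ := √(1 + p ^ 2) * (p / (p ^ 2 + ε))

lemma hasDerivAt_mult {ε : ℝ} (hε : 0 < ε) (p : ℝ) :
    HasDerivAt (mult ε)
      ((ε + p ^ 2 * (2 * ε - 1)) / ((p ^ 2 + ε) ^ 2 * √(1 + p ^ 2))) p := by
  have h1 : 0 < 1 + p ^ 2 := by positivity
  have h2 : 0 < p ^ 2 + ε := by positivity
  have hs : √(1 + p ^ 2) ≠ 0 := Real.sqrt_ne_zero'.2 h1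
  have hss : √(1 + p ^ 2) ^ 2 = 1 + p ^ 2 := Real.sq_sqrt h1.le
  have a1 : HasDerivAt (fun z : ℝ => 1 + z ^ 2) (2 * p) p := by
    simpa using (hasDerivAt_pow 2 p).const_add 1
  have a2 : HasDerivAt (fun z : ℝ => z ^ 2 + ε) (2 * p) p := by
    simpa using (hasDerivAt_pow 2 p).add_const ε
  refine ((a1.sqrt h1.ne').mul ((hasDerivAt_id p).div a2 h2.ne')).congr_deriv ?_
  simp only [id, Pi.div_apply]
  field_simp
  rw [hss]
  ring

lemma abs_deriv_mult_le {ε : ℝ} (hε : 0 < ε) (hε1 : ε ≤ 1) (p : ℝ) :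
    |(ε + p ^ 2 * (2 * ε - 1)) / ((p ^ 2 + ε) ^ 2 * √(1 + p ^ 2))| ≤ (p ^ 2 + ε)⁻¹ := by
  have h2 : 0 < p ^ 2 + ε := by positivity
  have hs : 1 ≤ √(1 + p ^ 2) := Real.one_le_sqrt.2 (by nlinarith [sq_nonneg p])
  have hs0 : 0 < √(1 + p ^ 2) := by linarith
  have h3 : |ε + p ^ 2 * (2 * ε - 1)| ≤ p ^ 2 + ε := by
    rw [abs_le]; constructor <;> nlinarith [sq_nonneg p]
  rw [abs_div, abs_of_pos (a := (p ^ 2 + ε) ^ 2 * √(1 + p ^ 2)) (by positivity),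
    div_le_iff₀ (by positivity)]
  calc _ ≤ p ^ 2 + ε := h3
    _ ≤ (p ^ 2 + ε) * √(1 + p ^ 2) := by nlinarith
    _ = _ := by field_simp

lemma abs_mult_le {L : ℝ} (hL : 1 ≤ L) (p : ℝ) : |mult L⁻¹ p| ≤ 2 * √L := by
  have hL0 : 0 < L := by linarith
  have hs : 1 ≤ √L := Real.one_le_sqrt.2 hL
  have hss : √L ^ 2 = L := Real.sq_sqrt hL0.le
  have h2 : 0 < p ^ 2 + L⁻¹ := by positivity
  have h1 : √(1 + p ^ 2) ≤ 1 + |p| := by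
    rw [Real.sqrt_le_left (by positivity)]
    nlinarith [abs_nonneg p, sq_abs p]
  have h0 : 0 ≤ √(1 + p ^ 2) := Real.sqrt_nonneg _
  unfold mult
  rw [abs_mul, abs_of_nonneg h0, abs_div, abs_of_pos h2, ← mul_div_assoc, div_le_iff₀ h2]
  have h4 : (√L)⁻¹ * √L = 1 := inv_mul_cancel₀ (by positivity)
  have h5 : L⁻¹ = ((√L)⁻¹) ^ 2 := by rw [inv_pow, hss]
  have h7 : 0 < (√L)⁻¹ := by positivity
  rw [h5]
  set s := √L
  set t := (√L)⁻¹
  have h6 := sq_abs p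
  calc √(1 + p ^ 2) * |p| ≤ (1 + |p|) * |p| := by gcongr
    _ ≤ 2 * s * (p ^ 2 + t ^ 2) := by
      have : |p| ≤ s * (p ^ 2 + t ^ 2) := by
        rw [← h6]
        nlinarith [sq_nonneg (|p| - t), abs_nonneg p, mul_nonneg (by linarith : 0 ≤ s) (sq_nonneg (|p| - t))]
      nlinarith [sq_nonneg p, sq_nonneg t, mul_nonneg (by linarith : 0 ≤ s - 1) (sq_nonneg p)]

lemma integral_inv_sq_add {L : ℝ} (hL : 1 ≤ L) :
    Integrable (fun p : ℝ => (p ^ 2 + L⁻¹)⁻¹) ∧ ∫ p : ℝ, (p ^ 2 + L⁻¹)⁻¹ = Real.pi * √L := by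
  have hL0 : 0 < L := by linarith
  have hs : 0 < √L := Real.sqrt_pos.2 hL0
  have hss : √L ^ 2 = L := Real.sq_sqrt hL0.le
  have e : (fun p : ℝ => (p ^ 2 + L⁻¹)⁻¹) = fun p : ℝ => L * (1 + (p * √L) ^ 2)⁻¹ := by
    funext p
    have : 0 < p ^ 2 + L⁻¹ := by positivity
    rw [mul_pow, hss]
    field_simp
    ring
  rw [e]
  refine ⟨(integrable_inv_one_add_mul_sq hs.ne').const_mul L, ?_⟩
  rw [integral_const_mul, Measure.integral_comp_mul_right (fun x : ℝ => (1 + x ^ 2)⁻¹),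
    integral_univ_inv_one_add_sq, abs_of_pos (inv_pos.2 hs), smul_eq_mul]
  field_simp
  rw [hss]

lemma exists_norm_ampl_le {τ : ℂ} (hτ : τ.re = 0) (P : Polynomial ℂ) :
    ∃ C : ℝ, 0 ≤ C ∧ ∀ lam : ℂ, lam.re = 0 → 1 ≤ ‖lam‖ → ∀ δ : ℝ, 0 < δ → δ ≤ 1 →
      ‖ampl τ P lam δ‖ ≤ C * (√‖lam‖)⁻¹ := by
  obtain ⟨C, hC0, hC⟩ := exists_norm_symPoly_le hτ P
  obtain ⟨C', hC0', hC'⟩ := exists_norm_symPoly_le hτ (symDeriv τ P)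
  refine ⟨2 * Real.pi * (C + C'), by positivity, fun lam hl hL δ h0 h1 => ?_⟩
  set L := ‖lam‖ with hLdef
  have hL0 : 0 < L := by linarith
  have hLi : L⁻¹ ≤ 1 := inv_le_one_of_one_le₀ hL
  have hs : 0 < √L := Real.sqrt_pos.2 hL0
  have hss : √L * √L = L := Real.mul_self_sqrt hL0.le
  set φ : ℝ → ℂ := fun p => Complex.exp (-(lam / 2) * (Real.log (1 + p ^ 2) : ℂ)) with hφ
  have nφ : ∀ p, ‖φ p‖ = 1 := fun p => by
    rw [hφ]; simp only; rw [Complex.norm_exp, Complex.re_mul_ofReal]; simp [hl]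
  set k' : ℝ → ℝ := fun p => (L⁻¹ + p ^ 2 * (2 * L⁻¹ - 1)) / ((p ^ 2 + L⁻¹) ^ 2 * √(1 + p ^ 2))
    with hk'
  set R : ℝ → ℂ := fun p => φ p * (lam * (((√(1 + p ^ 2))⁻¹ * (L⁻¹ / (p ^ 2 + L⁻¹)) : ℝ) : ℂ) *
    symPoly τ P (p * δ) + (k' p : ℂ) * symPoly τ P (p * δ) +
    (mult L⁻¹ p : ℂ) * ((δ * (√(1 + (p * δ) ^ 2))⁻¹ : ℝ) * symPoly τ (symDeriv τ P) (p * δ)))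
    with hR
  have hLp : ∀ p : ℝ, 0 < p ^ 2 + L⁻¹ := fun p => by positivity
  have hsp : ∀ p : ℝ, 0 < √(1 + p ^ 2) := fun p => Real.sqrt_pos.2 (by positivity)
  have hF : ∀ p : ℝ, HasDerivAt (fun p => φ p * ((mult L⁻¹ p : ℂ) * symPoly τ P (p * δ)))
      (R p - lam * (wt lam p * symPoly τ P (p * δ))) p := by
    intro p
    have a1 := (hasDerivAt_mult (inv_pos.2 hL0) p).ofReal_comp
    have a2 : HasDerivAt (fun x : ℝ => x * δ) δ p := by
      simpa using (hasDerivAt_id p).mul_const δ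
    have a3 := (hasDerivAt_symPoly τ P (p * δ)).scomp p a2
    refine ((hasDerivAt_log_one_add_sq_cexp lam p).mul (a1.mul a3)).congr_deriv ?_
    have e : p / (1 + p ^ 2) * mult L⁻¹ p =
        (√(1 + p ^ 2))⁻¹ - (√(1 + p ^ 2))⁻¹ * (L⁻¹ / (p ^ 2 + L⁻¹)) := by
      have := hLp p
      have h3 := (hsp p).ne'
      have : √(1 + p ^ 2) ^ 2 = 1 + p ^ 2 := Real.sq_sqrt (by positivity)
      have : (1 + p ^ 2) ≠ 0 := by positivity
      unfold mult
      field_simp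
      grind
    have e' := congrArg (fun x : ℝ => (x : ℂ)) e
    simp only [Complex.ofReal_mul, Complex.ofReal_sub] at e'
    rw [hR, wt_eq]
    simp only [hφ, Function.comp, Complex.real_smul, Complex.ofReal_mul, Pi.mul_apply]
    linear_combination (-lam * (Complex.exp (-(lam / 2) * (Real.log (1 + p ^ 2) : ℂ))) *
      symPoly τ P (p * δ)) * e'
  have nR : ∀ p, ‖R p‖ ≤ 2 * C * (p ^ 2 + L⁻¹)⁻¹ + 2 * √L * C' * δ * (1 + (p * δ) ^ 2)⁻¹ := by
    intro p
    have b1 : (√(1 + p ^ 2))⁻¹ ≤ 1 :=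
      inv_le_one_of_one_le₀ (Real.one_le_sqrt.2 (by nlinarith [sq_nonneg p]))
    have b1' : (√(1 + (p * δ) ^ 2))⁻¹ ≤ 1 :=
      inv_le_one_of_one_le₀ (Real.one_le_sqrt.2 (by nlinarith [sq_nonneg (p * δ)]))
    have b2 : ‖symPoly τ P (p * δ)‖ ≤ C :=
      (hC _).trans (mul_le_of_le_one_right hC0 b1')
    have := hLp p
    have := hsp p
    have := hsp (p * δ)
    rw [hR]
    simp only
    rw [norm_mul, nφ, one_mul]
    refine (norm_add₃_le).trans ?_
    have c1 : ‖lam * (((√(1 + p ^ 2))⁻¹ * (L⁻¹ / (p ^ 2 + L⁻¹)) : ℝ) : ℂ) *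
        symPoly τ P (p * δ)‖ ≤ C * (p ^ 2 + L⁻¹)⁻¹ := by
      rw [norm_mul, norm_mul, Complex.norm_real, Real.norm_of_nonneg (by positivity)]
      calc _ ≤ L * (1 * (L⁻¹ / (p ^ 2 + L⁻¹))) * C := by gcongr
        _ = _ := by field_simp
    have c2 : ‖(k' p : ℂ) * symPoly τ P (p * δ)‖ ≤ C * (p ^ 2 + L⁻¹)⁻¹ := by
      rw [norm_mul, Complex.norm_real, mul_comm]
      gcongr
      exact abs_deriv_mult_le (inv_pos.2 hL0) hLi p
    have c3 : ‖(mult L⁻¹ p : ℂ) * ((δ * (√(1 + (p * δ) ^ 2))⁻¹ : ℝ) *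
        symPoly τ (symDeriv τ P) (p * δ))‖ ≤ 2 * √L * C' * δ * (1 + (p * δ) ^ 2)⁻¹ := by
      rw [norm_mul, norm_mul, Complex.norm_real, Complex.norm_real,
        Real.norm_of_nonneg (r := δ * _) (by positivity)]
      calc _ ≤ (2 * √L) * (δ * (√(1 + (p * δ) ^ 2))⁻¹ * (C' * (√(1 + (p * δ) ^ 2))⁻¹)) := by
            gcongr
            · exact abs_mult_le hL p
            · exact hC' _
        _ = 2 * √L * C' * δ * ((√(1 + (p * δ) ^ 2))⁻¹ * (√(1 + (p * δ) ^ 2))⁻¹) := by ring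
        _ = _ := by rw [← mul_inv, Real.mul_self_sqrt (by positivity)]
    linarith
  have hdom : Integrable fun p : ℝ =>
      2 * C * (p ^ 2 + L⁻¹)⁻¹ + 2 * √L * C' * δ * (1 + (p * δ) ^ 2)⁻¹ :=
    ((integral_inv_sq_add hL).1.const_mul _).add
      ((integrable_inv_one_add_mul_sq h0.ne').const_mul _)
  have cφ : Continuous φ := continuous_iff_continuousAt.2 fun p =>
    (hasDerivAt_log_one_add_sq_cexp lam p).continuousAt
  have cP : ∀ Q : Polynomial ℂ, Continuous fun p : ℝ => symPoly τ Q (p * δ) := fun Q =>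
    (continuous_symPoly τ Q).comp (by fun_prop)
  have cm : Continuous (mult L⁻¹) := continuous_iff_continuousAt.2 fun p =>
    (hasDerivAt_mult (inv_pos.2 hL0) p).continuousAt
  have ck : Continuous k' := by
    refine Continuous.div (by fun_prop) (by fun_prop) fun p => ?_
    exact mul_ne_zero (pow_ne_zero _ (hLp p).ne') (hsp p).ne'
  have c4 : Continuous fun p : ℝ => (√(1 + p ^ 2))⁻¹ := Continuous.inv₀ (by fun_prop) fun p => (hsp p).ne'
  have c5 : Continuous fun p : ℝ => (√(1 + (p * δ) ^ 2))⁻¹ :=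
    Continuous.inv₀ (by fun_prop) fun p => (hsp (p * δ)).ne'
  have c6 : Continuous fun p : ℝ => L⁻¹ / (p ^ 2 + L⁻¹) :=
    Continuous.div (by fun_prop) (by fun_prop) fun p => (hLp p).ne'
  have cR : Continuous R := by
    have := cP P
    have := cP (symDeriv τ P)
    fun_prop
  have iR : Integrable R := hdom.mono' cR.aestronglyMeasurable (.of_forall nR)
  have iw := integrable_ampl hτ P hl h0 h1
  have lim : ∀ l : Filter ℝ, Filter.Tendsto (fun p : ℝ => 1 + (p * δ) ^ 2) l Filter.atTop →
      Filter.Tendsto (fun p => φ p * ((mult L⁻¹ p : ℂ) * symPoly τ P (p * δ))) l (nhds 0) := by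
    intro l hl'
    have t1 : Filter.Tendsto (fun p : ℝ => 2 * √L * C * (√(1 + (p * δ) ^ 2))⁻¹) l (nhds 0) := by
      have := ((Real.tendsto_sqrt_atTop.comp hl').inv_tendsto_atTop).const_mul (2 * √L * C)
      simpa using this
    refine squeeze_zero_norm (fun p => ?_) t1
    rw [norm_mul, nφ, one_mul, norm_mul, Complex.norm_real]
    calc _ ≤ (2 * √L) * (C * (√(1 + (p * δ) ^ 2))⁻¹) := by
          gcongr
          · exact abs_mult_le hL p
          · exact hC _
      _ = _ := by ring
  have tT : Filter.Tendsto (fun p : ℝ => 1 + (p * δ) ^ 2) Filter.atTop Filter.atTop :=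
    Filter.tendsto_atTop_add_const_left _ _
      ((Filter.tendsto_pow_atTop two_ne_zero).comp (Filter.tendsto_id.atTop_mul_const h0))
  have tB : Filter.Tendsto (fun p : ℝ => 1 + (p * δ) ^ 2) Filter.atBot Filter.atTop := by
    have := tT.comp Filter.tendsto_neg_atBot_atTop
    refine this.congr fun p => ?_
    simp
  have key := integral_of_hasDerivAt_of_tendsto hF (iR.sub (iw.const_mul lam)) (lim _ tB) (lim _ tT)
  rw [integral_sub iR (iw.const_mul lam), integral_const_mul, sub_zero, sub_eq_zero] at key
  have fin : L * ‖ampl τ P lam δ‖ ≤ 2 * C * (Real.pi * √L) + 2 * √L * C' * Real.pi := by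
    have : L * ‖ampl τ P lam δ‖ = ‖∫ p, R p‖ := by rw [key, norm_mul]; rfl
    rw [this]
    refine (norm_integral_le_of_norm_le hdom (.of_forall nR)).trans_eq ?_
    rw [integral_add ((integral_inv_sq_add hL).1.const_mul _)
      ((integrable_inv_one_add_mul_sq h0.ne').const_mul _), integral_const_mul,
      integral_const_mul, (integral_inv_sq_add hL).2,
      Measure.integral_comp_mul_right (fun x : ℝ => (1 + x ^ 2)⁻¹),
      integral_univ_inv_one_add_sq, abs_of_pos (inv_pos.2 h0), smul_eq_mul]
    field_simp
  rw [← div_eq_mul_inv, le_div_iff₀ hs]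
  have : √L * (‖ampl τ P lam δ‖ * √L) ≤ √L * (2 * Real.pi * (C + C')) := by
    calc _ = √L * √L * ‖ampl τ P lam δ‖ := by ring
      _ ≤ 2 * C * (Real.pi * √L) + 2 * √L * C' * Real.pi := by rw [hss]; exact fin
      _ = _ := by ring
  exact le_of_mul_le_mul_left this hs

/-- The change of variables `sin t = sin c · p / √(1 + p²)`. -/
noncomputable def angle (c p : ℝ) : ℝ := Real.arcsin (Real.sin c * symVar p)

lemma one_sub_symVar_sq (p : ℝ) : 1 - symVar p ^ 2 = (1 + p ^ 2)⁻¹ := by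
  have h1 : 0 < 1 + p ^ 2 := by positivity
  have h2 : √(1 + p ^ 2) ^ 2 = 1 + p ^ 2 := Real.sq_sqrt h1.le
  unfold symVar
  rw [mul_pow, inv_pow, h2]
  field_simp
  ring

lemma symVar_sq_lt_one (p : ℝ) : symVar p ^ 2 < 1 := by
  have h : 0 < (1 + p ^ 2)⁻¹ := by positivity
  rw [← one_sub_symVar_sq] at h
  linarith

lemma one_sub_sin_mul_symVar_sq (c p : ℝ) :
    1 - (Real.sin c * symVar p) ^ 2 = (1 + (p * Real.cos c) ^ 2) / (1 + p ^ 2) := by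
  have h1 : 0 < 1 + p ^ 2 := by positivity
  have h2 : symVar p ^ 2 = 1 - (1 + p ^ 2)⁻¹ := by linarith [one_sub_symVar_sq p]
  rw [mul_pow, h2, mul_pow, Real.cos_sq']
  field_simp
  ring

lemma symVar_div_sqrt {v : ℝ} (h : 0 < 1 - v ^ 2) : symVar (v / √(1 - v ^ 2)) = v := by
  have v4 : √(1 - v ^ 2) ^ 2 = 1 - v ^ 2 := Real.sq_sqrt h.le
  have v5 : 0 < √(1 - v ^ 2) := Real.sqrt_pos.2 h
  unfold symVar
  rw [div_pow, v4]
  have : 1 + v ^ 2 / (1 - v ^ 2) = (1 - v ^ 2)⁻¹ := by field_simp; ring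
  rw [this, Real.sqrt_inv, inv_inv]
  field_simp

lemma sin_angle (c p : ℝ) : Real.sin (angle c p) = Real.sin c * symVar p := by
  have h : 0 < 1 - (Real.sin c * symVar p) ^ 2 := by
    rw [one_sub_sin_mul_symVar_sq]; positivity
  have h2 : |Real.sin c * symVar p| ≤ 1 := by
    rw [← sq_le_one_iff_abs_le_one]; linarith
  exact Real.sin_arcsin (abs_le.1 h2).1 (abs_le.1 h2).2

lemma cos_angle (c p : ℝ) :
    Real.cos (angle c p) = √(1 + (p * Real.cos c) ^ 2) * (√(1 + p ^ 2))⁻¹ := by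
  rw [angle, Real.cos_arcsin, one_sub_sin_mul_symVar_sq, Real.sqrt_div (by positivity),
    div_eq_mul_inv]

lemma hasDerivAt_angle (c p : ℝ) :
    HasDerivAt (angle c)
      (Real.sin c * (1 + p ^ 2)⁻¹ * (√(1 + (p * Real.cos c) ^ 2))⁻¹) p := by
  have h : 0 < 1 - (Real.sin c * symVar p) ^ 2 := by
    rw [one_sub_sin_mul_symVar_sq]; positivity
  have n1 : Real.sin c * symVar p ≠ -1 := fun h' => by rw [h'] at h; norm_num at h
  have n2 : Real.sin c * symVar p ≠ 1 := fun h' => by rw [h'] at h; norm_num at h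
  have a := (Real.hasDerivAt_arcsin n1 n2).comp p ((hasDerivAt_symVar p).const_mul (Real.sin c))
  refine a.congr_deriv ?_
  have e1 : 0 < √(1 + p ^ 2) := Real.sqrt_pos.2 (by positivity)
  have e2 : 0 < √(1 + (p * Real.cos c) ^ 2) := Real.sqrt_pos.2 (by positivity)
  rw [one_sub_sin_mul_symVar_sq, Real.sqrt_div (by positivity), one_sub_symVar_sq]
  field_simp

lemma sin_sub_angle (c p : ℝ) :
    Real.sin (c - angle c p) =
      Real.sin c * (√(1 + p ^ 2))⁻¹ * Real.exp (-Real.arsinh (p * Real.cos c)) := by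
  rw [Real.sin_sub, sin_angle, cos_angle, ← Real.arsinh_neg, Real.exp_arsinh, symVar, neg_sq]
  ring

lemma sin_add_angle (c p : ℝ) :
    Real.sin (c + angle c p) =
      Real.sin c * (√(1 + p ^ 2))⁻¹ * Real.exp (Real.arsinh (p * Real.cos c)) := by
  rw [Real.sin_add, sin_angle, cos_angle, Real.exp_arsinh, symVar]
  ring

lemma angle_injective {c : ℝ} (h0 : 0 < c) (h1 : c < Real.pi / 2) :
    Function.Injective (angle c) := by
  have hs : 0 < Real.sin c := Real.sin_pos_of_pos_of_lt_pi h0 (by linarith [Real.pi_pos])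
  refine (strictMono_of_deriv_pos fun p => ?_).injective
  rw [(hasDerivAt_angle c p).deriv]
  have e2 : 0 < √(1 + (p * Real.cos c) ^ 2) := Real.sqrt_pos.2 (by positivity)
  positivity

lemma range_angle {c : ℝ} (h0 : 0 < c) (h1 : c < Real.pi / 2) :
    angle c '' Set.univ = Set.Ioo (-c) c := by
  have hs : 0 < Real.sin c := Real.sin_pos_of_pos_of_lt_pi h0 (by linarith [Real.pi_pos])
  ext t
  constructor
  · rintro ⟨p, -, rfl⟩
    have hv := abs_lt.1 ((sq_lt_one_iff_abs_lt_one _).1 (symVar_sq_lt_one p))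
    have b1 : Real.sin (angle c p) < Real.sin c := by rw [sin_angle]; nlinarith
    have b2 : Real.sin (-c) < Real.sin (angle c p) := by
      rw [sin_angle, Real.sin_neg]; nlinarith
    have m := Real.arcsin_mem_Icc (Real.sin c * symVar p)
    constructor
    · by_contra hh
      have := Real.sin_le_sin_of_le_of_le_pi_div_two m.1 (by linarith) (not_lt.1 hh)
      exact absurd b2 (not_lt.2 this)
    · by_contra hh
      have := Real.sin_le_sin_of_le_of_le_pi_div_two (by linarith) m.2 (not_lt.1 hh)
      exact absurd b1 (not_lt.2 this)
  · rintro ⟨t1, t2⟩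
    have b1 : Real.sin t < Real.sin c :=
      Real.sin_lt_sin_of_lt_of_le_pi_div_two (by linarith) (by linarith) t2
    have b2 : -Real.sin c < Real.sin t := by
      rw [← Real.sin_neg]
      exact Real.sin_lt_sin_of_lt_of_le_pi_div_two (by linarith) (by linarith) t1
    set v := Real.sin t / Real.sin c with hv
    have v1 : v < 1 := by rw [hv, div_lt_one hs]; exact b1
    have v2 : -1 < v := by rw [hv, lt_div_iff₀ hs]; linarith
    have v3 : 0 < 1 - v ^ 2 := by nlinarith
    refine ⟨v / √(1 - v ^ 2), trivial, ?_⟩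
    rw [angle, symVar_div_sqrt v3, hv, mul_div_cancel₀ _ hs.ne']
    exact Real.arcsin_sin (by linarith) (by linarith)

/-- The integrand of the inner integral in `kKer`. -/
noncomputable def kerIntegrand (τ lam : ℂ) (c t : ℝ) : ℂ :=
  rpowC |Real.sin (t - c)| ((-1 - 2 * τ + lam) / 2) *
    rpowC |Real.sin (t + c)| ((-1 + 2 * τ + lam) / 2)

lemma kerIntegrand_angle (τ lam : ℂ) {c : ℝ} (h0 : 0 < c) (h1 : c < Real.pi / 2) (p : ℝ) :
    |Real.sin c * (1 + p ^ 2)⁻¹ * (√(1 + (p * Real.cos c) ^ 2))⁻¹| •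
      kerIntegrand τ lam c (angle c p) =
    rpowC (Real.sin c) lam * (wt lam p * symPoly τ 1 (p * Real.cos c)) := by
  have hs : 0 < Real.sin c := Real.sin_pos_of_pos_of_lt_pi h0 (by linarith [Real.pi_pos])
  have hp : 0 < 1 + p ^ 2 := by positivity
  have e1 : 0 < √(1 + p ^ 2) := Real.sqrt_pos.2 hp
  have e2 : 0 < √(1 + (p * Real.cos c) ^ 2) := Real.sqrt_pos.2 (by positivity)
  have l1 : Real.log |Real.sin (angle c p - c)| =
      Real.log (Real.sin c) - Real.log (1 + p ^ 2) / 2 - Real.arsinh (p * Real.cos c) := by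
    rw [← neg_sub, Real.sin_neg, abs_neg, sin_sub_angle, Real.log_abs,
      Real.log_mul (by positivity) (Real.exp_pos _).ne', Real.log_exp,
      Real.log_mul hs.ne' (by positivity), Real.log_inv, Real.log_sqrt hp.le]
    ring
  have l2 : Real.log |Real.sin (angle c p + c)| =
      Real.log (Real.sin c) - Real.log (1 + p ^ 2) / 2 + Real.arsinh (p * Real.cos c) := by
    rw [add_comm, sin_add_angle, Real.log_abs,
      Real.log_mul (by positivity) (Real.exp_pos _).ne', Real.log_exp,
      Real.log_mul hs.ne' (by positivity), Real.log_inv, Real.log_sqrt hp.le]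
    ring
  have e3 : Real.sin c * (1 + p ^ 2)⁻¹ = Real.exp (Real.log (Real.sin c) - Real.log (1 + p ^ 2)) := by
    rw [Real.exp_sub, Real.exp_log hs, Real.exp_log hp, div_eq_mul_inv]
  rw [abs_of_pos (by positivity), e3, Complex.real_smul, Complex.ofReal_mul, Complex.ofReal_exp,
    kerIntegrand, rpowC, rpowC, rpowC, l1, l2, wt, symPoly, symBase, Polynomial.eval_one, mul_one]
  have : ∀ a b d x e f g : ℂ, a * (b * d) = e * (f * g) → a * x * (b * d) = e * (f * (x * g)) := by
    intro a b d x e f g h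
    linear_combination x * h
  apply this
  rw [← Complex.exp_add, ← Complex.exp_add, ← Complex.exp_add, ← Complex.exp_add]
  congr 1
  push_cast
  ring

lemma intervalIntegrable_kerIntegrand_core {τ lam : ℂ} (hτ : τ.re = 0) (hl : lam.re = 0) {c : ℝ}
    (h0 : 0 < c) (h1 : c < Real.pi / 2) :
    IntervalIntegrable (kerIntegrand τ lam c) volume (-c) c := by
  rw [intervalIntegrable_iff_integrableOn_Ioo_of_le (by linarith), ← range_angle h0 h1,
    integrableOn_image_iff_integrableOn_abs_deriv_smul MeasurableSet.univ
      (fun p _ => (hasDerivAt_angle c p).hasDerivWithinAt) (angle_injective h0 h1).injOn]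
  simp only [kerIntegrand_angle τ lam h0 h1, integrableOn_univ]
  exact (integrable_ampl hτ 1 hl (Real.cos_pos_of_mem_Ioo ⟨by linarith, h1⟩)
    (Real.cos_le_one c)).const_mul _

lemma integral_kerIntegrand_core {τ lam : ℂ} {c : ℝ}
    (h0 : 0 < c) (h1 : c < Real.pi / 2) :
    ∫ t in (-c)..c, kerIntegrand τ lam c t =
      rpowC (Real.sin c) lam * ampl τ 1 lam (Real.cos c) := by
  rw [intervalIntegral.integral_of_le (by linarith), integral_Ioc_eq_integral_Ioo,
    ← range_angle h0 h1,
    integral_image_eq_integral_abs_deriv_smul MeasurableSet.univ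
      (fun p _ => (hasDerivAt_angle c p).hasDerivWithinAt) (angle_injective h0 h1).injOn]
  simp only [kerIntegrand_angle τ lam h0 h1, setIntegral_univ]
  rw [integral_const_mul, ampl]

lemma kerIntegrand_reflect (τ lam : ℂ) (c t : ℝ) :
    kerIntegrand τ lam c (Real.pi / 2 - t) = kerIntegrand τ lam (Real.pi / 2 - c) t := by
  have e1 : |Real.sin (Real.pi / 2 - t - c)| = |Real.sin (t - (Real.pi / 2 - c))| := by
    rw [← abs_neg, ← Real.sin_neg]; congr 2; ring
  have e2 : Real.sin (Real.pi / 2 - t + c) = Real.sin (t + (Real.pi / 2 - c)) := by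
    rw [← Real.sin_pi_sub]; congr 1; ring
  rw [kerIntegrand, kerIntegrand, e1, e2]

lemma kerIntegrand_periodic (τ lam : ℂ) (c : ℝ) :
    Function.Periodic (kerIntegrand τ lam c) Real.pi := by
  intro t
  have e1 : Real.sin (t + Real.pi - c) = -Real.sin (t - c) := by
    rw [← Real.sin_add_pi]; congr 1; ring
  have e2 : Real.sin (t + Real.pi + c) = -Real.sin (t + c) := by
    rw [← Real.sin_add_pi]; congr 1; ring
  rw [kerIntegrand, kerIntegrand, e1, e2, abs_neg, abs_neg]

lemma integral_kerIntegrand {τ lam : ℂ} (hτ : τ.re = 0) (hl : lam.re = 0) {c : ℝ}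
    (h0 : 0 < c) (h1 : c < Real.pi / 2) :
    ∫ t in (0 : ℝ)..(2 * Real.pi), kerIntegrand τ lam c t =
      2 * (rpowC (Real.sin c) lam * ampl τ 1 lam (Real.cos c) +
        rpowC (Real.cos c) lam * ampl τ 1 lam (Real.sin c)) := by
  have g0 : 0 < Real.pi / 2 - c := by linarith
  have g1 : Real.pi / 2 - c < Real.pi / 2 := by linarith
  have i1 := intervalIntegrable_kerIntegrand_core hτ hl h0 h1
  have i2 : IntervalIntegrable (kerIntegrand τ lam c) volume c (Real.pi - c) := by
    have := (intervalIntegrable_kerIntegrand_core hτ hl g0 g1).comp_sub_left (Real.pi / 2)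
    have e : (fun x => kerIntegrand τ lam (Real.pi / 2 - c) (Real.pi / 2 - x)) =
        kerIntegrand τ lam c := by
      funext x
      rw [← kerIntegrand_reflect]; congr 1; ring
    rw [e] at this
    convert this.symm using 1 <;> ring
  have j2 : ∫ t in c..(Real.pi - c), kerIntegrand τ lam c t =
      rpowC (Real.cos c) lam * ampl τ 1 lam (Real.sin c) := by
    have := integral_kerIntegrand_core (τ := τ) (lam := lam) g0 g1
    rw [Real.sin_pi_div_two_sub, Real.cos_pi_div_two_sub] at this
    rw [← this]
    simp only [← kerIntegrand_reflect]
    rw [intervalIntegral.integral_comp_sub_left (fun x => kerIntegrand τ lam c x)]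
    congr 1 <;> ring
  have per := kerIntegrand_periodic τ lam c
  have i3 : IntervalIntegrable (kerIntegrand τ lam c) volume (-c) (-c + Real.pi) := by
    have := i1.trans i2
    rwa [sub_eq_neg_add] at this
  have iall : ∀ a b, IntervalIntegrable (kerIntegrand τ lam c) volume a b :=
    fun a b => per.intervalIntegrable Real.pi_ne_zero i3 a b
  have k1 : ∫ t in (0:ℝ)..Real.pi, kerIntegrand τ lam c t =
      rpowC (Real.sin c) lam * ampl τ 1 lam (Real.cos c) +
        rpowC (Real.cos c) lam * ampl τ 1 lam (Real.sin c) := by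
    have := per.intervalIntegral_add_eq 0 (-c)
    rw [zero_add] at this
    rw [this, neg_add_eq_sub, ← intervalIntegral.integral_add_adjacent_intervals i1 i2,
      integral_kerIntegrand_core h0 h1, j2]
  have k2 : ∫ t in Real.pi..(2 * Real.pi), kerIntegrand τ lam c t =
      ∫ t in (0:ℝ)..Real.pi, kerIntegrand τ lam c t := by
    have := per.intervalIntegral_add_eq Real.pi 0
    rwa [zero_add, ← two_mul] at this
  rw [← intervalIntegral.integral_add_adjacent_intervals (iall 0 Real.pi) (iall Real.pi _), k2, k1]
  ring

lemma kKer_eq {τ lam : ℂ} (hτ : τ.re = 0) (hl : lam.re = 0) {c : ℝ}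
    (h0 : 0 < c) (h1 : c < Real.pi / 2) :
    kKer τ lam c = (1 / Real.pi * Complex.exp (-(lam / 2) * (Real.log 2 : ℂ))) *
      ((((√(Real.sin (2 * c)))⁻¹ : ℝ) : ℂ) *
        (Complex.exp (lam / 2 * (Real.log (Real.tan c) : ℂ)) * ampl τ 1 lam (Real.cos c) +
          Complex.exp (-lam / 2 * (Real.log (Real.tan c) : ℂ)) * ampl τ 1 lam (Real.sin c))) := by
  have hs : 0 < Real.sin c := Real.sin_pos_of_pos_of_lt_pi h0 (by linarith [Real.pi_pos])
  have hc : 0 < Real.cos c := Real.cos_pos_of_mem_Ioo ⟨by linarith, h1⟩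
  have h2 : 0 < Real.sin (2 * c) := by rw [Real.sin_two_mul]; positivity
  have hk : kKer τ lam c = (1 / (2 * Real.pi)) * rpowC |Real.sin (2 * c)| ((-1 - lam) / 2) *
      ∫ t in (0 : ℝ)..(2 * Real.pi), kerIntegrand τ lam c t := rfl
  have l2 : Real.log (Real.sin (2 * c)) =
      Real.log 2 + Real.log (Real.sin c) + Real.log (Real.cos c) := by
    rw [Real.sin_two_mul, Real.log_mul (by positivity) hc.ne', Real.log_mul two_ne_zero hs.ne']
  have lt : Real.log (Real.tan c) = Real.log (Real.sin c) - Real.log (Real.cos c) := by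
    rw [Real.tan_eq_sin_div_cos, Real.log_div hs.ne' hc.ne']
  have e1 : (((√(Real.sin (2 * c)))⁻¹ : ℝ) : ℂ) =
      Complex.exp (-(1 / 2) * (Real.log (Real.sin (2 * c)) : ℂ)) := by
    rw [Real.sqrt_eq_rpow, ← Real.rpow_neg h2.le, Real.rpow_def_of_pos h2, Complex.ofReal_exp]
    congr 1; push_cast; ring
  have hpi : (Real.pi : ℂ) ≠ 0 := by exact_mod_cast Real.pi_ne_zero
  rw [hk, integral_kerIntegrand hτ hl h0 h1, abs_of_pos h2, e1, rpowC, rpowC, rpowC, l2, lt]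
  have x1 : Complex.exp ((-1 - lam) / 2 *
        ((Real.log 2 + Real.log (Real.sin c) + Real.log (Real.cos c) : ℝ) : ℂ)) *
        Complex.exp (lam * (Real.log (Real.sin c) : ℂ)) =
      Complex.exp (-(lam / 2) * (Real.log 2 : ℂ)) * Complex.exp (-(1 / 2) *
        ((Real.log 2 + Real.log (Real.sin c) + Real.log (Real.cos c) : ℝ) : ℂ)) *
        Complex.exp (lam / 2 * ((Real.log (Real.sin c) - Real.log (Real.cos c) : ℝ) : ℂ)) := by
    simp only [← Complex.exp_add]
    congr 1; push_cast; ring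
  have x2 : Complex.exp ((-1 - lam) / 2 *
        ((Real.log 2 + Real.log (Real.sin c) + Real.log (Real.cos c) : ℝ) : ℂ)) *
        Complex.exp (lam * (Real.log (Real.cos c) : ℂ)) =
      Complex.exp (-(lam / 2) * (Real.log 2 : ℂ)) * Complex.exp (-(1 / 2) *
        ((Real.log 2 + Real.log (Real.sin c) + Real.log (Real.cos c) : ℝ) : ℂ)) *
        Complex.exp (-lam / 2 * ((Real.log (Real.sin c) - Real.log (Real.cos c) : ℝ) : ℂ)) := by
    simp only [← Complex.exp_add]
    congr 1; push_cast; ring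
  rw [show ∀ a b x y z w : ℂ, (1 / (2 * (Real.pi : ℂ))) * a * (2 * (x * y + z * w)) =
    1 / (Real.pi : ℂ) * ((a * x) * y + (a * z) * w) from fun a b x y z w => by field_simp, x1, x2]
  · ring
  · exact 0

lemma kKer_eq_integral (τ lam : ℂ) (c : ℝ) :
    kKer τ lam c = (1 / (2 * Real.pi)) * rpowC |Real.sin (2 * c)| ((-1 - lam) / 2) *
      ∫ t in (0 : ℝ)..(2 * Real.pi), kerIntegrand τ lam c t := rfl

lemma kKer_neg (τ lam : ℂ) (c : ℝ) : kKer τ lam (-c) = kKer τ lam c := by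
  have e : ∀ t, kerIntegrand τ lam (-c) t = kerIntegrand τ lam c (-t) := by
    intro t
    have e1 : |Real.sin (t - -c)| = |Real.sin (-t - c)| := by
      rw [← abs_neg, ← Real.sin_neg]; congr 2; ring
    have e2 : |Real.sin (t + -c)| = |Real.sin (-t + c)| := by
      rw [← abs_neg, ← Real.sin_neg]; congr 2; ring
    rw [kerIntegrand, kerIntegrand, e1, e2]
  have per : Function.Periodic (kerIntegrand τ lam c) (2 * Real.pi) := by
    have := (kerIntegrand_periodic τ lam c).nat_mul 2
    simpa using this
  have s : |Real.sin (2 * -c)| = |Real.sin (2 * c)| := by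
    rw [mul_neg, Real.sin_neg, abs_neg]
  have h := per.intervalIntegral_add_eq (-(2 * Real.pi)) 0
  rw [neg_add_cancel, zero_add] at h
  rw [kKer_eq_integral, kKer_eq_integral, s]
  simp only [e]
  rw [intervalIntegral.integral_comp_neg (fun t => kerIntegrand τ lam c t), neg_zero, h]

lemma kKer_periodic (τ lam : ℂ) : Function.Periodic (kKer τ lam) (2 * Real.pi) := by
  intro c
  have e : ∀ t, kerIntegrand τ lam (c + 2 * Real.pi) t = kerIntegrand τ lam c t := by
    intro t
    have e1 : Real.sin (t - (c + 2 * Real.pi)) = Real.sin (t - c) := by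
      rw [← Real.sin_sub_two_pi (t - c)]; congr 1; ring
    have e2 : Real.sin (t + (c + 2 * Real.pi)) = Real.sin (t + c) := by
      rw [← Real.sin_add_two_pi (t + c)]; congr 1; ring
    rw [kerIntegrand, kerIntegrand, e1, e2]
  have s : Real.sin (2 * (c + 2 * Real.pi)) = Real.sin (2 * c) := by
    rw [← Real.sin_add_two_pi (2 * c), ← Real.sin_add_two_pi (2 * c + 2 * Real.pi)]; congr 1; ring
  rw [kKer_eq_integral, kKer_eq_integral, s]
  simp only [e]

/-- `f₁ = sin(2c) · df/dc` on the interval `(0, r)`. -/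
def IsLogDeriv (r : ℝ) (f f₁ : ℝ → ℂ) : Prop :=
  ∀ c ∈ Set.Ioo 0 r, HasDerivAt f (f₁ c / (Real.sin (2 * c) : ℝ)) c

/-- `f` is bounded by `K · √(sin 2c)` on the interval `(0, r)`. -/
def SqrtBounded (r K : ℝ) (f : ℝ → ℂ) : Prop :=
  ∀ c ∈ Set.Ioo 0 r, ‖f c‖ ≤ K * √(Real.sin (2 * c))

section interval

variable {r : ℝ}

lemma le_sin_two_mul (hr : r ≤ 1 / 8) {c : ℝ} (hc : c ∈ Set.Ioo 0 r) : c ≤ Real.sin (2 * c) := by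
  have h := Real.mul_le_sin (x := 2 * c) (by linarith [hc.1])
    (by linarith [hc.1, hc.2, Real.pi_gt_three])
  refine le_trans ?_ h
  have : 1 ≤ 2 / Real.pi * 2 := by
    rw [div_mul_eq_mul_div, le_div_iff₀ Real.pi_pos]; linarith [Real.pi_le_four]
  nlinarith [hc.1]

lemma sin_two_mul_pos (hr : r ≤ 1 / 8) {c : ℝ} (hc : c ∈ Set.Ioo 0 r) : 0 < Real.sin (2 * c) :=
  hc.1.trans_le (le_sin_two_mul hr hc)

lemma half_le_cos_two_mul (hr : r ≤ 1 / 8) {c : ℝ} (hc : c ∈ Set.Ioo 0 r) :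
    1 / 2 ≤ Real.cos (2 * c) := by
  have := Real.one_sub_sq_div_two_le_cos (x := 2 * c)
  nlinarith [hc.1, hc.2]

lemma inv_sqrt_sin_le (hr : r ≤ 1 / 8) {c : ℝ} (hc : c ∈ Set.Ioo 0 r) :
    (√(Real.sin (2 * c)))⁻¹ ≤ c ^ (-(1 / 2) : ℝ) := by
  rw [Real.rpow_neg hc.1.le, ← Real.sqrt_eq_rpow]
  exact inv_anti₀ (Real.sqrt_pos.2 hc.1) (Real.sqrt_le_sqrt (le_sin_two_mul hr hc))

lemma integrableOn_rpow_neg_half (r : ℝ) :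
    IntegrableOn (fun c : ℝ => c ^ (-(1 / 2) : ℝ)) (Set.Ioo 0 r) := by
  rcases le_or_gt r 0 with h | h
  · simp [Set.Ioo_eq_empty (not_lt.2 h)]
  · rw [← intervalIntegrable_iff_integrableOn_Ioo_of_le h.le]
    exact intervalIntegral.intervalIntegrable_rpow' (by norm_num)

lemma integral_rpow_neg_half_le (h0 : 0 ≤ r) (hr : r ≤ 1 / 8) :
    ∫ c in Set.Ioo 0 r, c ^ (-(1 / 2) : ℝ) ≤ 1 := by
  rw [← integral_Ioc_eq_integral_Ioo, ← intervalIntegral.integral_of_le h0,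
    integral_rpow (Or.inl (by norm_num))]
  norm_num
  rw [← Real.sqrt_eq_rpow]
  have : √r ≤ 1 / 2 := Real.sqrt_le_iff.2 ⟨by norm_num, by linarith⟩
  linarith

lemma norm_div_sin_le (hr : r ≤ 1 / 8) {K : ℝ} {G : ℝ → ℂ} (hb : SqrtBounded r K G)
    {c : ℝ} (hc : c ∈ Set.Ioo 0 r) :
    ‖G c / (Real.sin (2 * c) : ℝ)‖ ≤ K * (√(Real.sin (2 * c)))⁻¹ := by
  have h := sin_two_mul_pos hr hc
  rw [norm_div, Complex.norm_real, Real.norm_of_nonneg h.le, div_le_iff₀ h]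
  refine (hb c hc).trans_eq ?_
  have h2 := Real.sqrt_pos.2 h
  have h3 := Real.sq_sqrt h.le
  field_simp
  rw [h3]

lemma SqrtBounded.nonneg (h0 : 0 < r) (hr : r ≤ 1 / 8) {K : ℝ} {G : ℝ → ℂ}
    (hb : SqrtBounded r K G) : 0 ≤ K := by
  have hc : r / 2 ∈ Set.Ioo 0 r := ⟨by linarith, by linarith⟩
  have h2 := Real.sqrt_pos.2 (sin_two_mul_pos hr hc)
  have := (norm_nonneg _).trans (hb _ hc)
  exact nonneg_of_mul_nonneg_left this h2

lemma continuousOn_div_sin (hr : r ≤ 1 / 8) {G : ℝ → ℂ} (hG : ContinuousOn G (Set.Ioo 0 r)) :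
    ContinuousOn (fun c => G c / (Real.sin (2 * c) : ℝ)) (Set.Ioo 0 r) := by
  refine hG.div (by fun_prop) fun c hc => ?_
  exact_mod_cast (sin_two_mul_pos hr hc).ne'

lemma integrableOn_div_sin (h0 : 0 < r) (hr : r ≤ 1 / 8) {K : ℝ} {G : ℝ → ℂ}
    (hG : ContinuousOn G (Set.Ioo 0 r)) (hb : SqrtBounded r K G) :
    IntegrableOn (fun c => G c / (Real.sin (2 * c) : ℝ)) (Set.Ioo 0 r) := by
  refine Integrable.mono' ((integrableOn_rpow_neg_half r).const_mul K)
    ((continuousOn_div_sin hr hG).aestronglyMeasurable measurableSet_Ioo) ?_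
  refine (ae_restrict_mem measurableSet_Ioo).mono fun c hc => ?_
  exact (norm_div_sin_le hr hb hc).trans
    (mul_le_mul_of_nonneg_left (inv_sqrt_sin_le hr hc) (hb.nonneg h0 hr))

lemma norm_integral_div_sin_le (h0 : 0 < r) (hr : r ≤ 1 / 8) {K : ℝ} {G : ℝ → ℂ}
    (hb : SqrtBounded r K G) :
    ‖∫ c in Set.Ioo 0 r, G c / (Real.sin (2 * c) : ℝ)‖ ≤ K := by
  have := norm_integral_le_of_norm_le ((integrableOn_rpow_neg_half r).const_mul K)
    ((ae_restrict_mem measurableSet_Ioo).mono fun c hc => (norm_div_sin_le hr hb hc).trans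
    (mul_le_mul_of_nonneg_left (inv_sqrt_sin_le hr hc) (hb.nonneg h0 hr)))
  refine this.trans ?_
  rw [integral_const_mul]
  exact mul_le_of_le_one_right (hb.nonneg h0 hr) (integral_rpow_neg_half_le h0.le hr)

lemma integral_logDeriv_eq_zero (h0 : 0 < r) (hr : r ≤ 1 / 8) {K K₁ : ℝ} {F F₁ : ℝ → ℂ}
    (hF : IsLogDeriv r F F₁) (hb : SqrtBounded r K F) (hz : ∀ c, r / 2 < c → F c = 0)
    (hc : ContinuousOn F₁ (Set.Ioo 0 r)) (hb₁ : SqrtBounded r K₁ F₁) :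
    ∫ c in Set.Ioo 0 r, F₁ c / (Real.sin (2 * c) : ℝ) = 0 := by
  have hi : IntervalIntegrable (fun c => F₁ c / (Real.sin (2 * c) : ℝ)) volume 0 r := by
    rw [intervalIntegrable_iff_integrableOn_Ioo_of_le h0.le]
    exact integrableOn_div_sin h0 hr hc hb₁
  have l0 : Filter.Tendsto F (nhdsWithin 0 (Set.Ioi 0)) (nhds 0) := by
    have hl : Filter.Tendsto (fun c : ℝ => K * √(Real.sin (2 * c))) (nhdsWithin 0 (Set.Ioi 0))
        (nhds 0) := by
      have : ContinuousAt (fun c : ℝ => K * √(Real.sin (2 * c))) 0 := by fun_prop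
      have h := this.tendsto.mono_left (nhdsWithin_le_nhds (s := Set.Ioi 0))
      simpa using h
    refine squeeze_zero_norm' ?_ hl
    filter_upwards [Ioo_mem_nhdsGT h0] with c hc using hb c hc
  have l1 : Filter.Tendsto F (nhdsWithin r (Set.Iio r)) (nhds 0) := by
    refine tendsto_const_nhds.congr' ?_
    filter_upwards [Ioo_mem_nhdsLT (show r / 2 < r by linarith)] with c hc using (hz c hc.1).symm
  have := intervalIntegral.integral_eq_sub_of_hasDerivAt_of_tendsto h0 hF hi l0 l1
  rwa [intervalIntegral.integral_of_le h0.le, integral_Ioc_eq_integral_Ioo, sub_zero] at this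

end interval

lemma IsLogDeriv.mul {r : ℝ} {f f₁ g g₁ : ℝ → ℂ} (hf : IsLogDeriv r f f₁)
    (hg : IsLogDeriv r g g₁) :
    IsLogDeriv r (fun c => f c * g c) (fun c => f₁ c * g c + f c * g₁ c) := fun c hc =>
  ((hf c hc).mul (hg c hc)).congr_deriv (by ring)

lemma IsLogDeriv.add {r : ℝ} {f f₁ g g₁ : ℝ → ℂ} (hf : IsLogDeriv r f f₁)
    (hg : IsLogDeriv r g g₁) :
    IsLogDeriv r (fun c => f c + g c) (fun c => f₁ c + g₁ c) := fun c hc =>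
  ((hf c hc).add (hg c hc)).congr_deriv (by ring)

lemma IsLogDeriv.const_mul {r : ℝ} {f f₁ : ℝ → ℂ} (hf : IsLogDeriv r f f₁) (a : ℂ) :
    IsLogDeriv r (fun c => a * f c) (fun c => a * f₁ c) := fun c hc =>
  ((hf c hc).const_mul a).congr_deriv (by ring)

lemma IsLogDeriv.inv {r : ℝ} {f f₁ : ℝ → ℂ} (hf : IsLogDeriv r f f₁)
    (h0 : ∀ c ∈ Set.Ioo 0 r, f c ≠ 0) :
    IsLogDeriv r (fun c => (f c)⁻¹) (fun c => -f₁ c * ((f c)⁻¹ * (f c)⁻¹)) := fun c hc =>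
  ((hf c hc).inv (h0 c hc)).congr_deriv (by
    have := h0 c hc
    field_simp)

lemma IsLogDeriv.congr {r : ℝ} {f f₁ g₁ : ℝ → ℂ} (hf : IsLogDeriv r f f₁)
    (h : ∀ c ∈ Set.Ioo 0 r, f₁ c = g₁ c) : IsLogDeriv r f g₁ := fun c hc =>
  h c hc ▸ hf c hc

lemma IsLogDeriv.continuousOn {r : ℝ} {f f₁ : ℝ → ℂ} (hf : IsLogDeriv r f f₁) :
    ContinuousOn f (Set.Ioo 0 r) := fun c hc => (hf c hc).continuousAt.continuousWithinAt

/-- The oscillating factor `exp(i(Mc + (Λ/2) log tan c))`. -/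
noncomputable def phase (M Λ c : ℝ) : ℂ :=
  Complex.exp (Complex.I * ((M * c + Λ / 2 * Real.log (Real.tan c) : ℝ) : ℂ))

lemma norm_phase (M Λ c : ℝ) : ‖phase M Λ c‖ = 1 := by
  rw [phase, mul_comm]; exact Complex.norm_exp_ofReal_mul_I _

section

variable {r : ℝ}

lemma isLogDeriv_ofReal {f f₁ : ℝ → ℝ}
    (h : ∀ c ∈ Set.Ioo 0 r, HasDerivAt f (f₁ c / Real.sin (2 * c)) c) :
    IsLogDeriv r (fun c => (f c : ℂ)) (fun c => (f₁ c : ℂ)) := fun c hc =>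
  ((h c hc).ofReal_comp).congr_deriv (by push_cast; rfl)

lemma isLogDeriv_phase (hr : r ≤ 1 / 8) (M Λ : ℝ) :
    IsLogDeriv r (phase M Λ)
      (fun c => Complex.I * ((M * Real.sin (2 * c) + Λ : ℝ) : ℂ) * phase M Λ c) := by
  intro c hc
  have hs := sin_two_mul_pos hr hc
  have hpi : c < Real.pi / 2 := by linarith [hc.2, Real.pi_gt_three]
  have h1 : 0 < Real.sin c := Real.sin_pos_of_pos_of_lt_pi hc.1 (by linarith [Real.pi_pos])
  have h2 : 0 < Real.cos c := Real.cos_pos_of_mem_Ioo ⟨by linarith [hc.1], hpi⟩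
  have ht : 0 < Real.tan c := by rw [Real.tan_eq_sin_div_cos]; positivity
  have d : HasDerivAt (fun c => M * c + Λ / 2 * Real.log (Real.tan c))
      ((M * Real.sin (2 * c) + Λ) / Real.sin (2 * c)) c := by
    refine (((hasDerivAt_id c).const_mul M).add
      (((Real.hasDerivAt_tan h2.ne').log ht.ne').const_mul (Λ / 2))).congr_deriv ?_
    rw [Real.sin_two_mul, Real.tan_eq_sin_div_cos]
    field_simp
  refine (((d.ofReal_comp).const_mul Complex.I).cexp).congr_deriv ?_
  simp only [phase]
  push_cast
  ring

lemma isLogDeriv_sin (hr : r ≤ 1 / 8) :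
    IsLogDeriv r (fun c => ((Real.sin (2 * c) : ℝ) : ℂ))
      (fun c => ((2 * Real.sin (2 * c) * Real.cos (2 * c) : ℝ) : ℂ)) := by
  refine isLogDeriv_ofReal fun c hc => ?_
  have hs := sin_two_mul_pos hr hc
  refine ((((hasDerivAt_id c).const_mul 2).sin)).congr_deriv ?_
  simp only [id]
  field_simp

lemma isLogDeriv_cos (hr : r ≤ 1 / 8) :
    IsLogDeriv r (fun c => ((Real.cos (2 * c) : ℝ) : ℂ))
      (fun c => ((-(2 * Real.sin (2 * c) ^ 2) : ℝ) : ℂ)) := by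
  refine isLogDeriv_ofReal fun c hc => ?_
  have hs := sin_two_mul_pos hr hc
  refine ((((hasDerivAt_id c).const_mul 2).cos)).congr_deriv ?_
  simp only [id]
  field_simp

lemma IsLogDeriv.congr_fun {f f₁ g : ℝ → ℂ} (hf : IsLogDeriv r f f₁) (h : ∀ c, g c = f c) :
    IsLogDeriv r g f₁ := by
  rwa [show g = f from funext h]

lemma isLogDeriv_const (a : ℂ) : IsLogDeriv r (fun _ => a) (fun _ => 0) := fun c _ =>
  (hasDerivAt_const c a).congr_deriv (by simp)

lemma isLogDeriv_frequency (hr : r ≤ 1 / 8) (M Λ : ℝ) :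
    IsLogDeriv r (fun c => ((M * Real.sin (2 * c) + Λ : ℝ) : ℂ))
      (fun c => ((2 * M * Real.sin (2 * c) * Real.cos (2 * c) : ℝ) : ℂ)) := by
  refine ((((isLogDeriv_sin hr).const_mul (M : ℂ)).add (isLogDeriv_const (Λ : ℂ))).congr
    fun c _ => ?_).congr_fun fun c => ?_
  · push_cast; ring
  · push_cast; ring

lemma isLogDeriv_frequency' (hr : r ≤ 1 / 8) (M : ℝ) :
    IsLogDeriv r (fun c => ((2 * M * Real.sin (2 * c) * Real.cos (2 * c) : ℝ) : ℂ))
      (fun c => ((4 * M * Real.sin (2 * c) * (Real.cos (2 * c) ^ 2 - Real.sin (2 * c) ^ 2) : ℝ) :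
        ℂ)) := by
  refine ((((isLogDeriv_sin hr).mul (isLogDeriv_cos hr)).const_mul (2 * M : ℂ)).congr
    fun c _ => ?_).congr_fun fun c => ?_
  · push_cast; ring
  · push_cast; ring

/-- Two integrations by parts when the frequency dominates. -/
lemma norm_integral_phase_le_inv_sq (h0 : 0 < r) (hr : r ≤ 1 / 8) {M Λ K : ℝ} (hL : 1 ≤ |Λ|)
    (hM : ∀ c ∈ Set.Ioo 0 r, |M| * Real.sin (2 * c) ≤ |Λ| / 2) {B B₁ B₂ : ℝ → ℂ}
    (hB : IsLogDeriv r B B₁) (hB₁ : IsLogDeriv r B₁ B₂) (hB₂ : ContinuousOn B₂ (Set.Ioo 0 r))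
    (b : SqrtBounded r K B) (b₁ : SqrtBounded r K B₁) (b₂ : SqrtBounded r K B₂)
    (z : ∀ c, r / 2 < c → B c = 0) (z₁ : ∀ c, r / 2 < c → B₁ c = 0) :
    ‖∫ c in Set.Ioo 0 r, (phase M Λ c * B c) / (Real.sin (2 * c) : ℝ)‖ ≤ 92 * K * |Λ|⁻¹ ^ 2 := by
  have hK := b.nonneg h0 hr
  have hL0 : 0 < |Λ| := by linarith
  have hQ0 : ∀ c ∈ Set.Ioo 0 r, |Λ| / 2 ≤ |M * Real.sin (2 * c) + Λ| := by
    intro c hc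
    have h1 := abs_sub_abs_le_abs_sub Λ (-(M * Real.sin (2 * c)))
    rw [abs_neg, abs_mul, abs_of_pos (sin_two_mul_pos hr hc), sub_neg_eq_add, add_comm Λ] at h1
    linarith [hM c hc]
  have hE := isLogDeriv_phase hr M Λ
  have hQ := isLogDeriv_frequency hr M Λ
  have hQ₁ := isLogDeriv_frequency' hr M
  have hQne : ∀ c ∈ Set.Ioo 0 r, ((M * Real.sin (2 * c) + Λ : ℝ) : ℂ) ≠ 0 := by
    intro c hc h
    have := hQ0 c hc
    rw [Complex.ofReal_eq_zero] at h
    rw [h, abs_zero] at this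
    linarith
  have nQ₁ : ∀ c ∈ Set.Ioo 0 r,
      ‖((2 * M * Real.sin (2 * c) * Real.cos (2 * c) : ℝ) : ℂ)‖ ≤ |Λ| := by
    intro c hc
    have hs := sin_two_mul_pos hr hc
    rw [Complex.norm_real, Real.norm_eq_abs, abs_mul, abs_mul, abs_mul, abs_two, abs_of_pos hs]
    have := mul_le_mul (hM c hc) (Real.abs_cos_le_one (2 * c)) (abs_nonneg _) (by linarith)
    linarith
  have nQ₂ : ∀ c ∈ Set.Ioo 0 r,
      ‖((4 * M * Real.sin (2 * c) * (Real.cos (2 * c) ^ 2 - Real.sin (2 * c) ^ 2) : ℝ) : ℂ)‖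
        ≤ 2 * |Λ| := by
    intro c hc
    have hs := sin_two_mul_pos hr hc
    rw [Complex.norm_real, Real.norm_eq_abs, abs_mul, abs_mul, abs_mul, abs_of_pos hs,
      abs_of_pos (by norm_num : (0:ℝ) < 4)]
    have h1 : |Real.cos (2 * c) ^ 2 - Real.sin (2 * c) ^ 2| ≤ 1 := by
      rw [abs_le]
      constructor <;> nlinarith [Real.sin_sq_add_cos_sq (2 * c), sq_nonneg (Real.sin (2 * c)),
        sq_nonneg (Real.cos (2 * c))]
    have := mul_le_mul (hM c hc) h1 (abs_nonneg _) (by linarith)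
    linarith
  generalize hQe : (fun c : ℝ => ((M * Real.sin (2 * c) + Λ : ℝ) : ℂ)) = Q at *
  generalize hQ1e : (fun c : ℝ => ((2 * M * Real.sin (2 * c) * Real.cos (2 * c) : ℝ) : ℂ)) = Q₁ at *
  generalize hQ2e : (fun c : ℝ => ((4 * M * Real.sin (2 * c) *
    (Real.cos (2 * c) ^ 2 - Real.sin (2 * c) ^ 2) : ℝ) : ℂ)) = Q₂ at *
  have q0 : ∀ c, ((M * Real.sin (2 * c) + Λ : ℝ) : ℂ) = Q c := fun c => congrFun hQe c
  have q1 : ∀ c, ((2 * M * Real.sin (2 * c) * Real.cos (2 * c) : ℝ) : ℂ) = Q₁ c :=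
    fun c => congrFun hQ1e c
  have q2 : ∀ c, ((4 * M * Real.sin (2 * c) *
    (Real.cos (2 * c) ^ 2 - Real.sin (2 * c) ^ 2) : ℝ) : ℂ) = Q₂ c := fun c => congrFun hQ2e c
  simp only [q0, q1, q2] at hE hQne nQ₁ nQ₂
  have nv : ∀ c ∈ Set.Ioo 0 r, ‖(Q c)⁻¹‖ ≤ 2 * |Λ|⁻¹ := by
    intro c hc
    rw [norm_inv, ← q0, Complex.norm_real, Real.norm_eq_abs]
    have := inv_anti₀ (by positivity) (hQ0 c hc)
    rwa [inv_div, div_eq_mul_inv] at this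
  obtain ⟨v, hve⟩ : ∃ v : ℝ → ℂ, v = fun c => (Q c)⁻¹ := ⟨_, rfl⟩
  have qv : ∀ c ∈ Set.Ioo 0 r, Q c * v c = 1 := fun c hc => by
    rw [hve]; exact mul_inv_cancel₀ (hQne c hc)
  have hv := hQ.inv hQne
  have cQ₂ : ContinuousOn Q₂ (Set.Ioo 0 r) := by rw [← hQ2e]; fun_prop
  have cE := hE.continuousOn
  simp only [← congrFun hve] at nv
  have hv' : IsLogDeriv r v (fun c => -Q₁ c * (v c * v c)) := by
    rw [hve]; exact hv
  obtain ⟨v₁, hv1e⟩ : ∃ v₁ : ℝ → ℂ, v₁ = fun c => -Q₁ c * (v c * v c) := ⟨_, rfl⟩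
  rw [← hv1e] at hv'
  obtain ⟨v₂, hv2e⟩ : ∃ v₂ : ℝ → ℂ, v₂ = fun c => -Q₂ c * (v c * v c) +
    -Q₁ c * (v₁ c * v c + v c * v₁ c) := ⟨_, rfl⟩
  have hv₁ : IsLogDeriv r v₁ v₂ := by
    refine ((((hQ₁.const_mul (-1)).mul (hv'.mul hv'))).congr fun c _ => ?_).congr_fun fun c => ?_
    · rw [hv2e]; ring
    · rw [hv1e]; ring
  have nv₁ : ∀ c ∈ Set.Ioo 0 r, ‖v₁ c‖ ≤ 4 * |Λ|⁻¹ := by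
    intro c hc
    rw [hv1e]
    simp only [norm_mul, norm_neg]
    calc ‖Q₁ c‖ * (‖v c‖ * ‖v c‖) ≤ |Λ| * ((2 * |Λ|⁻¹) * (2 * |Λ|⁻¹)) := by
          gcongr
          exacts [nQ₁ c hc, nv c hc, nv c hc]
      _ = _ := by field_simp; ring
  have nv₂ : ∀ c ∈ Set.Ioo 0 r, ‖v₂ c‖ ≤ 24 * |Λ|⁻¹ := by
    intro c hc
    rw [hv2e]
    calc ‖-Q₂ c * (v c * v c) + -Q₁ c * (v₁ c * v c + v c * v₁ c)‖
        ≤ ‖Q₂ c‖ * (‖v c‖ * ‖v c‖) + ‖Q₁ c‖ * (‖v₁ c‖ * ‖v c‖ + ‖v c‖ * ‖v₁ c‖) := by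
          refine (norm_add_le _ _).trans ?_
          rw [norm_mul, norm_mul, norm_mul, norm_neg, norm_neg]
          gcongr
          refine (norm_add_le _ _).trans ?_
          rw [norm_mul, norm_mul]
      _ ≤ (2 * |Λ|) * ((2 * |Λ|⁻¹) * (2 * |Λ|⁻¹)) +
          |Λ| * ((4 * |Λ|⁻¹) * (2 * |Λ|⁻¹) + (2 * |Λ|⁻¹) * (4 * |Λ|⁻¹)) := by
          have := nv c hc; have := nv₁ c hc; have := nQ₁ c hc; have := nQ₂ c hc
          gcongr
      _ = _ := by field_simp; ring
  have cv := hv'.continuousOn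
  have cv₁ := hv₁.continuousOn
  have cB := hB.continuousOn
  have cB₁ := hB₁.continuousOn
  have cQ₁ := hQ₁.continuousOn
  have cv₂ : ContinuousOn v₂ (Set.Ioo 0 r) := by rw [hv2e]; fun_prop
  obtain ⟨w, hw⟩ : ∃ w : ℝ → ℂ, w = fun c => (B₁ c * v c + B c * v₁ c) * v c := ⟨_, rfl⟩
  obtain ⟨w₁, hw1⟩ : ∃ w₁ : ℝ → ℂ, w₁ = fun c =>
    ((B₂ c * v c + B₁ c * v₁ c) + (B₁ c * v₁ c + B c * v₂ c)) * v c +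
      (B₁ c * v c + B c * v₁ c) * v₁ c := ⟨_, rfl⟩
  have hwd : IsLogDeriv r w w₁ := by
    rw [hw, hw1]
    exact ((hB₁.mul hv').add (hB.mul hv₁)).mul hv'
  have cw₁ : ContinuousOn w₁ (Set.Ioo 0 r) := by rw [hw1]; fun_prop
  have nw : ∀ c ∈ Set.Ioo 0 r, ‖w c‖ ≤ (12 * K * |Λ|⁻¹ ^ 2) * √(Real.sin (2 * c)) := by
    intro c hc
    rw [hw]
    calc ‖(B₁ c * v c + B c * v₁ c) * v c‖ ≤ (‖B₁ c‖ * ‖v c‖ + ‖B c‖ * ‖v₁ c‖) * ‖v c‖ := by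
          rw [norm_mul]; gcongr
          refine (norm_add_le _ _).trans ?_
          rw [norm_mul, norm_mul]
      _ ≤ ((K * √(Real.sin (2 * c))) * (2 * |Λ|⁻¹) + (K * √(Real.sin (2 * c))) * (4 * |Λ|⁻¹)) *
          (2 * |Λ|⁻¹) := by
          have := nv c hc; have := nv₁ c hc; have := b c hc; have := b₁ c hc
          gcongr
      _ = _ := by ring
  have nw₁ : ∀ c ∈ Set.Ioo 0 r, ‖w₁ c‖ ≤ (92 * K * |Λ|⁻¹ ^ 2) * √(Real.sin (2 * c)) := by
    intro c hc
    rw [hw1]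
    calc ‖((B₂ c * v c + B₁ c * v₁ c) + (B₁ c * v₁ c + B c * v₂ c)) * v c +
            (B₁ c * v c + B c * v₁ c) * v₁ c‖
        ≤ ((‖B₂ c‖ * ‖v c‖ + ‖B₁ c‖ * ‖v₁ c‖) + (‖B₁ c‖ * ‖v₁ c‖ + ‖B c‖ * ‖v₂ c‖)) * ‖v c‖ +
            (‖B₁ c‖ * ‖v c‖ + ‖B c‖ * ‖v₁ c‖) * ‖v₁ c‖ := by
          simp only [← norm_mul]
          refine (norm_add_le _ _).trans ?_
          rw [norm_mul _ (v c), norm_mul _ (v₁ c)]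
          gcongr
          · refine (norm_add_le _ _).trans ?_
            gcongr
            · exact norm_add_le _ _
            · exact norm_add_le _ _
          · exact norm_add_le _ _
      _ ≤ (((K * √(Real.sin (2 * c))) * (2 * |Λ|⁻¹) + (K * √(Real.sin (2 * c))) * (4 * |Λ|⁻¹)) +
          ((K * √(Real.sin (2 * c))) * (4 * |Λ|⁻¹) + (K * √(Real.sin (2 * c))) * (24 * |Λ|⁻¹))) *
          (2 * |Λ|⁻¹) + ((K * √(Real.sin (2 * c))) * (2 * |Λ|⁻¹) +
            (K * √(Real.sin (2 * c))) * (4 * |Λ|⁻¹)) * (4 * |Λ|⁻¹) := by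
          have := nv c hc; have := nv₁ c hc; have := nv₂ c hc
          have := b c hc; have := b₁ c hc; have := b₂ c hc
          gcongr
      _ = _ := by ring
  have key : IsLogDeriv r (fun c => phase M Λ c * (-Complex.I * (B c * v c) + w c))
      (fun c => phase M Λ c * B c + phase M Λ c * w₁ c) := by
    refine (hE.mul (((hB.mul hv').const_mul (-Complex.I)).add hwd)).congr fun c hc => ?_
    have h := qv c hc
    have hwc : w c = (B₁ c * v c + B c * v₁ c) * v c := congrFun hw c
    rw [hwc]
    linear_combination (phase M Λ c * B c + Complex.I * phase M Λ c * (B₁ c * v c + B c * v₁ c)) * h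
      - Q c * phase M Λ c * B c * v c * Complex.I_sq
  have nE := norm_phase M Λ
  have bEB : SqrtBounded r K (fun c => phase M Λ c * B c) := fun c hc => by
    rw [norm_mul, nE, one_mul]; exact b c hc
  have bEw : SqrtBounded r (92 * K * |Λ|⁻¹ ^ 2) (fun c => phase M Λ c * w₁ c) := fun c hc => by
    rw [norm_mul, nE, one_mul]; exact nw₁ c hc
  have zero := integral_logDeriv_eq_zero h0 hr (K := K * (2 * |Λ|⁻¹) + 12 * K * |Λ|⁻¹ ^ 2)
    (K₁ := K + 92 * K * |Λ|⁻¹ ^ 2) key (fun c hc => by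
      rw [norm_mul, nE, one_mul, add_mul]
      refine (norm_add_le _ _).trans (add_le_add ?_ (nw c hc))
      rw [norm_mul, norm_neg, Complex.norm_I, one_mul, norm_mul]
      calc ‖B c‖ * ‖v c‖ ≤ (K * √(Real.sin (2 * c))) * (2 * |Λ|⁻¹) := by
            have := b c hc; have := nv c hc
            gcongr
        _ = _ := by ring)
    (fun c hc => by rw [hw]; simp [z c hc, z₁ c hc])
    (by fun_prop)
    (fun c hc => by
      rw [add_mul]
      exact (norm_add_le _ _).trans (add_le_add (bEB c hc) (bEw c hc)))
  simp only [add_div] at zero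
  rw [integral_add (integrableOn_div_sin h0 hr (by fun_prop) bEB)
    (integrableOn_div_sin h0 hr (by fun_prop) bEw)] at zero
  rw [eq_neg_of_add_eq_zero_left zero, norm_neg]
  exact norm_integral_div_sin_le h0 hr bEw

end

lemma add_mul_sqrt_sub_sq_le {y L : ℝ} (hy : 0 ≤ y) (hL : 1 ≤ L) :
    (y + L) * (1 + (√y - √L) ^ 2) ≤ 6 * ((y - L) ^ 2 + L) := by
  have h1 : y + L ≤ 5 * ((y - L) ^ 2 + L) := by nlinarith [sq_nonneg (10 * (y - L) - 1)]
  have h2 : (y + L) * (√y - √L) ^ 2 ≤ (y - L) ^ 2 := by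
    have e : (y - L) ^ 2 = (√y + √L) ^ 2 * (√y - √L) ^ 2 := by
      rw [← mul_pow]
      congr 1
      nlinarith [Real.sq_sqrt hy, Real.sq_sqrt (by linarith : 0 ≤ L)]
    rw [e]
    gcongr
    nlinarith [Real.sq_sqrt hy, Real.sq_sqrt (by linarith : 0 ≤ L),
      mul_nonneg (Real.sqrt_nonneg y) (Real.sqrt_nonneg L)]
  nlinarith

section

variable {r : ℝ}

lemma integral_dominating_le (h0 : 0 < r) (hr : r ≤ 1 / 8) {M L : ℝ} (hM : 0 < M) :
    IntegrableOn (fun c => (√(Real.sin (2 * c)))⁻¹ *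
      (1 + (√(M * Real.sin (2 * c)) - √L) ^ 2)⁻¹) (Set.Ioo 0 r) ∧
    ∫ c in Set.Ioo 0 r, (√(Real.sin (2 * c)))⁻¹ *
      (1 + (√(M * Real.sin (2 * c)) - √L) ^ 2)⁻¹ ≤ 2 * Real.pi * (√M)⁻¹ := by
  have hs : ∀ c ∈ Set.Ioo 0 r, 0 < Real.sin (2 * c) := fun c hc => sin_two_mul_pos hr hc
  set f : ℝ → ℝ := fun c => (√(Real.sin (2 * c)))⁻¹ *
      (1 + (√(M * Real.sin (2 * c)) - √L) ^ 2)⁻¹ with hf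
  have dpos : ∀ c, 0 < 1 + (√(M * Real.sin (2 * c)) - √L) ^ 2 := fun c => by positivity
  have f0 : ∀ c, 0 ≤ f c := fun c => by
    have := dpos c
    simp only [hf]; positivity
  have ht : 0 < √M := Real.sqrt_pos.2 hM
  set a : ℝ → ℝ := fun c => Real.arctan (√(M * Real.sin (2 * c)) - √L) with ha
  set a' : ℝ → ℝ := fun c => √M * Real.cos (2 * c) * f c with ha'
  have ca : ContinuousOn a (Set.Icc 0 r) := by
    have : Continuous a := Real.continuous_arctan.comp (by fun_prop)
    exact this.continuousOn
  have da : ∀ c ∈ Set.Ioo 0 r, HasDerivAt a (a' c) c := by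
    intro c hc
    have hsc := hs c hc
    have h1 : HasDerivAt (fun c => M * Real.sin (2 * c)) (M * (Real.cos (2 * c) * 2)) c := by
      have := ((((hasDerivAt_id c).const_mul 2).sin)).const_mul M
      simpa using this
    refine (((h1.sqrt (mul_pos hM hsc).ne').sub_const (√L)).arctan).congr_deriv ?_
    simp only [ha', hf]
    have e := Real.sq_sqrt hM.le
    have h2 := Real.sqrt_pos.2 hsc
    have := dpos c
    rw [Real.sqrt_mul hM.le] at this ⊢
    field_simp
    rw [e]
  have a'0 : ∀ c ∈ Set.Ioo 0 r, √M / 2 * f c ≤ a' c := by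
    intro c hc
    have := half_le_cos_two_mul hr hc
    have := f0 c
    simp only [ha']
    gcongr
    nlinarith
  have ia : IntegrableOn a' (Set.Ioc 0 r) :=
    intervalIntegral.integrableOn_deriv_of_nonneg ca da fun c hc =>
      (mul_nonneg (by positivity) (f0 c)).trans (a'0 c hc)
  have ia' : IntegrableOn a' (Set.Ioo 0 r) := ia.mono_set Set.Ioo_subset_Ioc_self
  have int_a : ∫ c in Set.Ioo 0 r, a' c = a r - a 0 := by
    rw [← integral_Ioc_eq_integral_Ioo, ← intervalIntegral.integral_of_le h0.le]
    exact intervalIntegral.integral_eq_sub_of_hasDerivAt_of_le h0.le ca da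
      ((intervalIntegrable_iff_integrableOn_Ioc_of_le h0.le).2 ia)
  have le : ∀ c ∈ Set.Ioo 0 r, f c ≤ 2 * (√M)⁻¹ * a' c := by
    intro c hc
    have h := mul_le_mul_of_nonneg_left (a'0 c hc) (by positivity : 0 ≤ 2 * (√M)⁻¹)
    calc f c = 2 * (√M)⁻¹ * (√M / 2 * f c) := by field_simp
      _ ≤ _ := h
  have cf : ContinuousOn f (Set.Ioo 0 r) := by
    simp only [hf]
    refine ContinuousOn.mul (ContinuousOn.inv₀ (by fun_prop) fun c hc =>
      (Real.sqrt_pos.2 (hs c hc)).ne') (ContinuousOn.inv₀ (by fun_prop) fun c _ => (dpos c).ne')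
  have if' : IntegrableOn f (Set.Ioo 0 r) := by
    refine Integrable.mono' (ia'.const_mul (2 * (√M)⁻¹)) (cf.aestronglyMeasurable measurableSet_Ioo)
      ((ae_restrict_mem measurableSet_Ioo).mono fun c hc => ?_)
    rw [Real.norm_of_nonneg (f0 c)]
    exact le c hc
  refine ⟨if', ?_⟩
  calc ∫ c in Set.Ioo 0 r, f c ≤ ∫ c in Set.Ioo 0 r, 2 * (√M)⁻¹ * a' c :=
        setIntegral_mono_on if' (ia'.const_mul _) measurableSet_Ioo le
    _ = 2 * (√M)⁻¹ * (a r - a 0) := by rw [integral_const_mul, int_a]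
    _ ≤ 2 * (√M)⁻¹ * Real.pi := by
        gcongr
        have h1 : a r < Real.pi / 2 := Real.arctan_lt_pi_div_two _
        have h2 : -(Real.pi / 2) < a 0 := Real.neg_pi_div_two_lt_arctan _
        linarith
    _ = _ := by ring

/-- Uniform second derivative bound for the oscillating integral. -/
lemma norm_integral_phase_le_inv_sqrt (h0 : 0 < r) (hr : r ≤ 1 / 8) {M Λ K : ℝ} (hL : 1 ≤ |Λ|)
    (hM : M ≠ 0) {B B₁ : ℝ → ℂ}
    (hB : IsLogDeriv r B B₁) (hB₁ : ContinuousOn B₁ (Set.Ioo 0 r))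
    (b : SqrtBounded r K B) (b₁ : SqrtBounded r K B₁)
    (z : ∀ c, r / 2 < c → B c = 0) :
    ‖∫ c in Set.Ioo 0 r, (phase M Λ c * B c) / (Real.sin (2 * c) : ℝ)‖ ≤
      36 * Real.pi * K * (√|M|)⁻¹ := by
  have hK := b.nonneg h0 hr
  have hL0 : 0 < |Λ| := by linarith
  have hE := isLogDeriv_phase hr M Λ
  have hQ := isLogDeriv_frequency hr M Λ
  have cE := hE.continuousOn
  have cB := hB.continuousOn
  have nE := norm_phase M Λ
  set q : ℝ → ℝ := fun c => M * Real.sin (2 * c) + Λ with hq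
  set q₁ : ℝ → ℝ := fun c => 2 * M * Real.sin (2 * c) * Real.cos (2 * c) with hq1
  have den : ∀ c, 0 < q c ^ 2 + |Λ| := fun c => by positivity
  have denC : ∀ c, ((q c : ℂ) * q c + (|Λ| : ℝ)) ≠ 0 := fun c => by
    have := (den c).ne'
    rw [pow_two] at this
    exact_mod_cast this
  have hQ' : IsLogDeriv r (fun c => (q c : ℂ)) (fun c => (q₁ c : ℂ)) := hQ
  obtain ⟨m, hm⟩ : ∃ m : ℝ → ℝ, m = fun c => q c / (q c ^ 2 + |Λ|) := ⟨_, rfl⟩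
  obtain ⟨m₁, hm1⟩ : ∃ m₁ : ℝ → ℝ, m₁ = fun c =>
    q₁ c * ((|Λ| - q c ^ 2) / (q c ^ 2 + |Λ|) ^ 2) := ⟨_, rfl⟩
  have hmd : IsLogDeriv r (fun c => (m c : ℂ)) (fun c => (m₁ c : ℂ)) := by
    refine ((hQ'.mul (((hQ'.mul hQ').add (isLogDeriv_const ((|Λ| : ℝ) : ℂ))).inv
      fun c _ => denC c)).congr fun c hc => ?_).congr_fun fun c => ?_
    · have := denC c
      rw [hm1]
      push_cast
      rw [pow_two (q c : ℂ)]
      field_simp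
      ring
    · rw [hm]
      push_cast
      rw [pow_two, div_eq_mul_inv]
  have cm := hmd.continuousOn
  have cm₁ : ContinuousOn (fun c => (m₁ c : ℂ)) (Set.Ioo 0 r) := by
    have : Continuous m₁ := by
      rw [hm1]
      refine Continuous.mul (by simp only [hq1]; fun_prop) (Continuous.div (by fun_prop)
        (by fun_prop) fun c => (pow_pos (den c) 2).ne')
    exact (Complex.continuous_ofReal.comp this).continuousOn
  set y : ℝ → ℝ := fun c => |M| * Real.sin (2 * c) with hy
  have y0 : ∀ c ∈ Set.Ioo 0 r, 0 ≤ y c := fun c hc =>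
    mul_nonneg (abs_nonneg _) (sin_two_mul_pos hr hc).le
  have nq : ∀ c ∈ Set.Ioo 0 r, |q c| ≤ y c + |Λ| := fun c hc => by
    refine (abs_add_le _ _).trans ?_
    rw [abs_mul, abs_of_pos (sin_two_mul_pos hr hc)]
  have nq₁ : ∀ c ∈ Set.Ioo 0 r, |q₁ c| ≤ 2 * y c := fun c hc => by
    have hs := sin_two_mul_pos hr hc
    simp only [hq1, hy]
    rw [abs_mul, abs_mul, abs_mul, abs_two, abs_of_pos hs, mul_assoc 2]
    exact mul_le_of_le_one_right (by positivity) (Real.abs_cos_le_one _)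
  have nm : ∀ c ∈ Set.Ioo 0 r, |m c| ≤ (y c + |Λ|) / (q c ^ 2 + |Λ|) := fun c hc => by
    rw [hm]
    simp only
    rw [abs_div, abs_of_pos (den c)]
    exact div_le_div_of_nonneg_right (nq c hc) (den c).le
  have nm₁ : ∀ c ∈ Set.Ioo 0 r, |m₁ c| ≤ 2 * y c / (q c ^ 2 + |Λ|) := fun c hc => by
    have h1 := nq₁ c hc
    have h2 : |(|Λ| - q c ^ 2) / (q c ^ 2 + |Λ|) ^ 2| ≤ (q c ^ 2 + |Λ|)⁻¹ := by
      rw [abs_div, abs_of_pos (pow_pos (den c) 2), div_le_iff₀ (pow_pos (den c) 2),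
        pow_two (q c ^ 2 + |Λ|), inv_mul_cancel_left₀ (den c).ne', abs_le]
      constructor <;> nlinarith [sq_nonneg (q c)]
    rw [hm1]
    simp only
    rw [abs_mul]
    exact (mul_le_mul h1 h2 (abs_nonneg _) ((abs_nonneg _).trans h1)).trans_eq
      (div_eq_mul_inv _ _).symm
  have qy : ∀ c ∈ Set.Ioo 0 r, (y c - |Λ|) ^ 2 ≤ q c ^ 2 := fun c hc => by
    rw [sq_le_sq]
    have := abs_abs_sub_abs_le_abs_sub (M * Real.sin (2 * c)) (-Λ)
    rw [abs_mul, abs_of_pos (sin_two_mul_pos hr hc), abs_neg, sub_neg_eq_add] at this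
    exact this
  -- the error terms
  obtain ⟨R, hR⟩ : ∃ R : ℝ → ℂ, R = fun c => phase M Λ c *
    (Complex.I * ((|Λ| / (q c ^ 2 + |Λ|) : ℝ) : ℂ) * B c - B₁ c * m c - B c * m₁ c) := ⟨_, rfl⟩
  have key : IsLogDeriv r (fun c => phase M Λ c * (B c * m c))
      (fun c => Complex.I * (phase M Λ c * B c) - R c) := by
    refine (hE.mul (hB.mul hmd)).congr fun c _ => ?_
    have h : (q c : ℂ) * m c = 1 - ((|Λ| / (q c ^ 2 + |Λ|) : ℝ) : ℂ) := by
      rw [hm, ← Complex.ofReal_one, ← Complex.ofReal_sub, ← Complex.ofReal_mul]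
      congr 1
      have := (den c).ne'
      field_simp
      ring
    rw [hR]
    linear_combination (Complex.I * phase M Λ c * B c) * h
  have nR : ∀ c ∈ Set.Ioo 0 r, ‖R c‖ ≤ (3 * K * ((y c + |Λ|) / (q c ^ 2 + |Λ|))) *
      √(Real.sin (2 * c)) := by
    intro c hc
    have hd := den c
    have hb := b c hc
    have hb₁ := b₁ c hc
    have h1 := nm c hc
    have h2 := nm₁ c hc
    have hy0 := y0 c hc
    rw [hR]
    simp only
    rw [norm_mul, nE, one_mul]
    calc ‖Complex.I * ((|Λ| / (q c ^ 2 + |Λ|) : ℝ) : ℂ) * B c - B₁ c * m c - B c * m₁ c‖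
        ≤ |Λ| / (q c ^ 2 + |Λ|) * ‖B c‖ + ‖B₁ c‖ * |m c| + ‖B c‖ * |m₁ c| := by
          refine (norm_sub_le _ _).trans ?_
          gcongr
          · refine (norm_sub_le _ _).trans ?_
            rw [norm_mul, norm_mul, norm_mul, Complex.norm_I, one_mul, Complex.norm_real,
              Complex.norm_real, Real.norm_of_nonneg (by positivity), Real.norm_eq_abs]
          · rw [norm_mul, Complex.norm_real, Real.norm_eq_abs]
      _ ≤ |Λ| / (q c ^ 2 + |Λ|) * (K * √(Real.sin (2 * c))) +
          (K * √(Real.sin (2 * c))) * ((y c + |Λ|) / (q c ^ 2 + |Λ|)) +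
          (K * √(Real.sin (2 * c))) * (2 * y c / (q c ^ 2 + |Λ|)) := by
          gcongr
      _ = (K * √(Real.sin (2 * c))) * ((3 * y c + 2 * |Λ|) / (q c ^ 2 + |Λ|)) := by ring
      _ ≤ (K * √(Real.sin (2 * c))) * ((3 * (y c + |Λ|)) / (q c ^ 2 + |Λ|)) := by
          gcongr; linarith
      _ = _ := by ring
  have frac : ∀ c ∈ Set.Ioo 0 r, (y c + |Λ|) / (q c ^ 2 + |Λ|) ≤
      6 * (1 + (√(|M| * Real.sin (2 * c)) - √|Λ|) ^ 2)⁻¹ := by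
    intro c hc
    have h := add_mul_sqrt_sub_sq_le (y0 c hc) hL
    rw [div_le_iff₀ (den c), ← div_eq_mul_inv, div_mul_eq_mul_div, le_div_iff₀ (by positivity)]
    refine h.trans ?_
    linarith [qy c hc]
  have bR : SqrtBounded r (18 * K) R := fun c hc => by
    refine (nR c hc).trans (mul_le_mul_of_nonneg_right ?_ (Real.sqrt_nonneg _))
    have h1 : (1 + (√(|M| * Real.sin (2 * c)) - √|Λ|) ^ 2)⁻¹ ≤ 1 :=
      inv_le_one_of_one_le₀ (by nlinarith [sq_nonneg (√(|M| * Real.sin (2 * c)) - √|Λ|)])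
    have := frac c hc
    nlinarith
  have bEB : SqrtBounded r K (fun c => Complex.I * (phase M Λ c * B c)) := fun c hc => by
    rw [norm_mul, norm_mul, nE, Complex.norm_I, one_mul, one_mul]; exact b c hc
  have cR : ContinuousOn R (Set.Ioo 0 r) := by
    have : Continuous fun c => ((|Λ| / (q c ^ 2 + |Λ|) : ℝ) : ℂ) :=
      Complex.continuous_ofReal.comp (Continuous.div (by fun_prop) (by fun_prop)
        fun c => (den c).ne')
    have := this.continuousOn (s := Set.Ioo 0 r)
    rw [hR]
    fun_prop
  have nm' : ∀ c ∈ Set.Ioo 0 r, |m c| ≤ 6 := fun c hc => by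
    have h1 : (1 + (√(|M| * Real.sin (2 * c)) - √|Λ|) ^ 2)⁻¹ ≤ 1 :=
      inv_le_one_of_one_le₀ (by nlinarith [sq_nonneg (√(|M| * Real.sin (2 * c)) - √|Λ|)])
    linarith [nm c hc, frac c hc]
  have zero := integral_logDeriv_eq_zero h0 hr (K := K * 6) (K₁ := K + 18 * K) key
    (fun c hc => by
      rw [norm_mul, nE, one_mul, norm_mul, Complex.norm_real, Real.norm_eq_abs]
      have := b c hc; have := nm' c hc
      calc ‖B c‖ * |m c| ≤ (K * √(Real.sin (2 * c))) * 6 := by gcongr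
        _ = _ := by ring)
    (fun c hc => by simp [z c hc])
    (by fun_prop)
    (fun c hc => by
      rw [add_mul]
      exact (norm_sub_le _ _).trans (add_le_add (bEB c hc) (bR c hc)))
  simp only [sub_div] at zero
  rw [integral_sub (integrableOn_div_sin h0 hr (by fun_prop) bEB)
    (integrableOn_div_sin h0 hr cR bR)] at zero
  simp only [mul_div_assoc] at zero
  rw [integral_const_mul, sub_eq_zero] at zero
  have nn := congrArg norm zero
  rw [norm_mul, Complex.norm_I, one_mul] at nn
  simp only [mul_div_assoc]
  rw [nn]
  obtain ⟨hi, hle⟩ := integral_dominating_le h0 hr (M := |M|) (L := |Λ|) (abs_pos.2 hM)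
  refine (norm_integral_le_of_norm_le (hi.const_mul (18 * K))
    ((ae_restrict_mem measurableSet_Ioo).mono fun c hc => ?_)).trans ?_
  · have hs := sin_two_mul_pos hr hc
    have hs' := Real.sqrt_pos.2 hs
    rw [norm_div, Complex.norm_real, Real.norm_of_nonneg hs.le, div_le_iff₀ hs]
    refine (nR c hc).trans ?_
    have := frac c hc
    calc (3 * K * ((y c + |Λ|) / (q c ^ 2 + |Λ|))) * √(Real.sin (2 * c))
        ≤ (3 * K * (6 * (1 + (√(|M| * Real.sin (2 * c)) - √|Λ|) ^ 2)⁻¹)) *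
          √(Real.sin (2 * c)) := by gcongr
      _ = (18 * K * (1 + (√(|M| * Real.sin (2 * c)) - √|Λ|) ^ 2)⁻¹) *
          ((√(Real.sin (2 * c)))⁻¹ * √(Real.sin (2 * c)) ^ 2) := by field_simp; ring
      _ = _ := by rw [Real.sq_sqrt hs.le]; ring
  · rw [integral_const_mul]
    calc _ ≤ 18 * K * (2 * Real.pi * (√|M|)⁻¹) := by gcongr
      _ = _ := by ring

end

/-- `f` is twice differentiable on `(0, r)` along `sin(2c) · d/dc`, with derivatives `f₁`, `f₂`,
all bounded by `K`. -/
structure BoundedJet (r K : ℝ) (f f₁ f₂ : ℝ → ℂ) : Prop where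
  deriv_fst : IsLogDeriv r f f₁
  deriv_snd : IsLogDeriv r f₁ f₂
  cont : ContinuousOn f₂ (Set.Ioo 0 r)
  bound : ∀ c ∈ Set.Ioo 0 r, ‖f c‖ ≤ K
  bound_fst : ∀ c ∈ Set.Ioo 0 r, ‖f₁ c‖ ≤ K
  bound_snd : ∀ c ∈ Set.Ioo 0 r, ‖f₂ c‖ ≤ K

section

variable {r : ℝ}

lemma BoundedJet.mul {K K' : ℝ} {f f₁ f₂ g g₁ g₂ : ℝ → ℂ}
    (hf : BoundedJet r K f f₁ f₂) (hg : BoundedJet r K' g g₁ g₂) :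
    BoundedJet r (4 * (K * K')) (fun c => f c * g c) (fun c => f₁ c * g c + f c * g₁ c)
      (fun c => (f₂ c * g c + f₁ c * g₁ c) + (f₁ c * g₁ c + f c * g₂ c)) := by
  have m : ∀ {a b : ℂ}, ‖a‖ ≤ K → ‖b‖ ≤ K' → ‖a * b‖ ≤ K * K' := fun {a b} h1 h2 => by
    rw [norm_mul]
    exact mul_le_mul h1 h2 (norm_nonneg _) ((norm_nonneg _).trans h1)
  have c0 := hf.deriv_fst.continuousOn
  have c1 := hf.deriv_snd.continuousOn
  have c2 := hf.cont
  have d0 := hg.deriv_fst.continuousOn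
  have d1 := hg.deriv_snd.continuousOn
  have d2 := hg.cont
  have nn : ∀ c ∈ Set.Ioo 0 r, 0 ≤ K * K' := fun c hc =>
    (norm_nonneg _).trans (m (hf.bound c hc) (hg.bound c hc))
  refine ⟨hf.deriv_fst.mul hg.deriv_fst,
    (hf.deriv_snd.mul hg.deriv_fst).add (hf.deriv_fst.mul hg.deriv_snd), by fun_prop, ?_, ?_, ?_⟩
  · intro c hc
    linarith [nn c hc, m (hf.bound c hc) (hg.bound c hc)]
  · intro c hc
    have := norm_add_le (f₁ c * g c) (f c * g₁ c)
    linarith [nn c hc, m (hf.bound_fst c hc) (hg.bound c hc), m (hf.bound c hc) (hg.bound_fst c hc)]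
  · intro c hc
    have := norm_add_le (f₂ c * g c + f₁ c * g₁ c) (f₁ c * g₁ c + f c * g₂ c)
    have := norm_add_le (f₂ c * g c) (f₁ c * g₁ c)
    have := norm_add_le (f₁ c * g₁ c) (f c * g₂ c)
    linarith [m (hf.bound_fst c hc) (hg.bound_fst c hc), m (hf.bound_snd c hc) (hg.bound c hc),
      m (hf.bound c hc) (hg.bound_snd c hc)]

lemma isLogDeriv_sqrt_sin (hr : r ≤ 1 / 8) :
    IsLogDeriv r (fun c => ((√(Real.sin (2 * c)) : ℝ) : ℂ))
      (fun c => ((Real.cos (2 * c) * √(Real.sin (2 * c)) : ℝ) : ℂ)) := by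
  refine isLogDeriv_ofReal fun c hc => ?_
  have hs := sin_two_mul_pos hr hc
  have hs' := Real.sqrt_pos.2 hs
  refine (((((hasDerivAt_id c).const_mul 2).sin)).sqrt hs.ne').congr_deriv ?_
  simp only [id]
  have := Real.sq_sqrt hs.le
  field_simp
  rw [this]

lemma norm_cos_le_one (x : ℝ) : ‖((Real.cos x : ℝ) : ℂ)‖ ≤ 1 := by
  rw [Complex.norm_real]; exact Real.abs_cos_le_one x

/-- Multiplying by the square root of `sin 2c`. -/
lemma BoundedJet.sqrt_mul (hr : r ≤ 1 / 8) {K : ℝ} {f f₁ f₂ : ℝ → ℂ}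
    (hf : BoundedJet r K f f₁ f₂) (z : ∀ c, r / 2 < c → f c = 0)
    (z₁ : ∀ c, r / 2 < c → f₁ c = 0) :
    ∃ B₁ B₂ : ℝ → ℂ, IsLogDeriv r (fun c => (√(Real.sin (2 * c)) : ℝ) * f c) B₁ ∧
      IsLogDeriv r B₁ B₂ ∧ ContinuousOn B₂ (Set.Ioo 0 r) ∧
      SqrtBounded r (6 * K) (fun c => (√(Real.sin (2 * c)) : ℝ) * f c) ∧
      SqrtBounded r (6 * K) B₁ ∧ SqrtBounded r (6 * K) B₂ ∧
      ∀ c, r / 2 < c → B₁ c = 0 := by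
  have hs := isLogDeriv_sqrt_sin hr
  have hs₁ : IsLogDeriv r (fun c => ((Real.cos (2 * c) * √(Real.sin (2 * c)) : ℝ) : ℂ)) _ :=
    (((isLogDeriv_cos hr).mul hs).congr_fun fun c => by push_cast; rfl)
  have c0 := hf.deriv_fst.continuousOn
  have c1 := hf.deriv_snd.continuousOn
  have c2 := hf.cont
  have t0 : ∀ c ∈ Set.Ioo 0 r,
      ‖((√(Real.sin (2 * c)) : ℝ) : ℂ)‖ ≤ 1 * √(Real.sin (2 * c)) := fun c _ => by
    rw [Complex.norm_real, Real.norm_of_nonneg (Real.sqrt_nonneg _), one_mul]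
  have t1 : ∀ c ∈ Set.Ioo 0 r,
      ‖((Real.cos (2 * c) * √(Real.sin (2 * c)) : ℝ) : ℂ)‖ ≤ 1 * √(Real.sin (2 * c)) :=
    fun c hc => by
    rw [Complex.ofReal_mul, norm_mul]
    refine (mul_le_mul (norm_cos_le_one _) (t0 c hc) (norm_nonneg _) zero_le_one).trans_eq ?_
    ring
  have t2 : ∀ c ∈ Set.Ioo 0 r,
      ‖((-(2 * Real.sin (2 * c) ^ 2) : ℝ) : ℂ) * ((√(Real.sin (2 * c)) : ℝ) : ℂ) +
        ((Real.cos (2 * c) : ℝ) : ℂ) * ((Real.cos (2 * c) * √(Real.sin (2 * c)) : ℝ) : ℂ)‖ ≤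
      3 * √(Real.sin (2 * c)) := fun c hc => by
    refine (norm_add_le _ _).trans ?_
    rw [norm_mul, norm_mul]
    have h1 : ‖((-(2 * Real.sin (2 * c) ^ 2) : ℝ) : ℂ)‖ ≤ 2 := by
      rw [Complex.norm_real, norm_neg, Real.norm_of_nonneg (by positivity)]
      nlinarith [Real.sin_sq_le_one (2 * c)]
    have a := mul_le_mul h1 (t0 c hc) (norm_nonneg _) zero_le_two
    have b := mul_le_mul (norm_cos_le_one (2 * c)) (t1 c hc) (norm_nonneg _) zero_le_one
    linarith
  have m : ∀ {c : ℝ} {k : ℝ} {a b : ℂ}, ‖a‖ ≤ k * √(Real.sin (2 * c)) → ‖b‖ ≤ K →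
      ‖a * b‖ ≤ k * K * √(Real.sin (2 * c)) := fun {c k a b} h1 h2 => by
    rw [norm_mul]
    refine (mul_le_mul h1 h2 (norm_nonneg _) ((norm_nonneg _).trans h1)).trans_eq (by ring)
  have nn : ∀ c ∈ Set.Ioo 0 r, 0 ≤ K * √(Real.sin (2 * c)) := fun c hc =>
    mul_nonneg ((norm_nonneg _).trans (hf.bound c hc)) (Real.sqrt_nonneg _)
  refine ⟨_, _, hs.mul hf.deriv_fst, (hs₁.mul hf.deriv_fst).add (hs.mul hf.deriv_snd), ?_, ?_, ?_,
    ?_, ?_⟩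
  · fun_prop
  · intro c hc
    linarith [nn c hc, m (t0 c hc) (hf.bound c hc)]
  · intro c hc
    refine (norm_add_le _ _).trans ?_
    linarith [nn c hc, m (t1 c hc) (hf.bound c hc), m (t0 c hc) (hf.bound_fst c hc)]
  · intro c hc
    refine (norm_add_le _ _).trans ?_
    refine (add_le_add (norm_add_le _ _) (norm_add_le _ _)).trans ?_
    linarith [nn c hc, m (t2 c hc) (hf.bound c hc), m (t1 c hc) (hf.bound_fst c hc),
      m (t0 c hc) (hf.bound_snd c hc)]
  · intro c hc
    simp only [z c hc, z₁ c hc]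
    ring

/-- The jet of a dilated bump. -/
lemma exists_boundedJet_bump {ψ : ℝ → ℝ} (hψ : ContDiff ℝ (⊤ : ℕ∞) ψ)
    (hsupp : ∀ x, 1 / 16 < x → ψ x = 0) :
    ∃ K, 0 ≤ K ∧ ∀ T : ℝ, 1 ≤ T → ∃ p₁ p₂ : ℝ → ℂ,
      BoundedJet (1 / (8 * T)) K (fun c => (ψ (T * c) : ℂ)) p₁ p₂ ∧
      (∀ c, 1 / (8 * T) / 2 < c → (ψ (T * c) : ℂ) = 0) ∧
      ∀ c, 1 / (8 * T) / 2 < c → p₁ c = 0 := by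
  have h1 : ContDiff ℝ (⊤ : ℕ∞) (deriv ψ) := (contDiff_infty_iff_deriv.1 hψ).2
  have h2 : ContDiff ℝ (⊤ : ℕ∞) (deriv (deriv ψ)) := (contDiff_infty_iff_deriv.1 h1).2
  have bd : ∀ f : ℝ → ℝ, Continuous f → ∃ K, 0 ≤ K ∧ ∀ x ∈ Set.Icc (0 : ℝ) 1, |f x| ≤ K := by
    intro f hf
    obtain ⟨K, hK⟩ := isCompact_Icc.exists_bound_of_continuousOn (s := Set.Icc (0:ℝ) 1)
      hf.continuousOn
    exact ⟨K, (norm_nonneg _).trans (hK 0 (by simp)), hK⟩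
  obtain ⟨K0, k0, b0⟩ := bd ψ hψ.continuous
  obtain ⟨K1, k1, b1⟩ := bd _ h1.continuous
  obtain ⟨K2, k2, b2⟩ := bd _ h2.continuous
  refine ⟨K0 + K1 + K2, by positivity, fun T hT => ?_⟩
  have hT0 : 0 < T := by linarith
  have hr : 1 / (8 * T) ≤ 1 / 8 := by
    apply one_div_le_one_div_of_le <;> linarith
  have hTc : ∀ c, 1 / (8 * T) / 2 < c → 1 / 16 < T * c := fun c hc => by
    have := mul_lt_mul_of_pos_left hc hT0
    have e : T * (1 / (8 * T) / 2) = 1 / 16 := by field_simp; norm_num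
    rwa [e] at this
  have mem : ∀ c ∈ Set.Ioo 0 (1 / (8 * T)), 0 < T * c ∧ T * c ≤ 1 / 8 := fun c hc => by
    refine ⟨mul_pos hT0 hc.1, ?_⟩
    have := mul_le_mul_of_nonneg_left hc.2.le hT0.le
    have e : T * (1 / (8 * T)) = 1 / 8 := by field_simp
    rwa [e] at this
  have hd : ∀ (f : ℝ → ℝ) c, ContDiff ℝ (⊤ : ℕ∞) f →
      HasDerivAt (fun c => f (T * c)) (T * deriv f (T * c)) c := fun f c hf => by
    have h := (hf.differentiable (by simp)).differentiableAt.hasDerivAt (x := T * c)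
    have := h.comp c ((hasDerivAt_id c).const_mul T)
    refine this.congr_deriv ?_
    ring
  have d0 : IsLogDeriv (1 / (8 * T)) (fun c => (ψ (T * c) : ℂ))
      (fun c => ((Real.sin (2 * c) * (T * deriv ψ (T * c)) : ℝ) : ℂ)) :=
    isLogDeriv_ofReal fun c hc => (hd ψ c hψ).congr_deriv
      (mul_div_cancel_left₀ _ (sin_two_mul_pos hr hc).ne').symm
  have d1 : IsLogDeriv (1 / (8 * T))
      (fun c => ((Real.sin (2 * c) * (T * deriv ψ (T * c)) : ℝ) : ℂ))
      (fun c => ((Real.sin (2 * c) * (T * (2 * Real.cos (2 * c) * deriv ψ (T * c) +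
        Real.sin (2 * c) * (T * deriv (deriv ψ) (T * c)))) : ℝ) : ℂ)) :=
    isLogDeriv_ofReal fun c hc => ((((hasDerivAt_id c).const_mul 2).sin).mul
      ((hd (deriv ψ) c h1).const_mul T)).congr_deriv (by
      have := sin_two_mul_pos hr hc
      simp only [id]
      field_simp)
  have small : ∀ c ∈ Set.Ioo 0 (1 / (8 * T)), |Real.sin (2 * c) * T| ≤ 1 / 4 := fun c hc => by
    have h := sin_two_mul_pos hr hc
    have h' := Real.sin_le (x := 2 * c) (by linarith [hc.1])
    rw [abs_of_pos (by positivity)]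
    nlinarith [mem c hc]
  have zero : ∀ x, 1 / 16 < x → deriv ψ x = 0 := fun x hx => by
    have : ψ =ᶠ[nhds x] fun _ => 0 := by
      filter_upwards [Ioi_mem_nhds hx] with y hy using hsupp y hy
    rw [this.deriv_eq]
    simp
  have c1 := h1.continuous
  have c2 := h2.continuous
  refine ⟨_, _, ⟨d0, d1, by fun_prop, ?_, ?_, ?_⟩, ?_, ?_⟩
  · intro c hc
    rw [Complex.norm_real]
    have := b0 (T * c) ⟨(mem c hc).1.le, by linarith [mem c hc]⟩
    exact this.trans (by linarith)
  · intro c hc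
    rw [Complex.norm_real, Real.norm_eq_abs, ← mul_assoc, abs_mul]
    have := b1 (T * c) ⟨(mem c hc).1.le, by linarith [mem c hc]⟩
    have := mul_le_mul (small c hc) this (abs_nonneg _) (by norm_num)
    linarith
  · intro c hc
    have e1 := b1 (T * c) ⟨(mem c hc).1.le, by linarith [mem c hc]⟩
    have e2 := b2 (T * c) ⟨(mem c hc).1.le, by linarith [mem c hc]⟩
    have f1 : |2 * Real.cos (2 * c) * deriv ψ (T * c)| ≤ 2 * K1 := by
      rw [abs_mul, abs_mul, abs_two]
      have := mul_le_mul (Real.abs_cos_le_one (2 * c)) e1 (abs_nonneg _) zero_le_one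
      linarith
    have f2 : |Real.sin (2 * c) * (T * deriv (deriv ψ) (T * c))| ≤ 1 / 4 * K2 := by
      rw [← mul_assoc, abs_mul]
      exact mul_le_mul (small c hc) e2 (abs_nonneg _) (by norm_num)
    rw [Complex.norm_real, Real.norm_eq_abs, ← mul_assoc, abs_mul]
    have := mul_le_mul (small c hc) ((abs_add_le _ _).trans (add_le_add f1 f2)) (abs_nonneg _)
      (by norm_num)
    linarith
  · intro c hc
    simp [hsupp _ (hTc c hc)]
  · intro c hc
    simp [zero _ (hTc c hc)]

end

section

variable {τ : ℂ}

lemma exists_norm_ampl_le_three (hτ : τ.re = 0) :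
    ∃ C, 0 ≤ C ∧ ∀ lam : ℂ, lam.re = 0 → 1 ≤ ‖lam‖ → ∀ δ, 0 < δ → δ ≤ 1 →
      ‖ampl τ 1 lam δ‖ ≤ C * (√‖lam‖)⁻¹ ∧ ‖ampl τ (symEuler τ 1) lam δ‖ ≤ C * (√‖lam‖)⁻¹ ∧
      ‖ampl τ (symEuler τ (symEuler τ 1)) lam δ‖ ≤ C * (√‖lam‖)⁻¹ := by
  obtain ⟨C0, h0, b0⟩ := exists_norm_ampl_le hτ 1
  obtain ⟨C1, h1, b1⟩ := exists_norm_ampl_le hτ (symEuler τ 1)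
  obtain ⟨C2, h2, b2⟩ := exists_norm_ampl_le hτ (symEuler τ (symEuler τ 1))
  refine ⟨C0 + C1 + C2, by positivity, fun lam hl hl1 δ hd hd1 => ?_⟩
  have hp : 0 ≤ (√‖lam‖)⁻¹ := by positivity
  refine ⟨(b0 lam hl hl1 δ hd hd1).trans ?_, (b1 lam hl hl1 δ hd hd1).trans ?_,
    (b2 lam hl hl1 δ hd hd1).trans ?_⟩ <;> gcongr <;> linarith

lemma exists_boundedJet_ampl_cos (hτ : τ.re = 0) :
    ∃ C, 0 ≤ C ∧ ∀ r : ℝ, r ≤ 1 / 8 → ∀ lam : ℂ, lam.re = 0 → 1 ≤ ‖lam‖ → ∃ g₁ g₂ : ℝ → ℂ,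
      BoundedJet r (C * (√‖lam‖)⁻¹) (fun c => ampl τ 1 lam (Real.cos c)) g₁ g₂ := by
  obtain ⟨C, hC, b⟩ := exists_norm_ampl_le_three hτ
  refine ⟨6 * C, by positivity, fun r hr lam hl hl1 => ?_⟩
  have trig : ∀ c ∈ Set.Ioo 0 r, 0 < Real.cos c ∧ Real.cos c < 1 ∧ 0 < Real.sin c := by
    intro c hc
    have hpi : c < Real.pi / 2 := by linarith [hc.2, Real.pi_gt_three]
    refine ⟨Real.cos_pos_of_mem_Ioo ⟨by linarith [hc.1], hpi⟩, ?_,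
      Real.sin_pos_of_pos_of_lt_pi hc.1 (by linarith [Real.pi_pos])⟩
    rw [← Real.cos_zero]
    exact Real.cos_lt_cos_of_nonneg_of_le_pi_div_two le_rfl hpi.le hc.1
  have D : ∀ P, IsLogDeriv r (fun c => ampl τ P lam (Real.cos c))
      (fun c => (-2 * Real.sin c ^ 2 : ℝ) * ampl τ (symEuler τ P) lam (Real.cos c)) := by
    intro P c hc
    obtain ⟨h1, h2, h3⟩ := trig c hc
    refine ((hasDerivAt_ampl hτ P hl h1 h2).scomp c (Real.hasDerivAt_cos c)).congr_deriv ?_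
    rw [Real.sin_two_mul, Complex.real_smul]
    have e1 : ((Real.cos c : ℝ) : ℂ) ≠ 0 := by exact_mod_cast h1.ne'
    have e2 : ((Real.sin c : ℝ) : ℂ) ≠ 0 := by exact_mod_cast h3.ne'
    simp only [Complex.ofReal_mul, Complex.ofReal_pow, Complex.ofReal_neg, Complex.ofReal_ofNat]
    field_simp
  have dS : IsLogDeriv r (fun c => ((-2 * Real.sin c ^ 2 : ℝ) : ℂ))
      (fun c => ((-2 * Real.sin (2 * c) ^ 2 : ℝ) : ℂ)) := by
    refine isLogDeriv_ofReal fun c hc => ?_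
    have := sin_two_mul_pos hr hc
    refine (((Real.hasDerivAt_sin c).pow 2).const_mul (-2)).congr_deriv ?_
    field_simp
    rw [Real.sin_two_mul]
    push_cast
    ring
  have d2 := dS.mul (D (symEuler τ 1))
  have hp : 0 ≤ (√‖lam‖)⁻¹ := by positivity
  have s2 : ∀ x, ‖((-2 * Real.sin x ^ 2 : ℝ) : ℂ)‖ ≤ 2 := fun x => by
    rw [Complex.norm_real, norm_mul, norm_neg, Real.norm_two, Real.norm_of_nonneg (sq_nonneg _)]
    linarith [Real.sin_sq_le_one x]
  have E0 := fun c (hc : c ∈ Set.Ioo 0 r) => b lam hl hl1 _ (trig c hc).1 (trig c hc).2.1.le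
  have mono : C * (√‖lam‖)⁻¹ ≤ 6 * C * (√‖lam‖)⁻¹ := by gcongr; linarith
  have nnC : 0 ≤ C * (√‖lam‖)⁻¹ := by positivity
  refine ⟨_, _, D 1, d2, ?_, ?_, ?_, ?_⟩
  · have c1 := (D (symEuler τ 1)).continuousOn
    have c2 := (D (symEuler τ (symEuler τ 1))).continuousOn
    have h1 : Continuous fun x : ℝ => ((-2 * Real.sin (2 * x) ^ 2 : ℝ) : ℂ) := by fun_prop
    exact (h1.continuousOn.mul c1).add (dS.continuousOn.mul (dS.continuousOn.mul c2))
  · intro c hc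
    exact (E0 c hc).1.trans mono
  · intro c hc
    rw [norm_mul]
    refine (mul_le_mul (s2 c) (E0 c hc).2.1 (norm_nonneg _) zero_le_two).trans ?_
    linarith
  · intro c hc
    refine (norm_add_le _ _).trans ?_
    rw [norm_mul, norm_mul, norm_mul]
    refine (add_le_add (mul_le_mul (s2 (2 * c)) (E0 c hc).2.1 (norm_nonneg _) zero_le_two)
      (mul_le_mul (s2 c) (mul_le_mul (s2 c) (E0 c hc).2.2 (norm_nonneg _) zero_le_two)
      (by positivity) zero_le_two)).trans ?_
    linarith

lemma exists_boundedJet_ampl_sin (hτ : τ.re = 0) :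
    ∃ C, 0 ≤ C ∧ ∀ r : ℝ, r ≤ 1 / 8 → ∀ lam : ℂ, lam.re = 0 → 1 ≤ ‖lam‖ → ∃ g₁ g₂ : ℝ → ℂ,
      BoundedJet r (C * (√‖lam‖)⁻¹) (fun c => ampl τ 1 lam (Real.sin c)) g₁ g₂ := by
  obtain ⟨C, hC, b⟩ := exists_norm_ampl_le_three hτ
  refine ⟨6 * C, by positivity, fun r hr lam hl hl1 => ?_⟩
  have trig : ∀ c ∈ Set.Ioo 0 r, 0 < Real.sin c ∧ Real.sin c < 1 ∧ 0 < Real.cos c := by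
    intro c hc
    have hpi : c < Real.pi / 2 := by linarith [hc.2, Real.pi_gt_three]
    refine ⟨Real.sin_pos_of_pos_of_lt_pi hc.1 (by linarith [Real.pi_pos]), ?_,
      Real.cos_pos_of_mem_Ioo ⟨by linarith [hc.1], hpi⟩⟩
    have := Real.sin_le hc.1.le
    linarith [hc.2]
  have D : ∀ P, IsLogDeriv r (fun c => ampl τ P lam (Real.sin c))
      (fun c => (2 * Real.cos c ^ 2 : ℝ) * ampl τ (symEuler τ P) lam (Real.sin c)) := by
    intro P c hc
    obtain ⟨h1, h2, h3⟩ := trig c hc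
    refine ((hasDerivAt_ampl hτ P hl h1 h2).scomp c (Real.hasDerivAt_sin c)).congr_deriv ?_
    rw [Real.sin_two_mul, Complex.real_smul]
    have e1 : ((Real.cos c : ℝ) : ℂ) ≠ 0 := by exact_mod_cast h3.ne'
    have e2 : ((Real.sin c : ℝ) : ℂ) ≠ 0 := by exact_mod_cast h1.ne'
    simp only [Complex.ofReal_mul, Complex.ofReal_pow, Complex.ofReal_ofNat]
    field_simp
  have dS : IsLogDeriv r (fun c => ((2 * Real.cos c ^ 2 : ℝ) : ℂ))
      (fun c => ((-2 * Real.sin (2 * c) ^ 2 : ℝ) : ℂ)) := by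
    refine isLogDeriv_ofReal fun c hc => ?_
    have := sin_two_mul_pos hr hc
    refine (((Real.hasDerivAt_cos c).pow 2).const_mul 2).congr_deriv ?_
    field_simp
    rw [Real.sin_two_mul]
    push_cast
    ring
  have d2 := dS.mul (D (symEuler τ 1))
  have hp : 0 ≤ (√‖lam‖)⁻¹ := by positivity
  have s2 : ∀ x, ‖((-2 * Real.sin x ^ 2 : ℝ) : ℂ)‖ ≤ 2 := fun x => by
    rw [Complex.norm_real, norm_mul, norm_neg, Real.norm_two, Real.norm_of_nonneg (sq_nonneg _)]
    linarith [Real.sin_sq_le_one x]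
  have s3 : ∀ x, ‖((2 * Real.cos x ^ 2 : ℝ) : ℂ)‖ ≤ 2 := fun x => by
    rw [Complex.norm_real, norm_mul, Real.norm_two, Real.norm_of_nonneg (sq_nonneg _)]
    linarith [Real.cos_sq_le_one x]
  have E0 := fun c (hc : c ∈ Set.Ioo 0 r) => b lam hl hl1 _ (trig c hc).1 (trig c hc).2.1.le
  have mono : C * (√‖lam‖)⁻¹ ≤ 6 * C * (√‖lam‖)⁻¹ := by gcongr; linarith
  have nnC : 0 ≤ C * (√‖lam‖)⁻¹ := by positivity
  refine ⟨_, _, D 1, d2, ?_, ?_, ?_, ?_⟩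
  · have c1 := (D (symEuler τ 1)).continuousOn
    have c2 := (D (symEuler τ (symEuler τ 1))).continuousOn
    have h1 : Continuous fun x : ℝ => ((-2 * Real.sin (2 * x) ^ 2 : ℝ) : ℂ) := by fun_prop
    exact (h1.continuousOn.mul c1).add (dS.continuousOn.mul (dS.continuousOn.mul c2))
  · intro c hc
    exact (E0 c hc).1.trans mono
  · intro c hc
    rw [norm_mul]
    refine (mul_le_mul (s3 c) (E0 c hc).2.1 (norm_nonneg _) zero_le_two).trans ?_
    linarith
  · intro c hc
    refine (norm_add_le _ _).trans ?_
    rw [norm_mul, norm_mul, norm_mul]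
    refine (add_le_add (mul_le_mul (s2 (2 * c)) (E0 c hc).2.1 (norm_nonneg _) zero_le_two)
      (mul_le_mul (s3 c) (mul_le_mul (s3 c) (E0 c hc).2.2 (norm_nonneg _) zero_le_two)
      (by positivity) zero_le_two)).trans ?_
    linarith

end

/-- The Fourier integral of an even real function is real. -/
lemma integral_even_mul_exp {β : ℝ → ℝ} (hβ : ∀ x, β (-x) = β x) (ξ : ℝ) :
    ∫ x, (β x : ℂ) * Complex.exp (-Complex.I * (ξ * x : ℝ))
      = ((∫ x, (β x : ℂ) * Complex.exp (-Complex.I * (ξ * x : ℝ))).re : ℂ) := by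
  refine (Complex.conj_eq_iff_re.1 ?_).symm
  rw [← integral_conj, ← integral_neg_eq_self]
  congr 1
  ext x
  rw [hβ, map_mul, Complex.conj_ofReal, ← Complex.exp_conj]
  simp

lemma re_mul_exp (b ξ x : ℝ) :
    ((b : ℂ) * Complex.exp (-Complex.I * (ξ * x : ℝ))).re = b * Real.cos (ξ * x) := by
  rw [Complex.re_ofReal_mul, show -Complex.I * ((ξ * x : ℝ) : ℂ) = ((-(ξ * x) : ℝ) : ℂ) * Complex.I
    by push_cast; ring, Complex.exp_ofReal_mul_I_re, Real.cos_neg]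

lemma integrable_mul_exp {β : ℝ → ℝ} (hβ : Integrable β) (ξ : ℝ) :
    Integrable fun x => (β x : ℂ) * Complex.exp (-Complex.I * (ξ * x : ℝ)) := by
  refine hβ.ofReal.mul_bdd (c := 1) (by fun_prop) (Filter.Eventually.of_forall fun x => ?_)
  rw [Complex.norm_exp]
  simp

/-- A smooth, even, compactly supported function with nonnegative Fourier transform, bounded
below near the origin. -/
lemma exists_bump :
    ∃ ψ : ℝ → ℝ, ContDiff ℝ (⊤ : ℕ∞) ψ ∧ (∀ x, ψ (-x) = ψ x) ∧ (∀ x, 1 / 16 < |x| → ψ x = 0) ∧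
      ∀ ξ : ℝ, ∃ a : ℝ, 0 ≤ a ∧ (|ξ| ≤ 1 → 1 ≤ a) ∧
        (1 / (2 * Real.pi)) * ∫ x, (ψ x : ℂ) * Complex.exp (-Complex.I * (ξ * x : ℝ)) = a := by
  let b : ContDiffBump (0 : ℝ) := ⟨1 / 64, 1 / 32, by norm_num, by norm_num⟩
  set β : ℝ → ℝ := b.normed volume with hβ
  have even : ∀ x, β (-x) = β x := b.normed_neg
  have nonneg : ∀ x, 0 ≤ β x := b.nonneg_normed
  have int : Integrable β := b.integrable_normed
  have one : ∫ x, β x = 1 := b.integral_normed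
  have vanish : ∀ x, 1 / 32 ≤ |x| → β x = 0 := fun x hx => by
    by_contra h
    have : x ∈ Function.support β := h
    rw [hβ, b.support_normed_eq] at this
    have h2 : |x| < 1 / 32 := by simpa [b] using this
    linarith
  let ψ : ℝ → ℝ := fun x => ∫ t, β t * β (x - t)
  have hψ : ψ = MeasureTheory.convolution β β (ContinuousLinearMap.lsmul ℝ ℝ) volume := rfl
  refine ⟨fun x => 8 * Real.pi * ψ x, ?_, ?_, ?_, ?_⟩
  · refine contDiff_const.mul ?_
    rw [hψ]
    exact HasCompactSupport.contDiff_convolution_right _ b.hasCompactSupport_normed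
      int.locallyIntegrable b.contDiff_normed
  · intro x
    simp only [ψ]
    rw [← integral_neg_eq_self]
    congr 2
    ext t
    rw [even, ← even (-x - -t)]
    ring_nf
  · intro x hx
    have : ψ x = ∫ _ : ℝ, (0 : ℝ) := by
      refine integral_congr_ae (Filter.Eventually.of_forall fun t => ?_)
      rcases le_or_gt (1 / 32) |t| with h | h
      · simp only [vanish t h, zero_mul]
      · have : 1 / 32 ≤ |x - t| := by
          have := abs_sub_abs_le_abs_sub x t
          linarith
        simp only [vanish _ this, mul_zero]
    simp [this]
  · intro ξ
    set F : ℝ → ℂ := fun x => (β x : ℂ) * Complex.exp (-Complex.I * (ξ * x : ℝ)) with hF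
    have hFint : Integrable F := integrable_mul_exp int ξ
    set A : ℝ := (∫ x, F x).re
    have hA : ∫ x, F x = A := integral_even_mul_exp even ξ
    have key : ∫ x, (ψ x : ℂ) * Complex.exp (-Complex.I * (ξ * x : ℝ)) = (A : ℂ) * A := by
      have := integral_convolution (ContinuousLinearMap.mul ℝ ℂ) hFint hFint
      rw [hA, ContinuousLinearMap.mul_apply'] at this
      rw [← this]
      congr 1
      ext x
      rw [convolution_def, ← integral_complex_ofReal, ← integral_mul_const]
      congr 1
      ext t
      simp only [hF, ContinuousLinearMap.mul_apply']
      rw [mul_mul_mul_comm, ← Complex.exp_add]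
      push_cast
      ring_nf
    refine ⟨4 * A ^ 2, by positivity, fun h => ?_, ?_⟩
    · have hre : A = ∫ x, β x * Real.cos (ξ * x) := by
        have := integral_re hFint
        simp only [RCLike.re_to_complex] at this
        refine this.symm.trans ?_
        congr 1
        ext x
        exact re_mul_exp _ _ _
      have : 1 / 2 ≤ A := by
        rw [hre, show (1 / 2 : ℝ) = ∫ x, β x * (1 / 2) by rw [integral_mul_const, one, one_mul]]
        refine integral_mono (int.mul_const _) ?_ fun x => ?_
        · refine int.mul_bdd (c := 1) (by fun_prop) (Filter.Eventually.of_forall fun x => ?_)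
          exact Real.abs_cos_le_one _
        · rcases le_or_gt (1 / 32) |x| with hx | hx
          · simp [vanish x hx]
          · refine mul_le_mul_of_nonneg_left ?_ (nonneg x)
            have h1 := Real.one_sub_sq_div_two_le_cos (x := ξ * x)
            have h2 : |ξ * x| ≤ 1 := by
              rw [abs_mul]
              nlinarith [abs_nonneg x, abs_nonneg ξ]
            have := (sq_le_one_iff_abs_le_one _).2 h2
            linarith
      nlinarith
    · have : ∀ x : ℝ, ((8 * Real.pi * ψ x : ℝ) : ℂ) * Complex.exp (-Complex.I * (ξ * x : ℝ))
          = (8 * Real.pi : ℂ) * ((ψ x : ℂ) * Complex.exp (-Complex.I * (ξ * x : ℝ))) := fun x => by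
        push_cast; ring
      simp only [this]
      rw [integral_const_mul, key]
      push_cast
      have := Complex.ofReal_ne_zero.2 Real.pi_ne_zero
      field_simp
      ring

/-- The `2π`-periodic function equal to `f` on the period centred at the origin. -/
noncomputable def wrap (f : ℝ → ℂ) (c : ℝ) : ℂ := f (c - 2 * Real.pi * round (c / (2 * Real.pi)))

lemma periodic_wrap (f : ℝ → ℂ) : Function.Periodic (wrap f) (2 * Real.pi) := fun c => by
  have hp : 2 * Real.pi ≠ 0 := Real.two_pi_pos.ne'
  unfold wrap
  rw [add_div, div_self hp, round_add_one]
  congr 1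
  push_cast
  ring

lemma wrap_eq {f : ℝ → ℂ} (hf : ∀ x, 1 / 16 < |x| → f x = 0) {c : ℝ} {m : ℤ}
    (h : |c - 2 * Real.pi * m| < 3 * Real.pi / 2) : wrap f c = f (c - 2 * Real.pi * m) := by
  have hpi := Real.pi_gt_three
  unfold wrap
  set n := round (c / (2 * Real.pi)) with hn
  by_cases hmn : n = m
  · rw [hmn]
  have h1 : |c - 2 * Real.pi * n| ≤ Real.pi := by
    have := abs_sub_round (c / (2 * Real.pi))
    rw [← hn] at this
    have e : c - 2 * Real.pi * n = 2 * Real.pi * (c / (2 * Real.pi) - n) := by field_simp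
    rw [e, abs_mul, abs_of_pos Real.two_pi_pos]
    nlinarith
  have h2 : 2 * Real.pi ≤ |(c - 2 * Real.pi * m) - (c - 2 * Real.pi * n)| := by
    have : (1 : ℝ) ≤ |(n : ℝ) - m| := by exact_mod_cast Int.one_le_abs (sub_ne_zero.2 hmn)
    rw [show (c - 2 * Real.pi * m) - (c - 2 * Real.pi * n) = 2 * Real.pi * ((n : ℝ) - m) by ring,
      abs_mul, abs_of_pos Real.two_pi_pos]
    nlinarith
  have h3 := abs_sub (c - 2 * Real.pi * m) (c - 2 * Real.pi * n)
  rw [hf _ (by linarith), hf _ (by linarith)]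

lemma contDiff_wrap {f : ℝ → ℂ} (hf : ∀ x, 1 / 16 < |x| → f x = 0)
    (hs : ContDiff ℝ (⊤ : ℕ∞) f) : ContDiff ℝ (⊤ : ℕ∞) (wrap f) := by
  rw [contDiff_iff_contDiffAt]
  intro c
  set m := round (c / (2 * Real.pi)) with hm
  have h1 : |c - 2 * Real.pi * m| < 3 * Real.pi / 2 := by
    have := abs_sub_round (c / (2 * Real.pi))
    rw [← hm] at this
    have e : c - 2 * Real.pi * m = 2 * Real.pi * (c / (2 * Real.pi) - m) := by field_simp
    rw [e, abs_mul, abs_of_pos Real.two_pi_pos]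
    nlinarith [Real.pi_pos]
  have h2 : ContDiffAt ℝ (⊤ : ℕ∞) (fun x => f (x - 2 * Real.pi * m)) c :=
    (hs.comp (contDiff_id.sub contDiff_const)).contDiffAt
  refine h2.congr_of_eventuallyEq ?_
  have : ∀ᶠ x in nhds c, |x - 2 * Real.pi * m| < 3 * Real.pi / 2 :=
    (by fun_prop : Continuous fun x : ℝ => |x - 2 * Real.pi * m|).continuousAt.eventually_lt
      continuousAt_const h1
  exact this.mono fun x hx => wrap_eq hf hx

lemma wrap_eq_self {f : ℝ → ℂ} (hf : ∀ x, 1 / 16 < |x| → f x = 0) {c : ℝ}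
    (h : c ∈ Set.Icc (-Real.pi) Real.pi) : wrap f c = f c := by
  have := wrap_eq hf (c := c) (m := 0) (by
    have := abs_le.2 h
    simp only [Int.cast_zero, mul_zero, sub_zero]
    linarith [Real.pi_pos])
  simpa using this

/-- Integrating a wrapped function against a periodic one. -/
lemma integral_wrap_mul {f g : ℝ → ℂ} (hf : ∀ x, 1 / 16 < |x| → f x = 0)
    (hg : Function.Periodic g (2 * Real.pi)) :
    ∫ c in (0 : ℝ)..(2 * Real.pi), wrap f c * g c = ∫ c, f c * g c := by
  have hpi := Real.pi_gt_three
  have hper : Function.Periodic (fun c => wrap f c * g c) (2 * Real.pi) :=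
    (periodic_wrap f).mul hg
  have := hper.intervalIntegral_add_eq 0 (-Real.pi)
  rw [zero_add, show -Real.pi + 2 * Real.pi = Real.pi by ring] at this
  rw [this, intervalIntegral.integral_congr (g := fun c => f c * g c)]
  · refine intervalIntegral.integral_eq_integral_of_support_subset fun x hx => ?_
    have : |x| ≤ 1 / 16 := by
      by_contra h
      exact hx (by simp [hf x (not_le.1 h)])
    obtain ⟨h1, h2⟩ := abs_le.1 this
    exact ⟨by linarith, by linarith⟩
  · intro c hc
    rw [Set.uIcc_of_le (by linarith)] at hc
    simp only [wrap_eq_self hf hc]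

/-- The Fourier coefficients of a modulated, dilated bump. -/
lemma fourierCoeff'_wrap {ψ : ℝ → ℝ} (hψ : ∀ x, 1 / 16 < |x| → ψ x = 0) {T : ℝ} (hT : 1 ≤ T)
    (N k : ℤ) :
    fourierCoeff' (wrap fun c => Complex.exp (Complex.I * N * c) * ((T * ψ (T * c) : ℝ) : ℂ)) k
      = (1 / (2 * Real.pi)) *
        ∫ x, (ψ x : ℂ) * Complex.exp (-Complex.I * ((k - N) / T * x : ℝ)) := by
  unfold fourierCoeff'
  congr 1
  rw [integral_wrap_mul]
  · have h := Measure.integral_comp_mul_left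
      (fun x => (ψ x : ℂ) * Complex.exp (-Complex.I * (((k : ℝ) - N) / T * x : ℝ))) T
    rw [abs_of_pos (by positivity), eq_comm, inv_smul_eq_iff₀ (by positivity)] at h
    rw [h, Complex.real_smul, ← integral_const_mul]
    congr 1
    ext c
    have : (T : ℂ) ≠ 0 := by exact_mod_cast (by positivity : T ≠ 0)
    have e : -Complex.I * (((k : ℝ) - N) / T * (T * c) : ℝ)
        = Complex.I * N * c + -Complex.I * k * c := by
      push_cast
      field_simp
      ring
    rw [e, Complex.exp_add]
    push_cast
    ring
  · intro x hx
    rw [hψ (T * x) (by rw [abs_mul, abs_of_pos (by positivity)]; nlinarith [abs_nonneg x])]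
    simp
  · intro c
    simp only
    rw [show -Complex.I * k * ((c + 2 * Real.pi : ℝ) : ℂ)
      = -Complex.I * k * c + ((-k : ℤ) : ℂ) * (2 * Real.pi * Complex.I) by push_cast; ring,
      Complex.exp_add, Complex.exp_int_mul_two_pi_mul_I, mul_one]

/-- One of the oscillating pieces into which the transform of a modulated bump decomposes. -/
noncomputable def oscPiece (τ lam : ℂ) (ψ : ℝ → ℝ) (T : ℝ) (g : ℝ → ℝ) (M Λ c : ℝ) : ℂ :=
  phase M Λ c * (((√(Real.sin (2 * c)) : ℝ) : ℂ) * ((ψ (T * c) : ℂ) * ampl τ 1 lam (g c))) /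
    (Real.sin (2 * c) : ℝ)

lemma half_le_sin {c : ℝ} (hc : c ∈ Set.Ioo (0 : ℝ) (1 / 8)) : c / 2 ≤ Real.sin c := by
  have := Real.mul_le_sin hc.1.le (by linarith [Real.pi_gt_three, hc.2])
  have h2 : 1 / 2 ≤ 2 / Real.pi := by
    rw [div_le_div_iff₀ (by norm_num) Real.pi_pos]; linarith [Real.pi_le_four]
  nlinarith [hc.1]

lemma half_le_cos {c : ℝ} (hc : c ∈ Set.Ioo (0 : ℝ) (1 / 8)) : c / 2 ≤ Real.cos c := by
  have := Real.one_sub_sq_div_two_le_cos (x := c)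
  nlinarith [hc.1, hc.2]

lemma cos_lt_one_of_mem {c : ℝ} (hc : c ∈ Set.Ioo (0 : ℝ) (1 / 8)) : Real.cos c < 1 := by
  have := Real.cos_lt_cos_of_nonneg_of_le_pi_div_two le_rfl
    (by linarith [Real.pi_gt_three, hc.2]) hc.1
  simpa using this

lemma sin_lt_one_of_mem {c : ℝ} (hc : c ∈ Set.Ioo (0 : ℝ) (1 / 8)) : Real.sin c < 1 := by
  linarith [Real.sin_lt hc.1, hc.2]

lemma integral_rpow_neg_three_quarters_le {r : ℝ} (h0 : 0 ≤ r) (hr : r ≤ 1) :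
    IntegrableOn (fun c : ℝ => c ^ (-(3 / 4) : ℝ)) (Set.Ioo 0 r) ∧
      ∫ c in Set.Ioo 0 r, c ^ (-(3 / 4) : ℝ) ≤ 4 := by
  constructor
  · rw [← intervalIntegrable_iff_integrableOn_Ioo_of_le h0]
    exact intervalIntegral.intervalIntegrable_rpow' (by norm_num)
  · rw [← integral_Ioc_eq_integral_Ioo, ← intervalIntegral.integral_of_le h0,
      integral_rpow (Or.inl (by norm_num)), Real.zero_rpow (by norm_num)]
    have := Real.rpow_le_one h0 hr (by norm_num : (0 : ℝ) ≤ -(3 / 4) + 1)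
    rw [div_le_iff₀ (by norm_num)]
    linarith

/-- The bound on the pieces that is uniform in all parameters. -/
lemma exists_norm_integral_oscPiece_le {τ : ℂ} (hτ : τ.re = 0) {ψ : ℝ → ℝ} (hψ : Continuous ψ)
    {K : ℝ} (hK : ∀ x, |ψ x| ≤ K) :
    ∃ C : ℝ, 0 ≤ C ∧ ∀ lam : ℂ, lam.re = 0 → ∀ r, 0 < r → r ≤ 1 / 8 → ∀ T : ℝ, ∀ g : ℝ → ℝ,
      Continuous g → (∀ c ∈ Set.Ioo (0 : ℝ) (1 / 8), c / 2 ≤ g c) →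
      (∀ c ∈ Set.Ioo (0 : ℝ) (1 / 8), g c < 1) → ∀ M Λ : ℝ,
      IntegrableOn (oscPiece τ lam ψ T g M Λ) (Set.Ioo 0 r) ∧
        ‖∫ c in Set.Ioo 0 r, oscPiece τ lam ψ T g M Λ c‖ ≤ C := by
  obtain ⟨C, hC, h⟩ := exists_norm_ampl_le_rpow hτ 1
  have hK0 : 0 ≤ K := (abs_nonneg _).trans (hK 0)
  refine ⟨K * (2 * C) * 4, by positivity, fun lam hl r h0 hr T g hg hg0 hg1 M Λ => ?_⟩
  have mem : ∀ {c}, c ∈ Set.Ioo 0 r → c ∈ Set.Ioo (0 : ℝ) (1 / 8) := fun hc =>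
    ⟨hc.1, hc.2.trans_le hr⟩
  have bd : ∀ c ∈ Set.Ioo 0 r,
      ‖oscPiece τ lam ψ T g M Λ c‖ ≤ K * (2 * C) * c ^ (-(3 / 4) : ℝ) := by
    intro c hc
    have hs := sin_two_mul_pos hr hc
    have hq := Real.sqrt_pos.2 hs
    have e : ‖oscPiece τ lam ψ T g M Λ c‖
        = (√(Real.sin (2 * c)))⁻¹ * (|ψ (T * c)| * ‖ampl τ 1 lam (g c)‖) := by
      unfold oscPiece
      rw [norm_div, norm_mul, norm_phase, one_mul, norm_mul, norm_mul, Complex.norm_real,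
        Complex.norm_real, Complex.norm_real, Real.norm_eq_abs, Real.norm_eq_abs, Real.norm_eq_abs,
        abs_of_pos hs, abs_of_pos hq]
      have := Real.sq_sqrt hs.le
      field_simp
      rw [this]
      ring
    have h1 := inv_sqrt_sin_le hr hc
    have hc2 : 0 < c / 2 := by linarith [hc.1]
    have h2 : ‖ampl τ 1 lam (g c)‖ ≤ 2 * C * c ^ (-(1 / 4) : ℝ) := by
      refine (h lam hl _ (hc2.trans_le (hg0 c (mem hc))) (hg1 c (mem hc)).le).trans ?_
      have h3 : g c ^ (-(1 / 4) : ℝ) ≤ (c / 2) ^ (-(1 / 4) : ℝ) :=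
        Real.rpow_le_rpow_of_nonpos hc2 (hg0 c (mem hc)) (by norm_num)
      have h4 : (c / 2) ^ (-(1 / 4) : ℝ) ≤ 2 * c ^ (-(1 / 4) : ℝ) := by
        rw [div_eq_inv_mul, Real.mul_rpow (by norm_num) hc.1.le]
        refine mul_le_mul_of_nonneg_right ?_ (Real.rpow_nonneg hc.1.le _)
        rw [Real.inv_rpow (by norm_num), Real.rpow_neg (by norm_num), inv_inv]
        exact (Real.rpow_le_rpow_of_exponent_le (by norm_num) (by norm_num)).trans_eq
          (Real.rpow_one 2)
      nlinarith
    rw [e]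
    calc _ ≤ c ^ (-(1 / 2) : ℝ) * (K * (2 * C * c ^ (-(1 / 4) : ℝ))) := by
          gcongr
          · exact Real.rpow_nonneg hc.1.le _
          · exact hK _
      _ = K * (2 * C) * (c ^ (-(1 / 2) : ℝ) * c ^ (-(1 / 4) : ℝ)) := by ring
      _ = _ := by rw [← Real.rpow_add hc.1]; norm_num
  obtain ⟨i1, i2⟩ := integral_rpow_neg_three_quarters_le h0.le (hr.trans (by norm_num))
  have i3 := i1.const_mul (K * (2 * C))
  have cont : ContinuousOn (oscPiece τ lam ψ T g M Λ) (Set.Ioo 0 r) := by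
    have hp := (isLogDeriv_phase hr M Λ).continuousOn
    have ha : ContinuousOn (fun c => ampl τ 1 lam (g c)) (Set.Ioo 0 r) :=
      (continuousOn_ampl hτ 1 hl).comp hg.continuousOn fun c hc =>
        ⟨(by linarith [hc.1] : 0 < c / 2).trans_le (hg0 c (mem hc)), hg1 c (mem hc)⟩
    unfold oscPiece
    refine (hp.mul ((by fun_prop : Continuous fun c : ℝ =>
      ((√(Real.sin (2 * c)) : ℝ) : ℂ)).continuousOn.mul
      ((by fun_prop : Continuous fun c : ℝ => (ψ (T * c) : ℂ)).continuousOn.mul ha))).div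
      (by fun_prop : Continuous fun c : ℝ => ((Real.sin (2 * c) : ℝ) : ℂ)).continuousOn ?_
    intro c hc
    exact Complex.ofReal_ne_zero.2 (sin_two_mul_pos hr hc).ne'
  have ae : ∀ᵐ c ∂(volume.restrict (Set.Ioo 0 r)),
      ‖oscPiece τ lam ψ T g M Λ c‖ ≤ K * (2 * C) * c ^ (-(3 / 4) : ℝ) :=
    ae_restrict_of_forall_mem measurableSet_Ioo bd
  refine ⟨i3.mono' (cont.aestronglyMeasurable measurableSet_Ioo) ae, ?_⟩
  refine (norm_integral_le_of_norm_le i3 ae).trans ?_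
  rw [integral_const_mul]
  gcongr

/-- The kernel against a modulated bump, in terms of oscillating pieces. -/
lemma exp_mul_bump_mul_kKer {τ lam : ℂ} (hτ : τ.re = 0) (hl : lam.re = 0) (ψ : ℝ → ℝ)
    (T M : ℝ) {c : ℝ} (hc : c ∈ Set.Ioo (0 : ℝ) (1 / 8)) :
    Complex.exp (Complex.I * M * c) * ψ (T * c) * kKer τ lam c
      = (1 / Real.pi * Complex.exp (-(lam / 2) * (Real.log 2 : ℂ))) *
        (oscPiece τ lam ψ T Real.cos M lam.im c + oscPiece τ lam ψ T Real.sin M (-lam.im) c) := by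
  have hs := sin_two_mul_pos le_rfl hc
  have hq := Real.sqrt_pos.2 hs
  rw [kKer_eq hτ hl hc.1 (by linarith [hc.2, Real.pi_gt_three])]
  have hlam : lam = Complex.I * lam.im := by
    conv_lhs => rw [← Complex.re_add_im lam, hl]
    simp [mul_comm]
  have ph : ∀ L : ℝ, Complex.exp (Complex.I * M * c) *
      Complex.exp (Complex.I * L / 2 * (Real.log (Real.tan c) : ℂ)) = phase M L c := fun L => by
    unfold phase
    rw [← Complex.exp_add]
    push_cast
    ring_nf
  have p1 := ph lam.im
  have p2 := ph (-lam.im)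
  rw [← hlam] at p1
  rw [show Complex.I * ((-lam.im : ℝ) : ℂ) = -lam by rw [hlam]; simp] at p2
  unfold oscPiece
  rw [← p1, ← p2]
  have e : (((√(Real.sin (2 * c)))⁻¹ : ℝ) : ℂ)
      = ((√(Real.sin (2 * c)) : ℝ) : ℂ) / (Real.sin (2 * c) : ℝ) := by
    rw [← Complex.ofReal_div]
    congr 1
    have := Real.sq_sqrt hs.le
    field_simp
    rw [this]
  rw [e]
  ring

lemma integral_eq_add_integral_neg {F : ℝ → ℂ} {r : ℝ} (hF : ∀ x, r ≤ |x| → F x = 0)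
    (h1 : IntegrableOn F (Set.Ioo 0 r)) (h2 : IntegrableOn (fun x => F (-x)) (Set.Ioo 0 r)) :
    ∫ x, F x = (∫ x in Set.Ioo 0 r, F x) + ∫ x in Set.Ioo 0 r, F (-x) := by
  have sub : Set.Ioo 0 r ⊆ Set.Ioi 0 := fun x hx => hx.1
  have v1 : ∀ x ∈ Set.Ioi 0 \ Set.Ioo 0 r, F x = 0 := fun x hx => by
    refine hF x (le_trans ?_ (le_abs_self x))
    by_contra h
    exact hx.2 ⟨hx.1, not_le.1 h⟩
  have v2 : ∀ x ∈ Set.Ioi 0 \ Set.Ioo 0 r, F (-x) = 0 := fun x hx => by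
    refine hF _ (le_trans ?_ ((abs_neg x).symm ▸ le_abs_self x))
    by_contra h
    exact hx.2 ⟨hx.1, not_le.1 h⟩
  have i1 := h1.of_forall_sdiff_eq_zero measurableSet_Ioi v1
  have i2 := h2.of_forall_sdiff_eq_zero measurableSet_Ioi v2
  have i3 : IntegrableOn F (Set.Iic 0) := by
    rw [← Measure.map_neg_eq_self (volume : Measure ℝ)]
    have m : MeasurableEmbedding fun x : ℝ => -x := (Homeomorph.neg ℝ).measurableEmbedding
    rw [m.integrableOn_map_iff]
    simp_rw [Function.comp_def, Set.neg_preimage, Set.neg_Iic, neg_zero]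
    exact Iff.mpr integrableOn_Ici_iff_integrableOn_Ioi i2
  have e3 := integral_comp_neg_Iic 0 fun x => F (-x)
  simp only [neg_neg, neg_zero] at e3
  rw [← intervalIntegral.integral_Iic_add_Ioi i3 i1, e3, add_comm,
    setIntegral_eq_of_subset_of_forall_sdiff_eq_zero measurableSet_Ioi sub v1,
    setIntegral_eq_of_subset_of_forall_sdiff_eq_zero measurableSet_Ioi sub v2]

lemma norm_kKer_factor_le {lam : ℂ} (hl : lam.re = 0) :
    ‖(1 / Real.pi * Complex.exp (-(lam / 2) * (Real.log 2 : ℂ)) : ℂ)‖ ≤ 1 := by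
  have : (-(lam / 2) * (Real.log 2 : ℂ)).re = 0 := by
    rw [Complex.re_mul_ofReal]
    simp [hl]
  rw [norm_mul, Complex.norm_exp, this, Real.exp_zero, mul_one, norm_div, norm_one,
    Complex.norm_real, Real.norm_eq_abs, abs_of_pos Real.pi_pos, div_le_one Real.pi_pos]
  linarith [Real.pi_gt_three]

/-- The transform of a modulated bump is controlled by its oscillating pieces. -/
lemma norm_sharpTransform_wrap_le {τ lam : ℂ} (hτ : τ.re = 0) (hl : lam.re = 0) {ψ : ℝ → ℝ}
    (even : ∀ x, ψ (-x) = ψ x) (vanish : ∀ x, 1 / 16 < |x| → ψ x = 0) {T : ℝ} (hT : 1 ≤ T)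
    (N : ℤ) {X : ℝ}
    (hX : ∀ g : ℝ → ℝ, g = Real.cos ∨ g = Real.sin → ∀ M Λ : ℝ, |M| = |(N : ℝ)| → |Λ| = ‖lam‖ →
      IntegrableOn (oscPiece τ lam ψ T g M Λ) (Set.Ioo 0 (1 / (8 * T))) ∧
        ‖∫ c in Set.Ioo 0 (1 / (8 * T)), oscPiece τ lam ψ T g M Λ c‖ ≤ X) :
    ‖sharpTransform τ
      (wrap fun c => Complex.exp (Complex.I * N * c) * ((T * ψ (T * c) : ℝ) : ℂ)) lam‖
      ≤ T * X := by
  have hT0 : 0 < T := by linarith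
  have hr : 1 / (8 * T) ≤ 1 / 8 := one_div_le_one_div_of_le (by norm_num) (by linarith)
  have him : |lam.im| = ‖lam‖ := by
    rw [Complex.norm_eq_sqrt_sq_add_sq, hl, zero_pow two_ne_zero, zero_add, Real.sqrt_sq_eq_abs]
  have him' : |-lam.im| = ‖lam‖ := by rw [abs_neg, him]
  have hN' : |-(N : ℝ)| = |(N : ℝ)| := abs_neg _
  obtain ⟨i1, b1⟩ := hX _ (Or.inl rfl) N lam.im rfl him
  obtain ⟨i2, b2⟩ := hX _ (Or.inr rfl) N (-lam.im) rfl him'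
  obtain ⟨i3, b3⟩ := hX _ (Or.inl rfl) (-N) lam.im hN' him
  obtain ⟨i4, b4⟩ := hX _ (Or.inr rfl) (-N) (-lam.im) hN' him'
  set D : ℂ := 1 / Real.pi * Complex.exp (-(lam / 2) * (Real.log 2 : ℂ)) with hD
  have e1 : Set.EqOn (fun c : ℝ => Complex.exp (Complex.I * N * c) * ((T * ψ (T * c) : ℝ) : ℂ)
      * kKer τ lam c) (fun c => T * D * (oscPiece τ lam ψ T Real.cos N lam.im c +
        oscPiece τ lam ψ T Real.sin N (-lam.im) c)) (Set.Ioo 0 (1 / (8 * T))) := fun c hc => by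
    have := exp_mul_bump_mul_kKer hτ hl ψ T N (c := c) ⟨hc.1, hc.2.trans_le hr⟩
    simp only
    rw [mul_assoc (T : ℂ), ← this]
    push_cast
    ring
  have e2 : Set.EqOn (fun c : ℝ => Complex.exp (Complex.I * N * (-c : ℝ))
      * ((T * ψ (T * (-c)) : ℝ) : ℂ) * kKer τ lam (-c))
      (fun c => T * D * (oscPiece τ lam ψ T Real.cos (-N) lam.im c +
        oscPiece τ lam ψ T Real.sin (-N) (-lam.im) c)) (Set.Ioo 0 (1 / (8 * T))) := fun c hc => by
    have := exp_mul_bump_mul_kKer hτ hl ψ T (-N) (c := c) ⟨hc.1, hc.2.trans_le hr⟩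
    simp only
    rw [mul_assoc (T : ℂ), ← this, kKer_neg, mul_neg T, even]
    push_cast
    ring_nf
  have vf : ∀ x : ℝ, 1 / 16 < |T * x| →
      Complex.exp (Complex.I * N * x) * ((T * ψ (T * x) : ℝ) : ℂ) = 0 := fun x hx => by
    simp [vanish _ hx]
  have absT : ∀ x : ℝ, |T * x| = T * |x| := fun x => by rw [abs_mul, abs_of_pos hT0]
  unfold sharpTransform
  rw [integral_wrap_mul (fun x hx => vf x (by rw [absT]; nlinarith [abs_nonneg x]))
    (kKer_periodic τ lam), integral_eq_add_integral_neg (r := 1 / (8 * T))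
      (F := fun c : ℝ => Complex.exp (Complex.I * N * c) * ((T * ψ (T * c) : ℝ) : ℂ)
      * kKer τ lam c) ?_
      (IntegrableOn.congr_fun ((i1.add i2).const_mul (T * D)) e1.symm measurableSet_Ioo)
      (IntegrableOn.congr_fun ((i3.add i4).const_mul (T * D)) e2.symm measurableSet_Ioo),
    setIntegral_congr_fun measurableSet_Ioo e1, setIntegral_congr_fun measurableSet_Ioo e2,
    integral_const_mul, integral_const_mul, integral_add i1 i2, integral_add i3 i4, ← mul_add]
  · have hDn : ‖D‖ ≤ 1 := norm_kKer_factor_le hl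
    have hpi : ‖(1 / (2 * (Real.pi : ℂ)) ^ 2 : ℂ)‖ ≤ 1 / 4 := by
      rw [norm_div, norm_one, norm_pow, norm_mul, Complex.norm_real, Real.norm_eq_abs,
        abs_of_pos Real.pi_pos, Complex.norm_two]
      exact one_div_le_one_div_of_le (by norm_num) (by nlinarith [Real.pi_gt_three])
    have hXX : 0 ≤ X := (norm_nonneg _).trans b1
    rw [norm_mul, norm_mul, norm_mul, Complex.norm_real, Real.norm_eq_abs, abs_of_pos hT0]
    have h4 := (norm_add_le_of_le (norm_add_le_of_le b1 b2) (norm_add_le_of_le b3 b4))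
    calc _ ≤ 1 / 4 * (T * 1 * (X + X + (X + X))) := by gcongr
      _ = T * X := by ring
  · intro x hx
    have : 1 / 16 < |T * x| := by
      rw [absT]
      calc (1 / 16 : ℝ) < T * (1 / (8 * T)) := by field_simp; norm_num
        _ ≤ _ := by gcongr
    simp only [vf x this, zero_mul]

/-- The decay of the pieces for spectral parameters away from the origin. -/
lemma exists_norm_integral_oscPiece_le_decay {τ : ℂ} (hτ : τ.re = 0) {ψ : ℝ → ℝ}
    (hψ : ContDiff ℝ (⊤ : ℕ∞) ψ) (vanish : ∀ x, 1 / 16 < |x| → ψ x = 0) :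
    ∃ C : ℝ, 0 ≤ C ∧ ∀ lam : ℂ, lam.re = 0 → 1 ≤ ‖lam‖ → ∀ T : ℝ, 1 ≤ T → ∀ g : ℝ → ℝ,
      g = Real.cos ∨ g = Real.sin → ∀ M Λ : ℝ, |Λ| = ‖lam‖ →
      (M ≠ 0 → ‖∫ c in Set.Ioo 0 (1 / (8 * T)), oscPiece τ lam ψ T g M Λ c‖
        ≤ C * ((√‖lam‖)⁻¹ * (√|M|)⁻¹)) ∧
      (|M| / T ≤ ‖lam‖ → ‖∫ c in Set.Ioo 0 (1 / (8 * T)), oscPiece τ lam ψ T g M Λ c‖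
        ≤ C * ((√‖lam‖)⁻¹ * ‖lam‖⁻¹ ^ 2)) := by
  obtain ⟨K, hK, hb⟩ := exists_boundedJet_bump hψ fun x hx => vanish x (hx.trans_le (le_abs_self x))
  obtain ⟨C₁, hC₁, hcos⟩ := exists_boundedJet_ampl_cos hτ
  obtain ⟨C₂, hC₂, hsin⟩ := exists_boundedJet_ampl_sin hτ
  have pi4 := Real.pi_le_four
  refine ⟨144 * (24 * K * (C₁ + C₂)), by positivity,
    fun lam hl h1 T hT g hg M Λ hΛ => ?_⟩
  have hT0 : 0 < T := by linarith
  have h0 : 0 < 1 / (8 * T) := by positivity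
  have hr : 1 / (8 * T) ≤ 1 / 8 := one_div_le_one_div_of_le (by norm_num) (by linarith)
  have hq : 0 ≤ (√‖lam‖)⁻¹ := by positivity
  obtain ⟨D, hD, hD0, g₁, g₂, hj⟩ : ∃ D ≤ C₁ + C₂, 0 ≤ D ∧ ∃ g₁ g₂, BoundedJet (1 / (8 * T))
      (D * (√‖lam‖)⁻¹) (fun c => ampl τ 1 lam (g c)) g₁ g₂ := by
    rcases hg with rfl | rfl
    · exact ⟨C₁, by linarith, hC₁, hcos _ hr lam hl h1⟩
    · exact ⟨C₂, by linarith, hC₂, hsin _ hr lam hl h1⟩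
  obtain ⟨p₁, p₂, hp, z, z₁⟩ := hb T hT
  obtain ⟨B₁, B₂, d1, d2, c2, s0, s1, s2, w1⟩ := (hp.mul hj).sqrt_mul hr
    (fun c hc => by simp only [z c hc, zero_mul])
    (fun c hc => by simp only [z c hc, z₁ c hc, zero_mul, add_zero])
  have w0 : ∀ c, 1 / (8 * T) / 2 < c → ((√(Real.sin (2 * c)) : ℝ) : ℂ) *
      ((ψ (T * c) : ℂ) * ampl τ 1 lam (g c)) = 0 := fun c hc => by
    rw [z c hc, zero_mul, mul_zero]
  have e : 6 * (4 * (K * (D * (√‖lam‖)⁻¹))) ≤ 24 * K * (C₁ + C₂) * (√‖lam‖)⁻¹ := by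
    calc _ = 24 * K * D * (√‖lam‖)⁻¹ := by ring
      _ ≤ _ := by gcongr
  have nn : 0 ≤ 6 * (4 * (K * (D * (√‖lam‖)⁻¹))) := by positivity
  generalize 6 * (4 * (K * (D * (√‖lam‖)⁻¹))) = A at e nn s0 s1 s2
  constructor
  · intro hM
    refine (norm_integral_phase_le_inv_sqrt h0 hr (hΛ ▸ h1) hM d1 d2.continuousOn s0 s1 w0).trans ?_
    have hm : 0 ≤ (√|M|)⁻¹ := by positivity
    calc _ ≤ 36 * 4 * (24 * K * (C₁ + C₂) * (√‖lam‖)⁻¹) * (√|M|)⁻¹ := by gcongr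
      _ = _ := by ring
  · intro hM
    refine (norm_integral_phase_le_inv_sq h0 hr (hΛ ▸ h1) ?_ d1 d2 c2 s0 s1 s2 w0 w1).trans ?_
    · intro c hc
      have hs : Real.sin (2 * c) ≤ 1 / (4 * T) := by
        refine (Real.sin_le (by linarith [hc.1])).trans ?_
        calc 2 * c ≤ 2 * (1 / (8 * T)) := by linarith [hc.2]
          _ = 1 / (4 * T) := by field_simp; norm_num
      calc |M| * Real.sin (2 * c) ≤ |M| * (1 / (4 * T)) := by gcongr
        _ = |M| / T / 4 := by field_simp
        _ ≤ |Λ| / 2 := by rw [hΛ]; linarith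
    · rw [hΛ]
      calc _ ≤ 144 * (24 * K * (C₁ + C₂) * (√‖lam‖)⁻¹) * ‖lam‖⁻¹ ^ 2 := by gcongr; norm_num
        _ = _ := by ring

lemma rpow_neg_le_mul_one_add {x s : ℝ} (hx : 1 ≤ x) (h0 : 0 ≤ s) (h3 : s ≤ 3) :
    x ^ (-s) ≤ 8 * (1 + x) ^ (-s) := by
  have h : ((1 + x) / 2) ^ s ≤ x ^ s := Real.rpow_le_rpow (by linarith) (by linarith) h0
  rw [Real.div_rpow (by linarith) (by norm_num)] at h
  have h2 : (2 : ℝ) ^ s ≤ 8 :=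
    (Real.rpow_le_rpow_of_exponent_le (by norm_num) h3).trans (by norm_num)
  have hp : 0 < (1 + x) ^ s := Real.rpow_pos_of_pos (by linarith) s
  have h2p : 0 < (2 : ℝ) ^ s := Real.rpow_pos_of_pos (by norm_num) s
  rw [Real.rpow_neg (by linarith), Real.rpow_neg (by linarith)]
  calc (x ^ s)⁻¹ ≤ ((1 + x) ^ s / 2 ^ s)⁻¹ := inv_anti₀ (by positivity) h
    _ = 2 ^ s * ((1 + x) ^ s)⁻¹ := by rw [inv_div, div_eq_mul_inv]
    _ ≤ _ := by gcongr

lemma one_le_mul_one_add_rpow_neg {x s : ℝ} (h : 0 ≤ x) (hx : x ≤ 1) (h0 : 0 ≤ s) (h3 : s ≤ 3) :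
    1 ≤ 8 * (1 + x) ^ (-s) := by
  have h2 : (1 + x) ^ s ≤ 8 := by
    refine (Real.rpow_le_rpow (by linarith) (by linarith : 1 + x ≤ 2) h0).trans ?_
    exact (Real.rpow_le_rpow_of_exponent_le (by norm_num) h3).trans (by norm_num)
  have hp : 0 < (1 + x) ^ s := Real.rpow_pos_of_pos (by linarith) s
  rw [Real.rpow_neg (by linarith), ← div_eq_mul_inv, le_div_iff₀ hp]
  linarith

lemma inv_sqrt_eq_rpow {x : ℝ} (hx : 0 ≤ x) : (√x)⁻¹ = x ^ (-(1 / 2) : ℝ) := by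
  rw [Real.rpow_neg hx, Real.sqrt_eq_rpow]

lemma inv_sqrt_mul_inv_sq {x : ℝ} (hx : 0 < x) : (√x)⁻¹ * x⁻¹ ^ 2 = x ^ (-(5 / 2) : ℝ) := by
  rw [inv_sqrt_eq_rpow hx.le, inv_pow, ← Real.rpow_natCast, ← Real.rpow_neg hx.le,
    ← Real.rpow_add hx]
  norm_num

/-- Lemma 4.2 of the paper: existence of good test functions for the spherical
Rankin–Selberg formula. -/
theorem spherical_test_vector_bounds (τ : ℂ) (hτ : τ.re = 0) :
    ∃ α : ℝ, 0 < α ∧ ∀ N : ℤ, ∀ T : ℝ, 1 ≤ T → T ≤ (N : ℝ) →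
      ∃ u : ℝ → ℂ, ContDiff ℝ (⊤ : ℕ∞) u ∧ Function.Periodic u (2 * Real.pi) ∧
        -- (1)
        ‖u 0‖ ≤ α * T ∧
        -- (2) û(k) is real and nonnegative
        (∀ k : ℤ, (fourierCoeff' u k).im = 0 ∧ 0 ≤ (fourierCoeff' u k).re) ∧
        -- (3) û(k) ≥ 1 for |k − N| ≤ T
        (∀ k : ℤ, |(k : ℝ) - (N : ℝ)| ≤ T → 1 ≤ (fourierCoeff' u k).re) ∧
        -- (4) bound in the range |λ| ≤ N/T
        (∀ lam : ℂ, lam.re = 0 → ‖lam‖ ≤ (N : ℝ) / T →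
          ‖sharpTransform τ u lam‖ ≤
            α * T * (N : ℝ) ^ (-(1 : ℝ) / 2) * (1 + ‖lam‖) ^ (-(1 : ℝ) / 2) +
              α * T * (1 + ‖lam‖) ^ (-(5 : ℝ) / 2)) ∧
        -- (5) bound in the range |λ| ≥ N/T
        (∀ lam : ℂ, lam.re = 0 → (N : ℝ) / T ≤ ‖lam‖ →
          ‖sharpTransform τ u lam‖ ≤ α * T * (1 + ‖lam‖) ^ (-(5 : ℝ) / 2)) := by
  obtain ⟨ψ, hψ, even, vanish, hft⟩ := exists_bump
  obtain ⟨K, hK⟩ : ∃ K, ∀ x, |ψ x| ≤ K := by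
    have hcs : HasCompactSupport ψ := HasCompactSupport.of_support_subset_isCompact
      (isCompact_Icc (a := -(1 / 16 : ℝ)) (b := 1 / 16)) fun x hx =>
        abs_le.1 (not_lt.1 fun h => hx (vanish x h))
    exact hψ.continuous.bounded_above_of_compact_support hcs
  obtain ⟨C₁, hC₁, hb₁⟩ := exists_norm_integral_oscPiece_le hτ hψ.continuous hK
  obtain ⟨C₂, hC₂, hb₂⟩ := exists_norm_integral_oscPiece_le_decay hτ hψ vanish
  refine ⟨|ψ 0| + 8 * C₁ + 8 * C₂ + 1, by positivity, fun N T hT hTN => ?_⟩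
  have hT0 : 0 < T := by linarith
  have hN0 : (0 : ℝ) < N := by linarith
  have hr : 1 / (8 * T) ≤ 1 / 8 := one_div_le_one_div_of_le (by norm_num) (by linarith)
  have hNT : 1 ≤ (N : ℝ) / T := (one_le_div hT0).2 hTN
  set α := |ψ 0| + 8 * C₁ + 8 * C₂ + 1 with hα
  have hα0 : |ψ 0| ≤ α := by linarith
  have hα1 : 8 * C₁ ≤ α := by linarith [abs_nonneg (ψ 0)]
  have hα2 : 8 * C₂ ≤ α := by linarith [abs_nonneg (ψ 0)]
  have hαp : 0 ≤ α := (abs_nonneg _).trans hα0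
  let f : ℝ → ℂ := fun c => Complex.exp (Complex.I * N * c) * ((T * ψ (T * c) : ℝ) : ℂ)
  have hf : ∀ x, 1 / 16 < |x| → f x = 0 := fun x hx => by
    simp only [f]
    rw [vanish (T * x) (by rw [abs_mul, abs_of_pos hT0]; nlinarith [abs_nonneg x])]
    simp
  have uniform : ∀ lam : ℂ, lam.re = 0 → ∀ g : ℝ → ℝ, g = Real.cos ∨ g = Real.sin → ∀ M Λ : ℝ,
      IntegrableOn (oscPiece τ lam ψ T g M Λ) (Set.Ioo 0 (1 / (8 * T))) ∧
        ‖∫ c in Set.Ioo 0 (1 / (8 * T)), oscPiece τ lam ψ T g M Λ c‖ ≤ C₁ := by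
    rintro lam hl g (rfl | rfl) M Λ
    · exact hb₁ lam hl _ (by positivity) hr T _ Real.continuous_cos (fun c => half_le_cos)
        (fun c => cos_lt_one_of_mem) M Λ
    · exact hb₁ lam hl _ (by positivity) hr T _ Real.continuous_sin (fun c => half_le_sin)
        (fun c => sin_lt_one_of_mem) M Λ
  have neg_half : -(1 : ℝ) / 2 = -(1 / 2) := by norm_num
  have neg_five : -(5 : ℝ) / 2 = -(5 / 2) := by norm_num
  have small : ∀ lam : ℂ, lam.re = 0 → ‖lam‖ ≤ 1 →
      ‖sharpTransform τ (wrap f) lam‖ ≤ α * T * (1 + ‖lam‖) ^ (-(5 : ℝ) / 2) := by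
    intro lam hl h1
    refine (norm_sharpTransform_wrap_le hτ hl even vanish hT N fun g hg M Λ _ _ =>
      uniform lam hl g hg M Λ).trans ?_
    have := one_le_mul_one_add_rpow_neg (norm_nonneg lam) h1 (s := 5 / 2) (by norm_num)
      (by norm_num)
    rw [neg_five]
    have hp : 0 ≤ (1 + ‖lam‖) ^ (-(5 / 2) : ℝ) := by positivity
    calc T * C₁ ≤ T * C₁ * (8 * (1 + ‖lam‖) ^ (-(5 / 2) : ℝ)) :=
          le_mul_of_one_le_right (by positivity) this
      _ = 8 * C₁ * T * (1 + ‖lam‖) ^ (-(5 / 2) : ℝ) := by ring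
      _ ≤ _ := by gcongr
  refine ⟨wrap f, contDiff_wrap hf ?_, periodic_wrap f, ?_, ?_, ?_, ?_, ?_⟩
  · exact (contDiff_const.mul Complex.ofRealCLM.contDiff).cexp.mul
      (Complex.ofRealCLM.contDiff.comp
        (contDiff_const.mul (hψ.comp (contDiff_const.mul contDiff_id))))
  · rw [wrap_eq_self hf ⟨by linarith [Real.pi_pos], Real.pi_pos.le⟩]
    have e : ‖f 0‖ = T * |ψ 0| := by
      simp [f, abs_of_pos hT0]
    rw [e, mul_comm]
    gcongr
  · intro k
    obtain ⟨a, ha, -, he⟩ := hft ((k - N) / T)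
    rw [fourierCoeff'_wrap vanish hT, he]
    exact ⟨Complex.ofReal_im a, by rwa [Complex.ofReal_re]⟩
  · intro k hk
    obtain ⟨a, -, ha, he⟩ := hft ((k - N) / T)
    rw [fourierCoeff'_wrap vanish hT, he, Complex.ofReal_re]
    refine ha ?_
    rw [abs_div, abs_of_pos hT0]
    exact (div_le_one hT0).2 hk
  · intro lam hl _
    rcases le_or_gt ‖lam‖ 1 with h1 | h1
    · refine (small lam hl h1).trans (le_add_of_nonneg_left (by positivity))
    · have bd : ∀ g : ℝ → ℝ, g = Real.cos ∨ g = Real.sin → ∀ M Λ : ℝ, |M| = |(N : ℝ)| →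
          |Λ| = ‖lam‖ → ‖∫ c in Set.Ioo 0 (1 / (8 * T)), oscPiece τ lam ψ T g M Λ c‖
            ≤ C₂ * ((√‖lam‖)⁻¹ * (√N)⁻¹) := fun g hg M Λ hM hΛ => by
        rw [abs_of_pos hN0] at hM
        have := (hb₂ lam hl h1.le T hT g hg M Λ hΛ).1 (abs_pos.1 (hM ▸ hN0))
        rwa [hM] at this
      refine (norm_sharpTransform_wrap_le hτ hl even vanish hT N fun g hg M Λ hM hΛ =>
        ⟨(uniform lam hl g hg M Λ).1, bd g hg M Λ hM hΛ⟩).trans ?_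
      refine le_add_of_le_of_nonneg ?_ (by positivity)
      rw [inv_sqrt_eq_rpow (norm_nonneg _), inv_sqrt_eq_rpow hN0.le, neg_half]
      have := rpow_neg_le_mul_one_add h1.le (s := 1 / 2) (by norm_num) (by norm_num)
      have hp : 0 ≤ (1 + ‖lam‖) ^ (-(1 / 2) : ℝ) := by positivity
      calc T * (C₂ * (‖lam‖ ^ (-(1 / 2) : ℝ) * (N : ℝ) ^ (-(1 / 2) : ℝ)))
          ≤ T * (C₂ * (8 * (1 + ‖lam‖) ^ (-(1 / 2) : ℝ) * (N : ℝ) ^ (-(1 / 2) : ℝ))) := by gcongr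
        _ = 8 * C₂ * T * (N : ℝ) ^ (-(1 / 2) : ℝ) * (1 + ‖lam‖) ^ (-(1 / 2) : ℝ) := by ring
        _ ≤ _ := by gcongr
  · intro lam hl h
    have h1 : 1 ≤ ‖lam‖ := hNT.trans h
    refine (norm_sharpTransform_wrap_le hτ hl even vanish hT N fun g hg M Λ hM hΛ =>
      ⟨(uniform lam hl g hg M Λ).1, (hb₂ lam hl h1 T hT g hg M Λ hΛ).2 ?_⟩).trans ?_
    · rwa [hM, abs_of_pos hN0]
    · rw [inv_sqrt_mul_inv_sq (by linarith), neg_five]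
      have := rpow_neg_le_mul_one_add h1 (s := 5 / 2) (by norm_num) (by norm_num)
      have hp : 0 ≤ (1 + ‖lam‖) ^ (-(5 / 2) : ℝ) := by positivity
      calc T * (C₂ * ‖lam‖ ^ (-(5 / 2) : ℝ))
          ≤ T * (C₂ * (8 * (1 + ‖lam‖) ^ (-(5 / 2) : ℝ))) := by gcongr
        _ = 8 * C₂ * T * (1 + ‖lam‖) ^ (-(5 / 2) : ℝ) := by ring
        _ ≤ _ := by gcongr
end

section
/- (Model oscillatory integral bound from Appendix A.3, stationary-point range.) There exists a constant C > 0, depending only on χ, such that for all real numbers N ≥ T ≥ 1 and all purely imaginary λ with |λ| ≤ N/T: |I(λ, N, T)| ≤ C·T·N^{−1/2}. -/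
open MeasureTheory

/-- The model oscillatory integral
`I(λ,N,T) = T·∫ e^{−iNc}·|sin 2c|^{−1/2}·|sin c|^{λ/2}·|cos c|^{−λ/2}·χ(Tc) dc`. -/
noncomputable def modelInt (χ : ℝ → ℂ) (lam : ℂ) (N T : ℝ) : ℂ :=
  (T : ℂ) * ∫ c : ℝ,
    Complex.exp (-Complex.I * (N : ℂ) * (c : ℂ)) *
      rpowC |Real.sin (2 * c)| (-(1 / 2)) *
      rpowC |Real.sin c| (lam / 2) *
      rpowC |Real.cos c| (-(lam / 2)) * χ (T * c)

/-- Second-derivative test with phase `θ`, `θ' = p v`, against the density `v`. -/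
theorem norm_integral_oscillatory_le {a b N M L : ℝ} (hab : a ≤ b) (hN : 0 < N)
    {p p' q q' v θ : ℝ → ℝ} {g g' : ℝ → ℂ} {k : ℂ} (hk : k.re = 0) (hk1 : ‖k‖ = 1)
    (hp : ∀ x ∈ Set.Icc a b, HasDerivAt p (p' x) x)
    (hq : ∀ x ∈ Set.Icc a b, HasDerivAt q (q' x) x)
    (hθ : ∀ x ∈ Set.Icc a b, HasDerivAt θ (p x * v x) x)
    (hg : ∀ x ∈ Set.Icc a b, HasDerivAt g (g' x) x)
    (hp'c : ContinuousOn p' (Set.Icc a b)) (hq'c : ContinuousOn q' (Set.Icc a b))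
    (hvc : ContinuousOn v (Set.Icc a b)) (hg'c : ContinuousOn g' (Set.Icc a b))
    (hv : ∀ x ∈ Set.Icc a b, 0 ≤ v x)
    (hpq' : ∀ x ∈ Set.Icc a b, |p' x| ≤ q' x)
    (hvq' : ∀ x ∈ Set.Icc a b, N * v x ≤ 2 * q' x)
    (hqp : ∀ x ∈ Set.Icc a b, q x ^ 2 ≤ p x ^ 2)
    (hgM : ∀ x ∈ Set.Icc a b, ‖g x‖ ≤ M)
    (hgL : ∫ x in a..b, ‖g' x‖ ≤ L) :
    ‖∫ x in a..b, (v x : ℂ) * Complex.exp (k * θ x) * g x‖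
      ≤ (M * (1 + 3 * Real.pi) + L) / √N := by
  have hM : 0 ≤ M := (norm_nonneg _).trans (hgM a ⟨le_rfl, hab⟩)
  have hs : 0 < √N := Real.sqrt_pos.2 hN
  have hsN : √N ^ 2 = N := Real.sq_sqrt hN.le
  have hpc : ContinuousOn p (Set.Icc a b) := fun x hx => (hp x hx).continuousAt.continuousWithinAt
  have hqc : ContinuousOn q (Set.Icc a b) := fun x hx => (hq x hx).continuousAt.continuousWithinAt
  have hgc : ContinuousOn g (Set.Icc a b) := fun x hx => (hg x hx).continuousAt.continuousWithinAt
  have hden : ∀ x, 0 < p x ^ 2 + N := fun x => by positivity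
  have hdenq : ∀ x, 0 < q x ^ 2 + N := fun x => by positivity
  have hE : ∀ x, ‖Complex.exp (k * θ x)‖ = 1 := fun x => by
    rw [Complex.norm_exp]; simp [hk]
  set h : ℝ → ℝ := fun x => p x / (p x ^ 2 + N) with hh
  set h' : ℝ → ℝ := fun x => p' x * (N - p x ^ 2) / (p x ^ 2 + N) ^ 2 with hh'
  have hhd : ∀ x ∈ Set.Icc a b, HasDerivAt h (h' x) x := fun x hx => by
    refine ((hp x hx).div (((hp x hx).pow 2).add_const N) (hden x).ne').congr_deriv ?_
    simp only [hh', Pi.pow_apply]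
    congr 1
    push_cast
    ring
  have hhb : ∀ x, |h x| ≤ 1 / (2 * √N) := fun x => by
    rw [hh, abs_div, abs_of_pos (hden x), div_le_div_iff₀ (hden x) (by positivity)]
    nlinarith [sq_nonneg (|p x| - √N), sq_abs (p x)]
  set E : ℝ → ℂ := fun x => Complex.exp (k * θ x)
  have hEd : ∀ x ∈ Set.Icc a b, HasDerivAt E (E x * (k * ((p x * v x : ℝ) : ℂ))) x :=
    fun x hx => ((hθ x hx).ofReal_comp.const_mul k).cexp
  have hEc : ContinuousOn E (Set.Icc a b) := fun x hx => (hEd x hx).continuousAt.continuousWithinAt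
  set R : ℝ → ℂ := fun x => (h' x : ℂ) * (E x * g x) + (h x : ℂ) * (E x * g' x)
      - k * ((v x * (N / (p x ^ 2 + N)) : ℝ) : ℂ) * (E x * g x) with hR
  have hFd : ∀ x ∈ Set.uIcc a b, HasDerivAt (fun x => (h x : ℂ) * (E x * g x))
      (k * ((v x : ℂ) * E x * g x) + R x) x := fun x hx => by
    rw [Set.uIcc_of_le hab] at hx
    refine ((hhd x hx).ofReal_comp.mul ((hEd x hx).mul (hg x hx))).congr_deriv ?_
    have e : v x * (N / (p x ^ 2 + N)) = v x - p x * v x * h x := by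
      have := (hden x).ne'
      simp only [hh]; field_simp; ring
    simp only [hR, Pi.mul_apply, e]
    push_cast
    ring
  have hhc : ContinuousOn h (Set.Icc a b) :=
    fun x hx => (hhd x hx).continuousAt.continuousWithinAt
  have hh'c : ContinuousOn h' (Set.Icc a b) :=
    (hp'c.mul (continuousOn_const.sub (hpc.pow 2))).div (((hpc.pow 2).add continuousOn_const).pow 2)
      fun x _ => (pow_pos (hden x) 2).ne'
  have hRc : ContinuousOn R (Set.Icc a b) := by
    have c1 : ContinuousOn (fun x => v x * (N / (p x ^ 2 + N))) (Set.Icc a b) :=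
      hvc.mul (continuousOn_const.div ((hpc.pow 2).add continuousOn_const) fun x _ => (hden x).ne')
    exact (((Complex.continuous_ofReal.comp_continuousOn hh'c).mul (hEc.mul hgc)).add
      ((Complex.continuous_ofReal.comp_continuousOn hhc).mul (hEc.mul hg'c))).sub
      ((continuousOn_const.mul (Complex.continuous_ofReal.comp_continuousOn c1)).mul (hEc.mul hgc))
  have hGc : ContinuousOn (fun x => k * ((v x : ℂ) * E x * g x)) (Set.Icc a b) :=
    continuousOn_const.mul (((Complex.continuous_ofReal.comp_continuousOn hvc).mul hEc).mul hgc)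
  have iR := hRc.intervalIntegrable_of_Icc (μ := volume) hab
  have iG := hGc.intervalIntegrable_of_Icc (μ := volume) hab
  have key := intervalIntegral.integral_eq_sub_of_hasDerivAt hFd (iG.add iR)
  rw [intervalIntegral.integral_add iG iR, intervalIntegral.integral_const_mul] at key
  have hAd : ∀ x ∈ Set.uIcc a b, HasDerivAt (fun x => Real.arctan (q x / √N) / √N)
      (q' x / (q x ^ 2 + N)) x := fun x hx => by
    rw [Set.uIcc_of_le hab] at hx
    refine ((((hq x hx).div_const √N).arctan).div_const √N).congr_deriv ?_
    have := (hdenq x).ne'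
    rw [div_pow, hsN]
    have e : 1 + q x ^ 2 / N = (q x ^ 2 + N) / N := by field_simp; ring
    rw [e]
    field_simp
    rw [hsN, mul_comm]
  have hAc : ContinuousOn (fun x => q' x / (q x ^ 2 + N)) (Set.Icc a b) :=
    hq'c.div ((hqc.pow 2).add continuousOn_const) fun x _ => (hdenq x).ne'
  have iA := hAc.intervalIntegrable_of_Icc (μ := volume) hab
  have hA := intervalIntegral.integral_eq_sub_of_hasDerivAt hAd iA
  have hAle : ∫ x in a..b, q' x / (q x ^ 2 + N) ≤ Real.pi / √N := by
    rw [hA, ← sub_div]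
    gcongr
    linarith [Real.arctan_lt_pi_div_two (q b / √N), Real.neg_pi_div_two_lt_arctan (q a / √N)]
  have iL := (hg'c.norm).intervalIntegrable_of_Icc (μ := volume) hab
  have hRb : ∀ x ∈ Set.Icc a b, ‖R x‖
      ≤ 3 * M * (q' x / (q x ^ 2 + N)) + 1 / (2 * √N) * ‖g' x‖ := fun x hx => by
    have hEx : ‖E x‖ = 1 := hE x
    have hq0 : 0 ≤ q' x := (abs_nonneg _).trans (hpq' x hx)
    have hqi : 1 / (p x ^ 2 + N) ≤ 1 / (q x ^ 2 + N) :=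
      one_div_le_one_div_of_le (hdenq x) (add_le_add_left (hqp x hx) N)
    have b1 : |h' x| ≤ q' x / (q x ^ 2 + N) := by
      have : |h' x| ≤ q' x * (1 / (p x ^ 2 + N)) := by
        simp only [hh']
        rw [abs_div, abs_mul, abs_of_pos (pow_pos (hden x) 2), mul_one_div,
          div_le_div_iff₀ (pow_pos (hden x) 2) (hden x)]
        have : |N - p x ^ 2| ≤ p x ^ 2 + N := by
          rw [abs_le]; constructor <;> nlinarith [sq_nonneg (p x)]
        calc |p' x| * |N - p x ^ 2| * (p x ^ 2 + N)
            ≤ q' x * (p x ^ 2 + N) * (p x ^ 2 + N) := by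
              have := (hden x).le
              gcongr
              exact hpq' x hx
          _ = _ := by ring
      calc |h' x| ≤ q' x * (1 / (p x ^ 2 + N)) := this
        _ ≤ q' x * (1 / (q x ^ 2 + N)) := by gcongr
        _ = _ := by ring
    have b2 : |v x * (N / (p x ^ 2 + N))| ≤ 2 * (q' x / (q x ^ 2 + N)) := by
      have := hv x hx
      have := hden x
      rw [abs_of_nonneg (by positivity)]
      calc v x * (N / (p x ^ 2 + N)) = N * v x * (1 / (p x ^ 2 + N)) := by ring
        _ ≤ 2 * q' x * (1 / (q x ^ 2 + N)) :=
          mul_le_mul (hvq' x hx) hqi (by positivity) (by positivity)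
        _ = _ := by ring
    have n1 : ‖(h' x : ℂ) * (E x * g x)‖ ≤ q' x / (q x ^ 2 + N) * M := by
      rw [norm_mul, norm_mul, hEx, one_mul, Complex.norm_real, Real.norm_eq_abs]
      have := hdenq x
      gcongr
      exact hgM x hx
    have n2 : ‖(h x : ℂ) * (E x * g' x)‖ ≤ 1 / (2 * √N) * ‖g' x‖ := by
      rw [norm_mul, norm_mul, hEx, one_mul, Complex.norm_real, Real.norm_eq_abs]
      gcongr
      exact hhb x
    have n3 : ‖k * ((v x * (N / (p x ^ 2 + N)) : ℝ) : ℂ) * (E x * g x)‖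
        ≤ 2 * (q' x / (q x ^ 2 + N)) * M := by
      rw [norm_mul, norm_mul, norm_mul, hEx, hk1, one_mul, one_mul, Complex.norm_real,
        Real.norm_eq_abs]
      have := hdenq x
      gcongr
      exact hgM x hx
    calc ‖R x‖ ≤ _ := norm_sub_le _ _
      _ ≤ _ := add_le_add_left (norm_add_le _ _) _
      _ ≤ q' x / (q x ^ 2 + N) * M + 1 / (2 * √N) * ‖g' x‖
          + 2 * (q' x / (q x ^ 2 + N)) * M := by gcongr
      _ = _ := by ring
  have hRint : ‖∫ x in a..b, R x‖ ≤ 3 * M * (Real.pi / √N) + 1 / (2 * √N) * L := by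
    calc ‖∫ x in a..b, R x‖
        ≤ ∫ x in a..b, (3 * M * (q' x / (q x ^ 2 + N)) + 1 / (2 * √N) * ‖g' x‖) :=
          intervalIntegral.norm_integral_le_of_norm_le hab
            (Filter.Eventually.of_forall fun x hx => hRb x ⟨hx.1.le, hx.2⟩)
            ((iA.const_mul _).add (iL.const_mul _))
      _ = 3 * M * (∫ x in a..b, q' x / (q x ^ 2 + N))
          + 1 / (2 * √N) * ∫ x in a..b, ‖g' x‖ := by
          rw [intervalIntegral.integral_add (iA.const_mul _) (iL.const_mul _),
            intervalIntegral.integral_const_mul, intervalIntegral.integral_const_mul]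
      _ ≤ _ := by gcongr
  have hFb : ∀ x ∈ Set.Icc a b, ‖(h x : ℂ) * (E x * g x)‖ ≤ 1 / (2 * √N) * M := fun x hx => by
    have hEx : ‖E x‖ = 1 := hE x
    rw [norm_mul, norm_mul, hEx, one_mul, Complex.norm_real, Real.norm_eq_abs]
    gcongr
    · exact hhb x
    · exact hgM x hx
  have hL : 0 ≤ L := le_trans (intervalIntegral.integral_nonneg hab fun x _ => norm_nonneg _) hgL
  calc ‖∫ x in a..b, (v x : ℂ) * E x * g x‖
      = ‖k * ∫ x in a..b, (v x : ℂ) * E x * g x‖ := by rw [norm_mul, hk1, one_mul]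
    _ = ‖((h b : ℂ) * (E b * g b) - (h a : ℂ) * (E a * g a)) - ∫ x in a..b, R x‖ := by
        rw [← key, add_sub_cancel_right]
    _ ≤ (1 / (2 * √N) * M + 1 / (2 * √N) * M) + (3 * M * (Real.pi / √N) + 1 / (2 * √N) * L) :=
        (norm_sub_le _ _).trans (add_le_add ((norm_sub_le _ _).trans (add_le_add
          (hFb b ⟨hab, le_rfl⟩) (hFb a ⟨le_rfl, hab⟩))) hRint)
    _ = (M * (1 + 3 * Real.pi) + L / 2) / √N := by field_simp; ring
    _ ≤ _ := by gcongr; linarith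

/-- The oscillatory bound for the phase `N c - (μ / 2) log (tan c)` on `[ε, 1 / 2]`. -/
theorem norm_integral_log_tan_phase_le {ε N M L : ℝ} (μ : ℝ) (hε : 0 < ε) (hε2 : ε ≤ 1 / 2)
    (hN : 0 < N) {g g' : ℝ → ℂ} {k : ℂ} (hk : k.re = 0) (hk1 : ‖k‖ = 1)
    (hg : ∀ x, HasDerivAt g (g' x) x) (hg'c : Continuous g') (hgM : ∀ x, ‖g x‖ ≤ M)
    (hgL : ∫ x in ε..(1 / 2), ‖g' x‖ ≤ L) :
    ‖∫ c in ε..(1 / 2), ((√(Real.sin (2 * c)))⁻¹ : ℝ)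
        * Complex.exp (k * ((N * c - μ / 2 * (Real.log (Real.sin c) - Real.log (Real.cos c)) : ℝ)))
        * g c‖ ≤ (M * (1 + 3 * Real.pi) + L) / √N := by
  have hw : ∀ c ∈ Set.Icc ε (1 / 2), 0 < Real.sin (2 * c) := fun c hc =>
    Real.sin_pos_of_pos_of_lt_pi (by linarith [hc.1]) (by linarith [hc.2, Real.pi_gt_three])
  have hu : ∀ c ∈ Set.Icc ε (1 / 2), 0 < √(Real.sin (2 * c)) := fun c hc => Real.sqrt_pos.2 (hw c hc)
  have hcos : ∀ c ∈ Set.Icc ε (1 / 2), 1 / 2 ≤ Real.cos (2 * c) := fun c hc => by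
    have := Real.one_sub_sq_div_two_le_cos (x := 2 * c)
    nlinarith [hc.1, hc.2]
  have hud : ∀ c ∈ Set.Icc ε (1 / 2), HasDerivAt (fun c => √(Real.sin (2 * c)))
      (Real.cos (2 * c) / √(Real.sin (2 * c))) c := fun c hc => by
    refine ((((hasDerivAt_id c).const_mul 2).sin).sqrt (hw c hc).ne').congr_deriv ?_
    simp only [id]
    field_simp
  have hpd : ∀ ν : ℝ, ∀ c ∈ Set.Icc ε (1 / 2),
      HasDerivAt (fun c => N * √(Real.sin (2 * c)) - ν * (√(Real.sin (2 * c)))⁻¹)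
        ((N + ν / Real.sin (2 * c)) * Real.cos (2 * c) / √(Real.sin (2 * c))) c := fun ν c hc => by
    refine (((hud c hc).const_mul N).sub
      (((hud c hc).inv (hu c hc).ne').const_mul ν)).congr_deriv ?_
    rw [Real.sq_sqrt (hw c hc).le]
    have := (hw c hc).ne'
    have := (hu c hc).ne'
    field_simp
    ring
  have hwc : ContinuousOn (fun c => Real.sin (2 * c)) (Set.Icc ε (1 / 2)) := by fun_prop
  have hp'c : ∀ ν : ℝ, ContinuousOn (fun c =>
      (N + ν / Real.sin (2 * c)) * Real.cos (2 * c) / √(Real.sin (2 * c))) (Set.Icc ε (1 / 2)) :=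
    fun ν => ((continuousOn_const.add (continuousOn_const.div hwc fun c hc => (hw c hc).ne')).mul
      (by fun_prop)).div hwc.sqrt fun c hc => (hu c hc).ne'
  refine norm_integral_oscillatory_le hε2 hN hk hk1 (hpd μ) (hpd |μ|)
    (v := fun c => (√(Real.sin (2 * c)))⁻¹) (g' := g')
    (θ := fun c => N * c - μ / 2 * (Real.log (Real.sin c) - Real.log (Real.cos c)))
    ?_ (fun x _ => hg x) (hp'c μ) (hp'c |μ|) (hwc.sqrt.inv₀ fun c hc => (hu c hc).ne')
    hg'c.continuousOn (fun c _ => by positivity) ?_ ?_ ?_ (fun x _ => hgM x) hgL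
  · intro c hc
    have hsc : 0 < Real.sin c :=
      Real.sin_pos_of_pos_of_lt_pi (by linarith [hc.1]) (by linarith [hc.2, Real.pi_gt_three])
    have hcc : 0 < Real.cos c :=
      Real.cos_pos_of_mem_Ioo ⟨by linarith [hc.1, Real.pi_gt_three],
        by linarith [hc.2, Real.pi_gt_three]⟩
    refine (((hasDerivAt_id c).const_mul N).sub
      ((((Real.hasDerivAt_sin c).log hsc.ne').sub
        ((Real.hasDerivAt_cos c).log hcc.ne')).const_mul (μ / 2))).congr_deriv ?_
    have hu0 := (hu c hc).ne'
    have e1 : (N * √(Real.sin (2 * c)) - μ * (√(Real.sin (2 * c)))⁻¹) * (√(Real.sin (2 * c)))⁻¹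
        = N - μ / √(Real.sin (2 * c)) ^ 2 := by field_simp
    rw [e1, Real.sq_sqrt (hw c hc).le, Real.sin_two_mul]
    have e2 : Real.cos c / Real.sin c - -Real.sin c / Real.cos c
        = 1 / (Real.sin c * Real.cos c) := by
      field_simp
      linarith [Real.sin_sq_add_cos_sq c]
    rw [e2]
    field_simp
  · intro c hc
    have h1 := hw c hc
    have h2 := hu c hc
    have h3 := hcos c hc
    have h4 : 0 < Real.cos (2 * c) := by linarith
    rw [abs_div, abs_mul, abs_of_pos h2, abs_of_pos h4]
    gcongr
    refine (abs_add_le _ _).trans ?_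
    rw [abs_div, abs_of_pos hN, abs_of_pos h1]
  · intro c hc
    have h1 := hw c hc
    have h2 := hu c hc
    have h3 := hcos c hc
    have h4 : 0 ≤ |μ| / Real.sin (2 * c) := by positivity
    rw [← div_eq_mul_inv, ← mul_div_assoc]
    gcongr
    nlinarith
  · intro c hc
    have h2 := hu c hc
    have e : ∀ ν : ℝ, (N * √(Real.sin (2 * c)) - ν * (√(Real.sin (2 * c)))⁻¹) ^ 2
        = N ^ 2 * √(Real.sin (2 * c)) ^ 2 - 2 * N * ν
          + ν ^ 2 * (√(Real.sin (2 * c)))⁻¹ ^ 2 := fun ν => by field_simp; ring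
    rw [e, e, sq_abs]
    nlinarith [le_abs_self μ]

theorem rpowC_neg_half {r : ℝ} (hr : 0 < r) : rpowC r (-(1 / 2)) = ((√r)⁻¹ : ℝ) := by
  have : (√r)⁻¹ = Real.exp (-(1 / 2) * Real.log r) := by
    rw [Real.sqrt_eq_rpow, Real.rpow_def_of_pos hr, ← Real.exp_neg]
    ring_nf
  rw [this, rpowC]
  push_cast
  rfl

/-- A bound on all `∫ x in ε..b` with `0 < ε ≤ b` passes to the limit `ε → 0`. -/
theorem norm_intervalIntegral_zero_le {f : ℝ → ℂ} {b K : ℝ} (hf : Integrable f) (hb : 0 < b)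
    (h : ∀ ε, 0 < ε → ε ≤ b → ‖∫ x in ε..b, f x‖ ≤ K) : ‖∫ x in (0 : ℝ)..b, f x‖ ≤ K := by
  have hc : Continuous fun ε => ∫ x in b..ε, f x :=
    intervalIntegral.continuous_primitive (fun _ _ => hf.intervalIntegrable) b
  rw [intervalIntegral.integral_symm, norm_neg]
  refine le_of_tendsto (x := nhdsWithin (0 : ℝ) (Set.Ioi 0))
    ((hc.norm.tendsto 0).mono_left nhdsWithin_le_nhds) ?_
  filter_upwards [Ioc_mem_nhdsGT hb] with ε hε
  rw [intervalIntegral.integral_symm, norm_neg]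
  exact h ε hε.1 hε.2

/-- Appendix A.3, stationary-point range: `|I(λ,N,T)| ≤ C·T·N^{−1/2}` for `|λ| ≤ N/T`. -/
theorem model_integral_stationary_bound
    (χ : ℝ → ℂ) (hχ_smooth : ContDiff ℝ (⊤ : ℕ∞) χ)
    (hχ_supp : Function.support χ ⊆ Set.Icc (-(1 / 4) : ℝ) (1 / 4)) :
    ∃ C : ℝ, 0 < C ∧ ∀ N T : ℝ, 1 ≤ T → T ≤ N →
      ∀ lam : ℂ, lam.re = 0 → ‖lam‖ ≤ N / T →
        ‖modelInt χ lam N T‖ ≤ C * T * N ^ (-(1 : ℝ) / 2) := by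
  have hsupp : HasCompactSupport χ :=
    HasCompactSupport.of_support_subset_isCompact isCompact_Icc hχ_supp
  have hdiff : Differentiable ℝ χ := hχ_smooth.differentiable (by simp)
  have hd'c : Continuous (deriv χ) := hχ_smooth.continuous_deriv (by simp)
  obtain ⟨M, hM⟩ := hsupp.exists_bound_of_continuous hχ_smooth.continuous
  have hM0 : 0 ≤ M := (norm_nonneg _).trans (hM 0)
  have hdint : Integrable (fun x => ‖deriv χ x‖) :=
    (hd'c.integrable_of_hasCompactSupport hsupp.deriv).norm
  set L := ∫ x, ‖deriv χ x‖
  have hL0 : 0 ≤ L := integral_nonneg fun x => norm_nonneg _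
  have hscale : ∀ s : ℝ, s ≠ 0 → ∀ ε, ε ≤ (1 / 2 : ℝ) →
      ∫ x in ε..(1 / 2), ‖s • deriv χ (s * x)‖ ≤ L := fun s hs ε hε => by
    have hi : Integrable fun x => ‖s • deriv χ (s * x)‖ := by
      simp only [norm_smul]
      exact (hdint.comp_mul_left' hs).const_mul _
    rw [intervalIntegral.integral_of_le hε]
    refine (setIntegral_le_integral hi
      (Filter.Eventually.of_forall fun x => norm_nonneg _)).trans_eq ?_
    simp only [norm_smul]
    rw [integral_const_mul, Measure.integral_comp_mul_left (fun x => ‖deriv χ x‖), abs_inv,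
      smul_eq_mul, Real.norm_eq_abs, mul_inv_cancel_left₀ (abs_pos.2 hs).ne']
  set K := M * (1 + 3 * Real.pi) + L
  have hK0 : 0 ≤ K := by have := Real.pi_pos; positivity
  refine ⟨2 * K + 1, by positivity, fun N T hT hTN lam hre _ => ?_⟩
  have hT0 : 0 < T := by linarith
  have hN : 0 < N := by linarith
  have hlam : lam = (lam.im : ℂ) * Complex.I := by
    apply Complex.ext <;> simp [hre]
  set μ := lam.im
  have hpow : N ^ (-(1 : ℝ) / 2) = 1 / √N := by
    rw [neg_div, Real.rpow_neg hN.le, ← Real.sqrt_eq_rpow, one_div]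
  rw [hpow, modelInt, norm_mul, Complex.norm_real, Real.norm_of_nonneg hT0.le]
  set f : ℝ → ℂ := fun c => Complex.exp (-Complex.I * (N : ℂ) * (c : ℂ)) *
      rpowC |Real.sin (2 * c)| (-(1 / 2)) * rpowC |Real.sin c| (lam / 2) *
      rpowC |Real.cos c| (-(lam / 2)) * χ (T * c) with hf
  suffices hmain : ‖∫ c, f c‖ ≤ 2 * K / √N by
    have hs : 0 < √N := Real.sqrt_pos.2 hN
    calc T * ‖∫ c, f c‖ ≤ T * (2 * K / √N) := by gcongr
      _ = 2 * K * T * (1 / √N) := by ring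
      _ ≤ (2 * K + 1) * T * (1 / √N) := by gcongr; linarith
  by_cases hfi : Integrable f
  swap
  · rw [integral_undef hfi, norm_zero]
    positivity
  have hfs : Function.support f ⊆ Set.Ioc (-(1 / 2)) (1 / 2) := fun c hc => by
    have h1 : T * c ∈ Set.Icc (-(1 / 4) : ℝ) (1 / 4) := hχ_supp (right_ne_zero_of_mul hc)
    constructor
    · by_contra! h; nlinarith [h1.1]
    · by_contra! h; nlinarith [h1.2]
  have hpos : ∀ c ∈ Set.Ioc (0 : ℝ) (1 / 2),
      0 < Real.sin (2 * c) ∧ 0 < Real.sin c ∧ 0 < Real.cos c := fun c hc =>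
    ⟨Real.sin_pos_of_pos_of_lt_pi (by linarith [hc.1]) (by linarith [hc.2, Real.pi_gt_three]),
      Real.sin_pos_of_pos_of_lt_pi (by linarith [hc.1]) (by linarith [hc.2, Real.pi_gt_three]),
      Real.cos_pos_of_mem_Ioo ⟨by linarith [hc.1, Real.pi_gt_three],
        by linarith [hc.2, Real.pi_gt_three]⟩⟩
  have hright : ‖∫ c in (0 : ℝ)..(1 / 2), f c‖ ≤ K / √N := by
    refine norm_intervalIntegral_zero_le hfi (by norm_num) fun ε hε hε2 => ?_
    refine le_of_eq_of_le (congrArg _ ?_) (norm_integral_log_tan_phase_le (L := L) μ hε hε2 hN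
      (k := -Complex.I) (g := fun c => χ (T * c)) (g' := fun c => T • deriv χ (T * c))
      (by simp) (by simp) (fun x => ?_) (by fun_prop) (fun x => hM _) (hscale T hT0.ne' ε hε2))
    · refine intervalIntegral.integral_congr fun c hc => ?_
      rw [Set.uIcc_of_le hε2] at hc
      obtain ⟨h1, h2, h3⟩ := hpos c ⟨hε.trans_le hc.1, hc.2⟩
      simp only [hf]
      rw [abs_of_pos h1, abs_of_pos h2, abs_of_pos h3, rpowC_neg_half h1, rpowC, rpowC, hlam,
        mul_comm (Complex.exp _) (Complex.ofReal _), mul_assoc (Complex.ofReal _),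
        mul_assoc (Complex.ofReal _), ← Complex.exp_add, ← Complex.exp_add]
      congr 3
      push_cast
      ring
    · exact (hdiff _).hasDerivAt.scomp x (((hasDerivAt_id' x).const_mul T).congr_deriv (mul_one _))
  have hleft : ‖∫ c in (0 : ℝ)..(1 / 2), f (-c)‖ ≤ K / √N := by
    refine norm_intervalIntegral_zero_le hfi.comp_neg (by norm_num) fun ε hε hε2 => ?_
    refine le_of_eq_of_le (congrArg _ ?_) (norm_integral_log_tan_phase_le (L := L) (-μ) hε hε2 hN
      (k := Complex.I) (g := fun c => χ (-T * c)) (g' := fun c => (-T) • deriv χ (-T * c))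
      (by simp) (by simp) (fun x => ?_) (by fun_prop) (fun x => hM _)
      (hscale (-T) (neg_ne_zero.2 hT0.ne') ε hε2))
    · refine intervalIntegral.integral_congr fun c hc => ?_
      rw [Set.uIcc_of_le hε2] at hc
      obtain ⟨h1, h2, h3⟩ := hpos c ⟨hε.trans_le hc.1, hc.2⟩
      simp only [hf]
      rw [mul_neg, mul_neg T, ← neg_mul T, Real.sin_neg, Real.sin_neg, Real.cos_neg, abs_neg,
        abs_neg, abs_of_pos h1, abs_of_pos h2, abs_of_pos h3, rpowC_neg_half h1, rpowC, rpowC, hlam,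
        mul_comm (Complex.exp _) (Complex.ofReal _), mul_assoc (Complex.ofReal _),
        mul_assoc (Complex.ofReal _), ← Complex.exp_add, ← Complex.exp_add]
      congr 3
      push_cast
      ring
    · exact (hdiff _).hasDerivAt.scomp x
        (((hasDerivAt_id' x).const_mul (-T)).congr_deriv (mul_one _))
  rw [← intervalIntegral.integral_eq_integral_of_support_subset hfs,
    ← intervalIntegral.integral_add_adjacent_intervals (b := 0) hfi.intervalIntegrable
      hfi.intervalIntegrable]
  rw [intervalIntegral.integral_comp_neg, neg_zero] at hleft
  calc _ ≤ K / √N + K / √N := (norm_add_le _ _).trans (add_le_add hleft hright)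
    _ = _ := by ring
end
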